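/- (Independence theorem for two co-NSOP_1 types) Let T be NSOP_3, let p(x), q(x) be co-NSOP_1 partial types over M, let a ≡_M a' be tuples of realizations of p, and let b, c be tuples of realizations of q, with a ⫝^{K*}_M b, a' ⫝^{K*}_M c, and c ⫝^{K*}_M b. Then there is a'' with a'' ⫝^{K*}_M bc and a'' ⊨ tp(a/Mb) ∪ tp(a'/Mc). -/

import Mathlib

namespace NSOP3Paper

open FirstOrder Language

universe u v w w' w₂ x y z

/-- Consistency (equivalently, by compactness over the monster model, finite
satisfiability) of a family of conditions on tuples. -/
def FamConsistent {ι : Type*} {X : Type*} (C : ι → X → Prop) : Prop :=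
  ∀ s : Finset ι, ∃ xx : X, ∀ i ∈ s, C i xx

/-- `k`-inconsistency of a family of conditions: any `k` of them (with pairwise
distinct indices) are jointly unsatisfiable. -/
def FamKInconsistent {ι : Type*} {X : Type*} (k : ℕ) (C : ι → X → Prop) : Prop :=
  ∀ s : Finset ι, s.card = k → ¬∃ xx : X, ∀ i ∈ s, C i xx

/-- Flattening of a family of tuples into a single tuple. -/
def flat {𝕄 : Type w} {ι : Type*} {β : Type*} (a : ι → β → 𝕄) : ι × β → 𝕄 :=
  fun q => a q.1 q.2

/-- A first-order `L`-formula in free variables `α`, together with a tuple of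
parameters from `𝕄`; this represents an instance `φ(x̄, b̄)`. -/
structure ParamFormula (L : FirstOrder.Language.{u, v}) (𝕄 : Type w) [L.Structure 𝕄]
    (α : Type w') where
  Params : Type
  toFormula : L.Formula (α ⊕ Params)
  params : Params → 𝕄

namespace ParamFormula

variable {L : FirstOrder.Language.{u, v}} {𝕄 : Type w} [L.Structure 𝕄] {α : Type w'}

/-- Realization of `φ(x̄, b̄)` at a tuple from `𝕄`. -/
def Realize (φ : ParamFormula L 𝕄 α) (xx : α → 𝕄) : Prop :=
  φ.toFormula.Realize (Sum.elim xx φ.params)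

/-- All parameters of `φ` lie in `A`; i.e. `φ ∈ L(A)`. -/
def ParamsIn (φ : ParamFormula L 𝕄 α) (A : Set 𝕄) : Prop :=
  ∀ i, φ.params i ∈ A

/-- Negation of a formula with parameters. -/
protected def not (φ : ParamFormula L 𝕄 α) : ParamFormula L 𝕄 α :=
  ⟨φ.Params, BoundedFormula.not φ.toFormula, φ.params⟩

/-- Substitute a tuple of elements of `𝕄` for the second group of free variables,
obtaining the instance `φ(x̄, c̄)` as a formula with parameters. -/
def subst {γ : Type} (φ : ParamFormula L 𝕄 (α ⊕ γ)) (c : γ → 𝕄) : ParamFormula L 𝕄 α :=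
  ⟨γ ⊕ φ.Params,
    (φ.toFormula).relabel (Sum.elim (Sum.map id Sum.inl) (Sum.inr ∘ Sum.inr)),
    Sum.elim c φ.params⟩

end ParamFormula

section TypesDefs

variable (L : FirstOrder.Language.{u, v}) (𝕄 : Type w) [L.Structure 𝕄]

/-- Two tuples have the same type over the parameter set `A` (written `b ≡_A b'`). -/
def TpEq (A : Set 𝕄) {β : Type w'} (b b' : β → 𝕄) : Prop :=
  ∀ φ : ParamFormula L 𝕄 β, φ.ParamsIn A → (φ.Realize b ↔ φ.Realize b')

/-- A complete global type in variables `α`: a complete, consistent set of formulas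
with parameters from the monster model `𝕄`. -/
structure GlobalType (α : Type w') where
  Mem : ParamFormula L 𝕄 α → Prop
  consistent : ∀ S : Finset (ParamFormula L 𝕄 α), (∀ φ ∈ S, Mem φ) →
    ∃ xx : α → 𝕄, ∀ φ ∈ S, φ.Realize xx
  complete : ∀ φ : ParamFormula L 𝕄 α, Mem φ ∨ Mem φ.not

/-- A sequence of tuples is indiscernible over the parameter set `A`: any two finite
increasing subtuples of the same length have the same type over `A`. -/
def IndiscernibleOver (A : Set 𝕄) {β : Type w'} (b : ℕ → β → 𝕄) : Prop :=
  ∀ (n : ℕ) (f g : Fin n → ℕ), StrictMono f → StrictMono g →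
    TpEq L 𝕄 A (fun q : Fin n × β => b (f q.1) q.2) (fun q : Fin n × β => b (g q.1) q.2)

end TypesDefs

namespace GlobalType

variable {L : FirstOrder.Language.{u, v}} {𝕄 : Type w} [L.Structure 𝕄] {α : Type w'}

/-- A global type is invariant over `A` if membership of `φ(x̄, b̄)` depends only on
the type of `b̄` over `A`. -/
def InvariantOver (p : GlobalType L 𝕄 α) (A : Set 𝕄) : Prop :=
  ∀ (P : Type) (ψ : L.Formula (α ⊕ P)) (b b' : P → 𝕄),
    TpEq L 𝕄 A b b' → (p.Mem ⟨P, ψ, b⟩ ↔ p.Mem ⟨P, ψ, b'⟩)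

/-- A global type is finitely satisfiable in `A` if each of its formulas is satisfied
by a tuple from `A`. -/
def FinSatIn (p : GlobalType L 𝕄 α) (A : Set 𝕄) : Prop :=
  ∀ φ : ParamFormula L 𝕄 α, p.Mem φ → ∃ xx : α → 𝕄, (∀ i, xx i ∈ A) ∧ φ.Realize xx

/-- `a ⊨ p|_B` : the tuple `a` realizes the restriction of the global type `p` to the
parameter set `B`. -/
def RealizesOver (p : GlobalType L 𝕄 α) (B : Set 𝕄) (a : α → 𝕄) : Prop :=
  ∀ φ : ParamFormula L 𝕄 α, p.Mem φ → φ.ParamsIn B → φ.Realize a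

/-- `(b i)` is a Morley sequence in `p` over `A`: each `b i ⊨ p|_{A b_{<i}}`. -/
def IsMorleyOver (p : GlobalType L 𝕄 α) (A : Set 𝕄) (b : ℕ → α → 𝕄) : Prop :=
  ∀ i : ℕ, p.RealizesOver (A ∪ ⋃ j ∈ Set.Iio i, Set.range (b j)) (b i)

end GlobalType

section MorleyDefs

variable (L : FirstOrder.Language.{u, v}) (𝕄 : Type w) [L.Structure 𝕄]

/-- `(b i)` is an invariant Morley sequence over `A`: a Morley sequence in some global
type invariant over `A`. -/
def IsInvMorleyOver (A : Set 𝕄) {α : Type w'} (b : ℕ → α → 𝕄) : Prop :=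
  ∃ p : GlobalType L 𝕄 α, p.InvariantOver A ∧ p.IsMorleyOver A b

/-- `(b i)` is a coheir Morley sequence over `A`: a Morley sequence in some global
type finitely satisfiable in `A`. -/
def IsCoheirMorleyOver (A : Set 𝕄) {α : Type w'} (b : ℕ → α → 𝕄) : Prop :=
  ∃ p : GlobalType L 𝕄 α, p.FinSatIn A ∧ p.IsMorleyOver A b

end MorleyDefs

namespace ParamFormula

variable {L : FirstOrder.Language.{u, v}} {𝕄 : Type w} [L.Structure 𝕄] {α : Type w'}

/-- `φ(x̄, b̄)` Kim-divides over `A`: some invariant Morley sequence over `A` starting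
with `b̄` makes the corresponding instances inconsistent. -/
def KimDividesOver (φ : ParamFormula L 𝕄 α) (A : Set 𝕄) : Prop :=
  ∃ b : ℕ → φ.Params → 𝕄, b 0 = φ.params ∧ IsInvMorleyOver L 𝕄 A b ∧
    ¬FamConsistent fun (i : ℕ) (xx : α → 𝕄) => φ.toFormula.Realize (Sum.elim xx (b i))

/-- `φ(x̄, b̄)` Conant-divides over `A`: every invariant Morley sequence over `A`
starting with `b̄` makes the corresponding instances inconsistent. -/
def ConantDividesOver (φ : ParamFormula L 𝕄 α) (A : Set 𝕄) : Prop :=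
  ∀ b : ℕ → φ.Params → 𝕄, b 0 = φ.params → IsInvMorleyOver L 𝕄 A b →
    ¬FamConsistent fun (i : ℕ) (xx : α → 𝕄) => φ.toFormula.Realize (Sum.elim xx (b i))

/-- `φ(x̄, b̄)` divides over `A`: some `A`-indiscernible sequence starting with `b̄`
makes the corresponding instances inconsistent. -/
def DividesOver (φ : ParamFormula L 𝕄 α) (A : Set 𝕄) : Prop :=
  ∃ b : ℕ → φ.Params → 𝕄, b 0 = φ.params ∧ IndiscernibleOver L 𝕄 A b ∧
    ¬FamConsistent fun (i : ℕ) (xx : α → 𝕄) => φ.toFormula.Realize (Sum.elim xx (b i))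

/-- `φ` Kim-forks over `A`: it implies a finite disjunction of formulas Kim-dividing
over `A`. -/
def KimForksOver (φ : ParamFormula L 𝕄 α) (A : Set 𝕄) : Prop :=
  ∃ (k : ℕ) (ψ : Fin k → ParamFormula L 𝕄 α), (∀ j, (ψ j).KimDividesOver A) ∧
    ∀ xx : α → 𝕄, φ.Realize xx → ∃ j, (ψ j).Realize xx

/-- `φ` Conant-forks over `A`: it implies a finite disjunction of formulas
Conant-dividing over `A`. -/
def ConantForksOver (φ : ParamFormula L 𝕄 α) (A : Set 𝕄) : Prop :=
  ∃ (k : ℕ) (ψ : Fin k → ParamFormula L 𝕄 α), (∀ j, (ψ j).ConantDividesOver A) ∧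
    ∀ xx : α → 𝕄, φ.Realize xx → ∃ j, (ψ j).Realize xx

/-- `φ` forks over `A`: it implies a finite disjunction of formulas dividing over `A`. -/
def ForksOver (φ : ParamFormula L 𝕄 α) (A : Set 𝕄) : Prop :=
  ∃ (k : ℕ) (ψ : Fin k → ParamFormula L 𝕄 α), (∀ j, (ψ j).DividesOver A) ∧
    ∀ xx : α → 𝕄, φ.Realize xx → ∃ j, (ψ j).Realize xx

end ParamFormula

section IndDefs

variable (L : FirstOrder.Language.{u, v}) (𝕄 : Type w) [L.Structure 𝕄]

/-- `a ⫝^K_A B` : `tp(a/A ∪ B)` contains no formula Kim-forking over `A`. -/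
def IndKim (A B : Set 𝕄) {γ : Type w'} (a : γ → 𝕄) : Prop :=
  ∀ φ : ParamFormula L 𝕄 γ, φ.ParamsIn (A ∪ B) → φ.Realize a → ¬φ.KimForksOver A

/-- `a ⫝^{Kd}_A B` : `tp(a/A ∪ B)` contains no formula Kim-dividing over `A`. -/
def IndKd (A B : Set 𝕄) {γ : Type w'} (a : γ → 𝕄) : Prop :=
  ∀ φ : ParamFormula L 𝕄 γ, φ.ParamsIn (A ∪ B) → φ.Realize a → ¬φ.KimDividesOver A

/-- `a ⫝^{K*}_A B` : Conant-independence. -/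
def IndConant (A B : Set 𝕄) {γ : Type w'} (a : γ → 𝕄) : Prop :=
  ∀ φ : ParamFormula L 𝕄 γ, φ.ParamsIn (A ∪ B) → φ.Realize a → ¬φ.ConantForksOver A

/-- `a ⫝^{K*d}_A B` : Conant-dividing independence. -/
def IndConantD (A B : Set 𝕄) {γ : Type w'} (a : γ → 𝕄) : Prop :=
  ∀ φ : ParamFormula L 𝕄 γ, φ.ParamsIn (A ∪ B) → φ.Realize a → ¬φ.ConantDividesOver A

/-- `a ⫝^f_A B` : forking-independence. -/
def IndForking (A B : Set 𝕄) {γ : Type w'} (a : γ → 𝕄) : Prop :=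
  ∀ φ : ParamFormula L 𝕄 γ, φ.ParamsIn (A ∪ B) → φ.Realize a → ¬φ.ForksOver A

/-- `a ⫝^i_A B` : `tp(a/A ∪ B)` extends to a global type invariant over `A`. -/
def IndInv (A B : Set 𝕄) {γ : Type w'} (a : γ → 𝕄) : Prop :=
  ∃ p : GlobalType L 𝕄 γ, p.InvariantOver A ∧
    ∀ φ : ParamFormula L 𝕄 γ, φ.ParamsIn (A ∪ B) → φ.Realize a → p.Mem φ

/-- `a ⫝^u_A B` : `tp(a/A ∪ B)` extends to a global type finitely satisfiable in `A`. -/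
def IndFinSat (A B : Set 𝕄) {γ : Type w'} (a : γ → 𝕄) : Prop :=
  ∃ p : GlobalType L 𝕄 γ, p.FinSatIn A ∧
    ∀ φ : ParamFormula L 𝕄 γ, φ.ParamsIn (A ∪ B) → φ.Realize a → p.Mem φ

/-- `a ⫝^{K+}_A b` : there is an invariant Morley sequence over `A` starting with `b`
that is indiscernible over `A ∪ a`. -/
def IndKPlus (A : Set 𝕄) {δ : Type w'} {γ : Type w₂} (b : δ → 𝕄) (a : γ → 𝕄) : Prop :=
  ∃ bs : ℕ → δ → 𝕄, bs 0 = b ∧ IsInvMorleyOver L 𝕄 A bs ∧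
    IndiscernibleOver L 𝕄 (A ∪ Set.range a) bs

/-- `a ⫝^{K+u}_A b` : there is a coheir Morley sequence over `A` starting with `b`
that is indiscernible over `A ∪ a`. -/
def IndKPlusU (A : Set 𝕄) {δ : Type w'} {γ : Type w₂} (b : δ → 𝕄) (a : γ → 𝕄) : Prop :=
  ∃ bs : ℕ → δ → 𝕄, bs 0 = b ∧ IsCoheirMorleyOver L 𝕄 A bs ∧
    IndiscernibleOver L 𝕄 (A ∪ Set.range a) bs

/-- Conant-independence `⫝^{K*}` is symmetric (over every small model). -/
def ConantSymmetric : Prop :=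
  ∀ (M : L.ElementarySubstructure 𝕄) (γ δ : Type w) (a : γ → 𝕄) (b : δ → 𝕄),
    IndConant L 𝕄 (M : Set 𝕄) (Set.range b) a → IndConant L 𝕄 (M : Set 𝕄) (Set.range a) b

/-- Conant-dividing independence `⫝^{K*d}` is symmetric. -/
def ConantDSymmetric : Prop :=
  ∀ (M : L.ElementarySubstructure 𝕄) (γ δ : Type w) (a : γ → 𝕄) (b : δ → 𝕄),
    IndConantD L 𝕄 (M : Set 𝕄) (Set.range b) a → IndConantD L 𝕄 (M : Set 𝕄) (Set.range a) b

/-- The relation `⫝^{K+}` is symmetric. -/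
def KPlusSymmetric : Prop :=
  ∀ (M : L.ElementarySubstructure 𝕄) (γ δ : Type w) (a : γ → 𝕄) (b : δ → 𝕄),
    IndKPlus L 𝕄 (M : Set 𝕄) b a → IndKPlus L 𝕄 (M : Set 𝕄) a b

/-- Forking-independence satisfies the chain condition with respect to invariant
Morley sequences. -/
def ChainConditionF : Prop :=
  ∀ (M : L.ElementarySubstructure 𝕄) (γ δ : Type w) (a : γ → 𝕄) (bs : ℕ → δ → 𝕄),
    IsInvMorleyOver L 𝕄 (M : Set 𝕄) bs →
    IndForking L 𝕄 (M : Set 𝕄) (Set.range (bs 0)) a →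
    ∃ bs' : ℕ → δ → 𝕄,
      TpEq L 𝕄 ((M : Set 𝕄) ∪ Set.range (bs 0)) (flat bs') (flat bs) ∧
      IndiscernibleOver L 𝕄 ((M : Set 𝕄) ∪ Set.range a) bs' ∧
      IndForking L 𝕄 (M : Set 𝕄) (Set.range (flat bs')) a

/-- Kim-independence satisfies the chain condition with respect to invariant Morley
sequences. -/
def ChainConditionK : Prop :=
  ∀ (M : L.ElementarySubstructure 𝕄) (γ δ : Type w) (a : γ → 𝕄) (bs : ℕ → δ → 𝕄),
    IsInvMorleyOver L 𝕄 (M : Set 𝕄) bs →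
    IndKim L 𝕄 (M : Set 𝕄) (Set.range (bs 0)) a →
    ∃ bs' : ℕ → δ → 𝕄,
      TpEq L 𝕄 ((M : Set 𝕄) ∪ Set.range (bs 0)) (flat bs') (flat bs) ∧
      IndiscernibleOver L 𝕄 ((M : Set 𝕄) ∪ Set.range a) bs' ∧
      IndKim L 𝕄 (M : Set 𝕄) (Set.range (flat bs')) a

/-- `T` is NSOP₃: there is no definable binary relation on tuples with no 3-cycles
containing an infinite chain. -/
def IsNSOP3 : Prop :=
  ¬∃ (m : ℕ) (R : ParamFormula L 𝕄 (Fin m ⊕ Fin m)) (a : ℕ → Fin m → 𝕄),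
    (∀ i j : ℕ, i < j → R.Realize (Sum.elim (a i) (a j))) ∧
    ¬∃ x1 x2 x3 : Fin m → 𝕄,
      R.Realize (Sum.elim x1 x2) ∧ R.Realize (Sum.elim x2 x3) ∧ R.Realize (Sum.elim x3 x1)

/-- `𝕄` is a `κ`-monster: every consistent type in fewer than `κ` variables over a
parameter set of size less than `κ` is realized. -/
class IsMonster (κ : Cardinal.{w}) : Prop where
  saturated : ∀ {α : Type w} (A : Set 𝕄) (S : Set (ParamFormula L 𝕄 α)),
    Cardinal.mk α < κ → Cardinal.mk A < κ → (∀ φ ∈ S, φ.ParamsIn A) →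
    (∀ S₀ : Finset (ParamFormula L 𝕄 α), (∀ φ ∈ S₀, φ ∈ S) →
      ∃ xx : α → 𝕄, ∀ φ ∈ S₀, φ.Realize xx) →
    ∃ xx : α → 𝕄, ∀ φ ∈ S, φ.Realize xx

/-- A tuple realizes the partial type `P`. -/
def RealizesPType {nv : ℕ} (P : Set (ParamFormula L 𝕄 (Fin nv))) (a : Fin nv → 𝕄) : Prop :=
  ∀ φ ∈ P, φ.Realize a

/-- `p(x̄)` is co-NSOP₁: no `L(M)`-formula `φ(x̄, ȳ)` and tree of tuples of
realizations of `p` witness SOP₁-style consistency/inconsistency. -/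
def CoNSOP1 (M : Set 𝕄) {nv : ℕ} (P : Set (ParamFormula L 𝕄 (Fin nv))) : Prop :=
  ¬∃ (k m : ℕ) (φ : ParamFormula L 𝕄 (Fin k ⊕ (Fin m × Fin nv)))
      (b : List Bool → Fin m → Fin nv → 𝕄),
    φ.ParamsIn M ∧
    (∀ η j, RealizesPType L 𝕄 P (b η j)) ∧
    (∀ σ : ℕ → Bool, FamConsistent fun (n : ℕ) (xx : Fin k → 𝕄) =>
      (φ.subst (flat (b (List.ofFn fun i : Fin n => σ i)))).Realize xx) ∧
    (∀ η₁ η₂ : List Bool, (η₁ ++ [false]) <+: η₂ →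
      ¬∃ xx : Fin k → 𝕄, (φ.subst (flat (b η₂))).Realize xx ∧
        (φ.subst (flat (b (η₁ ++ [true])))).Realize xx)

/-- The set of realizations of the partial type `P`. -/
def PRealizations {nv : ℕ} (P : Set (ParamFormula L 𝕄 (Fin nv))) : Type w :=
  { a : Fin nv → 𝕄 // RealizesPType L 𝕄 P a }

/-- The language `L_p` associated to a partial `nv`-type: an `m`-ary relation symbol
for each `L(M)`-formula in `m` groups of `nv` variables. -/
def pLang (M : Set 𝕄) (nv : ℕ) : Language :=
  ⟨fun _ => Empty, fun m => { φ : ParamFormula L 𝕄 (Fin m × Fin nv) // φ.ParamsIn M }⟩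

/-- The structure `M_p` on the set of realizations of `p`, with relations interpreted
by the corresponding formulas in `𝕄`. -/
instance pStruct (M : Set 𝕄) {nv : ℕ} (P : Set (ParamFormula L 𝕄 (Fin nv))) :
    (pLang L 𝕄 M nv).Structure (PRealizations L 𝕄 P) where
  funMap := fun {n} f _ => f.elim
  RelMap := fun {m} R xs => R.1.Realize fun q : Fin m × Fin nv => (xs q.1).1 q.2

end IndDefs

/-- An SOP₁ pattern witnessed inside the structure `W`. -/
def SOP1PatternIn (L' : FirstOrder.Language.{x, y}) (W : Type z) [L'.Structure W] : Prop :=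
  ∃ (k n : ℕ) (φ : L'.Formula (Fin k ⊕ Fin n)) (bt : List Bool → Fin n → W),
    (∀ σ : ℕ → Bool, FamConsistent fun (i : ℕ) (xx : Fin k → W) =>
      φ.Realize (Sum.elim xx (bt (List.ofFn fun j : Fin i => σ j)))) ∧
    (∀ η₁ η₂ : List Bool, (η₁ ++ [false]) <+: η₂ →
      ¬∃ xx : Fin k → W, φ.Realize (Sum.elim xx (bt η₂)) ∧
        φ.Realize (Sum.elim xx (bt (η₁ ++ [true]))))

/-- The complete theory of `N` is NSOP₁: no SOP₁ pattern in any elementarily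
equivalent structure. -/
def IsNSOP1Th (L' : FirstOrder.Language.{x, y}) (N : Type z) [L'.Structure N] : Prop :=
  ¬∃ (W : Type (max x y z)) (S : L'.Structure W),
    L'.completeTheory N = @Language.completeTheory L' W S ∧ @SOP1PatternIn L' W S

/-- The formula `φ(x̄, ȳ)` has the tree property, witnessed in `W`. -/
def FormulaTPIn (L' : FirstOrder.Language.{x, y}) (W : Type z) [L'.Structure W]
    {k n : ℕ} (φ : L'.Formula (Fin k ⊕ Fin n)) : Prop :=
  ∃ (kk : ℕ) (bt : List ℕ → Fin n → W),
    (∀ σ : ℕ → ℕ, FamConsistent fun (i : ℕ) (xx : Fin k → W) =>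
      φ.Realize (Sum.elim xx (bt (List.ofFn fun j : Fin i => σ j)))) ∧
    (∀ η : List ℕ, FamKInconsistent kk fun (j : ℕ) (xx : Fin k → W) =>
      φ.Realize (Sum.elim xx (bt (η ++ [j]))))

/-- The formula `φ(x̄, ȳ)` has SOP₁, witnessed in `W`. -/
def FormulaSOP1In (L' : FirstOrder.Language.{x, y}) (W : Type z) [L'.Structure W]
    {k n : ℕ} (φ : L'.Formula (Fin k ⊕ Fin n)) : Prop :=
  ∃ bt : List Bool → Fin n → W,
    (∀ σ : ℕ → Bool, FamConsistent fun (i : ℕ) (xx : Fin k → W) =>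
      φ.Realize (Sum.elim xx (bt (List.ofFn fun j : Fin i => σ j)))) ∧
    (∀ η₁ η₂ : List Bool, (η₁ ++ [false]) <+: η₂ →
      ¬∃ xx : Fin k → W, φ.Realize (Sum.elim xx (bt η₂)) ∧
        φ.Realize (Sum.elim xx (bt (η₁ ++ [true]))))

/-- Longest common prefix (meet in the tree `2^{<ω}`). -/
def meet : List Bool → List Bool → List Bool
  | a :: as, b :: bs => if a = b then a :: meet as bs else []
  | _, _ => []

/-- Strict tree order (strict prefix) on `2^{<ω}`. -/
def StrictPrefix (η ν : List Bool) : Prop := η <+: ν ∧ η ≠ ν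

/-- Lexicographic order on `2^{<ω}`. -/
def LexLt (η ν : List Bool) : Prop :=
  StrictPrefix η ν ∨ ((meet η ν ++ [false]) <+: η ∧ (meet η ν ++ [true]) <+: ν)

/-- The meet `c 0 ∧ … ∧ c k`. -/
def meetInit (c : ℕ → List Bool) : ℕ → List Bool
  | 0 => c 0
  | k + 1 => meet (meetInit c k) (c (k + 1))

/-- `c 0, …, c (l-1)` is a descending comb: a lexicographically increasing antichain
whose successive meets form a strictly descending chain in the tree order. -/
def IsDescendingComb (l : ℕ) (c : ℕ → List Bool) : Prop :=
  (∀ i j, i < l → j < l → i ≠ j → ¬(c i <+: c j)) ∧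
  (∀ i j, i < j → j < l → LexLt (c i) (c j)) ∧
  (∀ k, k + 1 < l → StrictPrefix (meetInit c (k + 1)) (meetInit c k))

section DCTP

variable (L : FirstOrder.Language.{u, v}) (𝕄 : Type w) [L.Structure 𝕄]

/-- `T` has `k`-DCTP₂. -/
def HasKDCTP2 (k : ℕ) : Prop :=
  ∃ (kx ny : ℕ) (φ : ParamFormula L 𝕄 (Fin kx ⊕ Fin ny)) (b : List Bool → Fin ny → 𝕄),
    (∀ σ : ℕ → Bool, FamKInconsistent k fun (n : ℕ) (xx : Fin kx → 𝕄) =>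
      (φ.subst (b (List.ofFn fun i : Fin n => σ i))).Realize xx) ∧
    (∀ (l : ℕ) (c : ℕ → List Bool), IsDescendingComb l c →
      ∃ xx : Fin kx → 𝕄, ∀ i < l, (φ.subst (b (c i))).Realize xx)

/-- `T` is N-ω-DCTP₂: it does not have `k`-DCTP₂ for any `k`. -/
def NOmegaDCTP2 : Prop := ∀ k : ℕ, ¬HasKDCTP2 L 𝕄 k

/-- A generic triple of sets of realizations of three partial types: the three sets
begin mutually indiscernible invariant Morley sequences over `M`. -/
def GenericTriple (M : Set 𝕄) {ι₁ ι₂ ι₃ : Type w} {nv₁ nv₂ nv₃ : ℕ}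
    (A : ι₁ → Fin nv₁ → 𝕄) (B : ι₂ → Fin nv₂ → 𝕄) (C : ι₃ → Fin nv₃ → 𝕄) : Prop :=
  ∃ (IA : ℕ → ι₁ → Fin nv₁ → 𝕄) (IB : ℕ → ι₂ → Fin nv₂ → 𝕄) (IC : ℕ → ι₃ → Fin nv₃ → 𝕄),
    IA 0 = A ∧ IB 0 = B ∧ IC 0 = C ∧
    IsInvMorleyOver L 𝕄 M (fun i => flat (IA i)) ∧
    IsInvMorleyOver L 𝕄 M (fun i => flat (IB i)) ∧
    IsInvMorleyOver L 𝕄 M (fun i => flat (IC i)) ∧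
    IndiscernibleOver L 𝕄
      (M ∪ Set.range (flat fun i => flat (IB i)) ∪ Set.range (flat fun i => flat (IC i)))
      (fun i => flat (IA i)) ∧
    IndiscernibleOver L 𝕄
      (M ∪ Set.range (flat fun i => flat (IA i)) ∪ Set.range (flat fun i => flat (IC i)))
      (fun i => flat (IB i)) ∧
    IndiscernibleOver L 𝕄
      (M ∪ Set.range (flat fun i => flat (IA i)) ∪ Set.range (flat fun i => flat (IB i)))
      (fun i => flat (IC i))

end DCTP

/-- The language of hypergraph sequences: one `n`-ary relation symbol for each `n`. -/
def hgLang : FirstOrder.Language.{0, 0} := ⟨fun _ => Empty, fun _ => PUnit⟩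

section Hypergraph

variable (V : Type z) [hgLang.Structure V]

/-- The `n`-ary edge relation of a hypergraph sequence. -/
def hgRel {n : ℕ} (v : Fin n → V) : Prop :=
  @Structure.RelMap hgLang V _ n PUnit.unit v

/-- A family of vertices is a clique: every tuple of its members is an edge. -/
def IsClique {ι : Type*} (a : ι → V) : Prop :=
  ∀ (n : ℕ) (f : Fin n → ι), hgRel V fun j => a (f j)

/-- A family of vertices is a `k`-anticlique: no `k`-tuple of its members (with
pairwise distinct indices) is an edge. -/
def IsAnticlique (k : ℕ) {ι : Type*} (a : ι → V) : Prop :=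
  ∀ f : Fin k → ι, Function.Injective f → ¬hgRel V fun j => a (f j)

/-- The hypergraph sequence has MTP. -/
def HasMTP : Prop :=
  ∃ (k : ℕ) (bt : List ℕ → V),
    (∀ σ : ℕ → ℕ, IsClique V fun n : ℕ => bt (List.ofFn fun j : Fin n => σ j)) ∧
    (∀ η : List ℕ, IsAnticlique V k fun n : ℕ => bt (η ++ [n]))

/-- The hypergraph sequence has an `(ω, ω, 1)`-array. -/
def HasOmegaArray : Prop :=
  ∃ (k : ℕ) (bt : ℕ → ℕ → V),
    (∀ i : ℕ, IsClique V (bt i)) ∧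
    (∀ σ : ℕ → ℕ, IsAnticlique V k fun i : ℕ => bt i (σ i))

/-- The hypergraph sequence has MSOP₁. -/
def HasMSOP1 : Prop :=
  ∃ bt : List Bool → V,
    (∀ σ : ℕ → Bool, IsClique V fun n : ℕ => bt (List.ofFn fun j : Fin n => σ j)) ∧
    (∀ η₁ η₂ : List Bool, (η₁ ++ [false]) <+: η₂ →
      IsAnticlique V 2 ![bt η₂, bt (η₁ ++ [true])])

/-- The hypergraph sequence has ω-MDCTP₂. -/
def HasOmegaMDCTP2 : Prop :=
  ∃ (k : ℕ) (bt : List Bool → V),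
    (∀ σ : ℕ → Bool, IsAnticlique V k fun n : ℕ => bt (List.ofFn fun j : Fin n => σ j)) ∧
    (∀ (l : ℕ) (c : ℕ → List Bool), IsDescendingComb l c →
      IsClique V fun i : Fin l => bt (c i))

/-- The hypergraph sequence has the compatible order property. -/
def HasCompatibleOrderProperty : Prop :=
  ∃ c d : ℕ → V,
    (∀ m n : ℕ, m < n →
      IsClique V fun i : Fin (n + 1) => if (i : ℕ) ≤ m then d i else c i) ∧
    (∀ m n : ℕ, m < n → ¬hgRel V ![c m, d n])

end Hypergraph

end NSOP3Paper

namespace NSOP3Paper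

/-- Concatenation of tuples. -/
infixr:67 " ⋈ " => Sum.elim

/-- An abstract system of `M`-definable conditions on tuples from `𝕄`. -/
structure Ctx (𝕄 : Type w) where
  M : Set 𝕄
  D : ∀ {α : Type}, ((α → 𝕄) → Prop) → Prop
  d_not : ∀ {α : Type} {C : (α → 𝕄) → Prop}, D C → D fun x => ¬ C x
  d_and : ∀ {α : Type} {C C' : (α → 𝕄) → Prop}, D C → D C' → D fun x => C x ∧ C' x
  d_true : ∀ {α : Type}, D fun _ : α → 𝕄 => True
  d_comp : ∀ {α β : Type} {C : (α → 𝕄) → Prop} (g : α → β), D C → D fun x => C (x ∘ g)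
  d_supp : ∀ {α : Type} {C : (α → 𝕄) → Prop}, D C →
    ∃ (s : Finset α) (C0 : (s → 𝕄) → Prop), D C0 ∧ ∀ x, C x ↔ C0 fun i => x i
  d_ex : ∀ {α β : Type} [Finite β] {C : (α ⊕ β → 𝕄) → Prop}, D C →
    D fun x => ∃ y, C (x ⋈ y)
  d_mem : ∀ {α β : Type} {C : (α ⊕ β → 𝕄) → Prop} (m : β → 𝕄), (∀ i, m i ∈ M) → D C →
    D fun x => C (x ⋈ m)
  d_tv : ∀ {α : Type} {C : (α → 𝕄) → Prop}, D C → ∀ d, C d → ∃ m, (∀ i, m i ∈ M) ∧ C m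
  d_sat : ∀ {α : Type} [Countable α] (e : ℕ → 𝕄) (F : Set ((α ⊕ ℕ → 𝕄) → Prop)),
    (∀ C ∈ F, D C) → (∀ s : Finset ((α ⊕ ℕ → 𝕄) → Prop), (∀ C ∈ s, C ∈ F) →
      ∃ x, ∀ C ∈ s, C (x ⋈ e)) → ∃ x, ∀ C ∈ F, C (x ⋈ e)
  ne : Nonempty 𝕄

namespace Ctx

variable {𝕄 : Type w} (K : Ctx 𝕄) {α β γ δ ξ : Type}

/-- Definability over `M ∪ A`. -/
def DA (A : Set 𝕄) (C : (α → 𝕄) → Prop) : Prop :=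
  ∃ (P : Type) (S : (α ⊕ P → 𝕄) → Prop) (e : P → 𝕄), K.D S ∧ (∀ i, e i ∈ A) ∧
    ∀ x, C x ↔ S (x ⋈ e)

/-- Same type over `M`. -/
def E (u v : α → 𝕄) : Prop := ∀ C, K.D C → C u → C v

/-- Same type over `M ∪ A`. -/
def EA (A : Set 𝕄) (u v : α → 𝕄) : Prop := ∀ C, K.DA A C → C u → C v

variable {K}

lemma D.congr {C C' : (α → 𝕄) → Prop} (h : K.D C) (hh : ∀ x, C' x ↔ C x) : K.D C' := by
  have : C' = C := funext fun x => propext (hh x)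
  rwa [this]

lemma D.pull {C : (α → 𝕄) → Prop} (h : K.D C) (g : (β → 𝕄) → (α → 𝕄))
    (hg : ∀ i, (∃ j, ∀ x, g x i = x j) ∨ ∃ m ∈ K.M, ∀ x, g x i = m) :
    K.D fun x => C (g x) := by
  classical
  have h1 : ∀ i : α, ∃ f : β ⊕ α, ∃ m : 𝕄, (∀ x, g x i = (x ⋈ fun _ => m) f) ∧
      (m ∈ K.M ∨ ∃ j, f = Sum.inl j) := by
    intro i
    rcases hg i with ⟨j, hj⟩ | ⟨m, hm, hx⟩
    · exact ⟨Sum.inl j, (Classical.choice K.ne), hj, Or.inr ⟨j, rfl⟩⟩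
    · exact ⟨Sum.inr i, m, hx, Or.inl hm⟩
  -- an element of `M`
  obtain ⟨z, hz, -⟩ := K.d_tv (K.d_true (α := Unit)) (fun _ => Classical.choice K.ne) trivial
  choose f m hf hm using h1
  let m' : α → 𝕄 := fun i => if m i ∈ K.M then m i else z ()
  have hm' : ∀ i, m' i ∈ K.M := by
    intro i; by_cases hi : m i ∈ K.M <;> simp [m', hi, hz]
  let f' : α → β ⊕ α := fun i => Sum.elim Sum.inl (fun _ => Sum.inr i) (f i)
  refine D.congr (K.d_mem m' hm' (K.d_comp f' h)) ?_
  intro x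
  have : g x = (x ⋈ m') ∘ f' := by
    funext i
    rw [hf i x]
    simp only [Function.comp, f']
    rcases hfi : f i with j | j
    · simp
    · have : m i ∈ K.M := by
        rcases hm i with h | ⟨j', hj'⟩
        · exact h
        · simp [hfi] at hj'
      simp [m', this]
  rw [this]

lemma exists_mem (K : Ctx 𝕄) : ∃ z, z ∈ K.M := by
  obtain ⟨z, hz, -⟩ := K.d_tv (K.d_true (α := Unit)) (fun _ => Classical.choice K.ne) trivial
  exact ⟨_, hz ()⟩

lemma D.da {C : (α → 𝕄) → Prop} (h : K.D C) (A : Set 𝕄) : K.DA A C :=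
  ⟨Empty, fun x => C (x ∘ Sum.inl), Empty.elim, K.d_comp _ h, fun i => i.elim, fun x => by
    simp⟩

lemma DA.congr {A : Set 𝕄} {C C' : (α → 𝕄) → Prop} (h : K.DA A C) (hh : ∀ x, C' x ↔ C x) :
    K.DA A C' := by
  have : C' = C := funext fun x => propext (hh x)
  rwa [this]

lemma DA.mono {A B : Set 𝕄} {C : (α → 𝕄) → Prop} (h : K.DA A C) (hAB : A ⊆ B) : K.DA B C := by
  obtain ⟨P, S, e, hS, he, hC⟩ := h
  exact ⟨P, S, e, hS, fun i => hAB (he i), hC⟩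

lemma DA.d {C : (α → 𝕄) → Prop} (h : K.DA ∅ C) : K.D C := by
  obtain ⟨P, S, e, hS, he, hC⟩ := h
  refine (hS.pull (fun x => x ⋈ e) ?_).congr hC
  rintro (i | i)
  · exact Or.inl ⟨i, fun _ => rfl⟩
  · exact (he i).elim

lemma DA.not {A : Set 𝕄} {C : (α → 𝕄) → Prop} (h : K.DA A C) : K.DA A fun x => ¬ C x := by
  obtain ⟨P, S, e, hS, he, hC⟩ := h
  exact ⟨P, _, e, K.d_not hS, he, fun x => by simp [hC]⟩

lemma DA.and {A : Set 𝕄} {C C' : (α → 𝕄) → Prop} (h : K.DA A C) (h' : K.DA A C') :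
    K.DA A fun x => C x ∧ C' x := by
  obtain ⟨P, S, e, hS, he, hC⟩ := h
  obtain ⟨P', S', e', hS', he', hC'⟩ := h'
  refine ⟨P ⊕ P', _, e ⋈ e', K.d_and (K.d_comp (Sum.map id Sum.inl) hS)
    (K.d_comp (Sum.map id Sum.inr) hS'), ?_, ?_⟩
  · rintro (i | i)
    · exact he i
    · exact he' i
  · intro x
    simp [hC, hC', Sum.elim_comp_map]

lemma DA.pull {A : Set 𝕄} {C : (α → 𝕄) → Prop} (h : K.DA A C) (g : (β → 𝕄) → (α → 𝕄))
    (hg : ∀ i, (∃ j, ∀ x, g x i = x j) ∨ ∃ m ∈ K.M ∪ A, ∀ x, g x i = m) :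
    K.DA A fun x => C (g x) := by
  classical
  obtain ⟨P, S, e, hS, he, hC⟩ := h
  -- the constants used
  let R : Type := P ⊕ {i : α // ∃ m ∈ A, ∀ x, g x i = m}
  let e' : R → 𝕄 := e ⋈ fun i => i.2.choose
  let G : (β ⊕ R → 𝕄) → (α ⊕ P → 𝕄) := fun y =>
    (fun i => if hi : ∃ m ∈ A, ∀ x, g x i = m then y (Sum.inr (Sum.inr ⟨i, hi⟩))
      else g (y ∘ Sum.inl) i) ⋈ fun p => y (Sum.inr (Sum.inl p))
  refine ⟨R, fun y => S (G y), e', hS.pull G ?_, ?_, ?_⟩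
  · rintro (i | i)
    · by_cases hi : ∃ m ∈ A, ∀ x, g x i = m
      · refine Or.inl ⟨Sum.inr (Sum.inr ⟨i, hi⟩), fun x => ?_⟩
        simp [G, hi]
      · rcases hg i with ⟨j, hj⟩ | ⟨m, hm | hm, hx⟩
        · exact Or.inl ⟨Sum.inl j, fun x => by
            simp only [G, Sum.elim_inl]; rw [dif_neg hi, hj]; rfl⟩
        · exact Or.inr ⟨m, hm, fun x => by
            simp only [G, Sum.elim_inl]; rw [dif_neg hi, hx]⟩
        · exact (hi ⟨m, hm, hx⟩).elim
    · exact Or.inl ⟨Sum.inr (Sum.inl i), fun x => rfl⟩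
  · rintro (i | i)
    · exact he i
    · exact i.2.choose_spec.1
  · intro x
    change C (g x) ↔ S (G (x ⋈ e'))
    rw [hC]
    have : G (x ⋈ e') = g x ⋈ e := by
      funext i
      rcases i with i | i
      · simp only [G, Sum.elim_inl]
        split_ifs with hi
        · exact (hi.choose_spec.2 x).symm
        · congr 1
      · rfl
    rw [this]

lemma DA.const (A : Set 𝕄) (p : Prop) : K.DA A fun _ : α → 𝕄 => p := by
  by_cases hp : p
  · simpa [hp] using K.d_true.da A
  · simpa [hp] using (K.d_true.da A (α := α)).not

lemma DA.or {A : Set 𝕄} {C C' : (α → 𝕄) → Prop} (h : K.DA A C) (h' : K.DA A C') :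
    K.DA A fun x => C x ∨ C' x :=
  (h.not.and h'.not).not.congr fun x => by tauto

lemma DA.imp {A : Set 𝕄} {C C' : (α → 𝕄) → Prop} (h : K.DA A C) (h' : K.DA A C') :
    K.DA A fun x => C x → C' x :=
  (h.not.or h').congr fun x => by tauto

lemma DA.ball {A : Set 𝕄} {ι : Type*} (s : Finset ι) {C : ι → (α → 𝕄) → Prop}
    (h : ∀ i ∈ s, K.DA A (C i)) : K.DA A fun x => ∀ i ∈ s, C i x := by
  classical
  induction s using Finset.induction_on with
  | empty => exact (DA.const A True).congr fun x => by simp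
  | insert i s hi ih =>
    refine ((h i (by simp)).and (ih fun j hj => h j (by simp [hj]))).congr fun x => by simp

lemma DA.bex {A : Set 𝕄} {ι : Type*} (s : Finset ι) {C : ι → (α → 𝕄) → Prop}
    (h : ∀ i ∈ s, K.DA A (C i)) : K.DA A fun x => ∃ i ∈ s, C i x :=
  (DA.ball s fun i hi => (h i hi).not).not.congr fun x => by simp

lemma DA.lt {A : Set 𝕄} (n : ℕ) {C : ℕ → (α → 𝕄) → Prop}
    (h : ∀ i < n, K.DA A (C i)) : K.DA A fun x => ∀ i < n, C i x :=
  (DA.ball (Finset.range n) fun i hi => h i (by simpa using hi)).congr fun x => by simp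

lemma DA.all_fin {A : Set 𝕄} {ι : Type*} [Finite ι] {C : ι → (α → 𝕄) → Prop}
    (h : ∀ i, K.DA A (C i)) : K.DA A fun x => ∀ i, C i x := by
  classical
  cases nonempty_fintype ι
  exact (DA.ball Finset.univ fun i _ => h i).congr fun x => by simp

lemma D.ex {C : (α ⊕ β → 𝕄) → Prop} (h : K.D C) : K.D fun x => ∃ y, C (x ⋈ y) := by
  classical
  obtain ⟨s, C0, h0, hC⟩ := K.d_supp h
  let β' : Type := {j : β // Sum.inr j ∈ s}
  have : Finite β' := Finite.of_injective (fun j : β' => (⟨Sum.inr j.1, j.2⟩ : s))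
    (fun a b hab => by
      simp only [Subtype.mk.injEq, Sum.inr.injEq] at hab; exact Subtype.ext hab)
  let g : s → α ⊕ β' := fun i => match i with
    | ⟨Sum.inl a, _⟩ => Sum.inl a
    | ⟨Sum.inr b, hb⟩ => Sum.inr ⟨b, hb⟩
  refine (K.d_ex (K.d_comp g h0)).congr fun x => ?_
  constructor
  · rintro ⟨y, hy⟩
    refine ⟨fun j => y j.1, ?_⟩
    rw [hC] at hy
    convert hy using 1
    funext i
    rcases i with ⟨i | i, hi⟩ <;> rfl
  · rintro ⟨y, hy⟩
    refine ⟨fun j => if hj : Sum.inr j ∈ s then y ⟨j, hj⟩ else Classical.choice K.ne, ?_⟩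
    rw [hC]
    convert hy using 1
    funext i
    rcases i with ⟨i | i, hi⟩
    · rfl
    · simp [g, hi]

lemma DA.ex {A : Set 𝕄} {C : (α ⊕ β → 𝕄) → Prop} (h : K.DA A C) :
    K.DA A fun x => ∃ y, C (x ⋈ y) := by
  obtain ⟨P, S, e, hS, he, hC⟩ := h
  refine ⟨P, _, e, D.ex (K.d_comp
    (Sum.elim (Sum.elim (Sum.inl ∘ Sum.inl) Sum.inr) (Sum.inl ∘ Sum.inr)) hS), he, fun x => ?_⟩
  refine exists_congr fun y => ?_
  rw [hC]
  have : (x ⋈ y) ⋈ e = ((x ⋈ e) ⋈ y) ∘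
      (Sum.elim (Sum.elim (Sum.inl ∘ Sum.inl) Sum.inr) (Sum.inl ∘ Sum.inr)) := by
    funext i; rcases i with (i | i) | i <;> rfl
  rw [this]

lemma DA.all {A : Set 𝕄} {C : (α ⊕ β → 𝕄) → Prop} (h : K.DA A C) :
    K.DA A fun x => ∀ y, C (x ⋈ y) :=
  h.not.ex.not.congr fun x => by simp

/-- Existential with general way of combining. -/
lemma DA.ex_of {A : Set 𝕄} {C : (α → 𝕄) → (β → 𝕄) → Prop}
    (h : K.DA A fun z : α ⊕ β → 𝕄 => C (z ∘ Sum.inl) (z ∘ Sum.inr)) :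
    K.DA A fun x => ∃ y, C x y := by
  simpa using h.ex

lemma DA.all_of {A : Set 𝕄} {C : (α → 𝕄) → (β → 𝕄) → Prop}
    (h : K.DA A fun z : α ⊕ β → 𝕄 => C (z ∘ Sum.inl) (z ∘ Sum.inr)) :
    K.DA A fun x => ∀ y, C x y := by
  simpa using h.all

lemma DA.range {d : δ → 𝕄} {C : (α → 𝕄) → Prop} (h : K.DA (Set.range d) C) :
    ∃ S : (α ⊕ δ → 𝕄) → Prop, K.D S ∧ ∀ x, C x ↔ S (x ⋈ d) := by
  obtain ⟨P, S, e, hS, he, hC⟩ := h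
  choose f hf using he
  refine ⟨_, K.d_comp (Sum.map id f) hS, fun x => ?_⟩
  rw [hC, Sum.elim_comp_map]
  have : e = d ∘ f := funext fun i => (hf i).symm
  rw [this]; rfl

/-- Splitting off parameters. -/
lemma DA.split {A : Set 𝕄} {d : δ → 𝕄} {C : (α → 𝕄) → Prop} (h : K.DA (A ∪ Set.range d) C) :
    ∃ S : (α ⊕ δ → 𝕄) → Prop, K.DA A S ∧ ∀ x, C x ↔ S (x ⋈ d) := by
  classical
  obtain ⟨P, S, e, hS, he, hC⟩ := h
  let G : (α ⊕ δ → 𝕄) → (α ⊕ P → 𝕄) := fun y => (y ∘ Sum.inl) ⋈ fun p =>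
    if hp : ∃ j, d j = e p then y (Sum.inr hp.choose) else e p
  refine ⟨fun y => S (G y), (hS.da A).pull G ?_, fun x => ?_⟩
  · rintro (i | i)
    · exact Or.inl ⟨_, fun x => rfl⟩
    · by_cases hp : ∃ j, d j = e i
      · exact Or.inl ⟨Sum.inr hp.choose, fun x => by simp [G, hp]⟩
      · refine Or.inr ⟨e i, Or.inr ?_, fun x => by simp [G, hp]⟩
        exact (he i).resolve_right hp
  · rw [hC]
    have : G (x ⋈ d) = x ⋈ e := by
      funext i
      rcases i with i | i
      · rfl
      · simp only [G, Sum.elim_inr]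
        split_ifs with hp
        · exact hp.choose_spec
        · rfl
    simp only [this]

lemma D.sub {S : (α ⊕ δ → 𝕄) → Prop} (h : K.D S) (d : δ → 𝕄) {A : Set 𝕄}
    (hd : ∀ i, d i ∈ A) : K.DA A fun x => S (x ⋈ d) := ⟨_, S, d, h, hd, fun _ => Iff.rfl⟩

lemma DA.sub {A : Set 𝕄} {S : (α ⊕ δ → 𝕄) → Prop} (h : K.DA A S) (d : δ → 𝕄)
    (hd : ∀ i, d i ∈ K.M ∪ A) : K.DA A fun x => S (x ⋈ d) :=
  h.pull (fun x => x ⋈ d) (by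
    rintro (i | i)
    · exact Or.inl ⟨i, fun _ => rfl⟩
    · exact Or.inr ⟨_, hd i, fun _ => rfl⟩)

lemma DA.sub' {A : Set 𝕄} {S : (δ ⊕ α → 𝕄) → Prop} (h : K.DA A S) (d : δ → 𝕄)
    (hd : ∀ i, d i ∈ K.M ∪ A) : K.DA A fun x => S (d ⋈ x) :=
  h.pull (fun x => d ⋈ x) (by
    rintro (i | i)
    · exact Or.inr ⟨_, hd i, fun _ => rfl⟩
    · exact Or.inl ⟨i, fun _ => rfl⟩)

lemma DA.comp {A : Set 𝕄} {C : (α → 𝕄) → Prop} (h : K.DA A C) (g : α → β) :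
    K.DA A fun x => C (x ∘ g) := h.pull _ fun _ => Or.inl ⟨_, fun _ => rfl⟩

lemma DA.supp {A : Set 𝕄} {C : (α → 𝕄) → Prop} (h : K.DA A C) :
    ∃ (s : Finset α) (C0 : (s → 𝕄) → Prop), K.DA A C0 ∧ ∀ x, C x ↔ C0 fun i => x i := by
  classical
  obtain ⟨P, S, e, hS, he, hC⟩ := h
  obtain ⟨s, C0, h0, hC0⟩ := K.d_supp hS
  let t : Finset α := s.preimage Sum.inl Sum.inl_injective.injOn
  let g : s → t ⊕ P := fun i => match i with
    | ⟨Sum.inl a, ha⟩ => Sum.inl ⟨a, by simpa [t] using ha⟩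
    | ⟨Sum.inr b, hb⟩ => Sum.inr b
  refine ⟨t, fun x => C0 ((x ⋈ e) ∘ g), (K.d_comp g h0).sub e he, fun x => ?_⟩
  rw [hC, hC0]
  have : (fun i : s => (x ⋈ e) i.1) = ((fun i : t => x i.1) ⋈ e) ∘ g := by
    funext i
    rcases i with ⟨i | i, hi⟩ <;> rfl
  rw [this]

/-! ### Equality of types -/

lemma E.refl (u : α → 𝕄) : K.E u u := fun _ _ h => h

lemma E.iff {u v : α → 𝕄} (h : K.E u v) {C : (α → 𝕄) → Prop} (hC : K.D C) : C u ↔ C v :=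
  ⟨h C hC, fun hv => by
    by_contra hu
    exact h _ (K.d_not hC) hu hv⟩

lemma E.symm {u v : α → 𝕄} (h : K.E u v) : K.E v u := fun _ hC => (h.iff hC).2

lemma E.trans {u v t : α → 𝕄} (h : K.E u v) (h' : K.E v t) : K.E u t :=
  fun C hC hu => h' C hC (h C hC hu)

lemma E.comp {u v : α → 𝕄} (h : K.E u v) (g : β → α) : K.E (u ∘ g) (v ∘ g) :=
  fun _ hC hu => h _ (K.d_comp g hC) hu

lemma E.of_comp {u v : α → 𝕄} (h : K.E u v) {u' v' : β → 𝕄} (g : β → α)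
    (hu : ∀ i, u' i = u (g i)) (hv : ∀ i, v' i = v (g i)) : K.E u' v' := by
  have h1 : u' = u ∘ g := funext hu
  have h2 : v' = v ∘ g := funext hv
  rw [h1, h2]; exact h.comp g

lemma EA.e {A : Set 𝕄} {u v : α → 𝕄} (h : K.EA A u v) : K.E u v :=
  fun C hC hu => h C (hC.da A) hu

lemma E.ea {u v : α → 𝕄} (h : K.E u v) : K.EA ∅ u v := fun C hC hu => h C hC.d hu

lemma EA.refl (A : Set 𝕄) (u : α → 𝕄) : K.EA A u u := fun _ _ h => h

lemma EA.iff {A : Set 𝕄} {u v : α → 𝕄} (h : K.EA A u v) {C : (α → 𝕄) → Prop}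
    (hC : K.DA A C) : C u ↔ C v :=
  ⟨h C hC, fun hv => by
    by_contra hu
    exact h _ hC.not hu hv⟩

lemma EA.symm {A : Set 𝕄} {u v : α → 𝕄} (h : K.EA A u v) : K.EA A v u :=
  fun _ hC => (h.iff hC).2

lemma EA.trans {A : Set 𝕄} {u v t : α → 𝕄} (h : K.EA A u v) (h' : K.EA A v t) : K.EA A u t :=
  fun C hC hu => h' C hC (h C hC hu)

lemma EA.mono {A B : Set 𝕄} {u v : α → 𝕄} (h : K.EA B u v) (hAB : A ⊆ B) : K.EA A u v :=
  fun C hC hu => h C (hC.mono hAB) hu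

lemma EA.of_comp {A : Set 𝕄} {u v : α → 𝕄} (h : K.EA A u v) {u' v' : β → 𝕄} (g : β → α)
    (hu : ∀ i, u' i = u (g i)) (hv : ∀ i, v' i = v (g i)) : K.EA A u' v' := by
  have h1 : u' = u ∘ g := funext hu
  have h2 : v' = v ∘ g := funext hv
  rw [h1, h2]; exact fun _ hC hu => h _ (hC.comp g) hu

/-- Adding parameters from `M ∪ A`. -/
lemma EA.add {A : Set 𝕄} {u v : α → 𝕄} (h : K.EA A u v) (d : δ → 𝕄)
    (hd : ∀ i, d i ∈ K.M ∪ A) : K.EA A (u ⋈ d) (v ⋈ d) :=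
  fun C hC hu => h (fun x => C (x ⋈ d)) (hC.sub d hd) hu

lemma EA.of_add {A : Set 𝕄} {u v : α → 𝕄} {d : δ → 𝕄} (h : K.EA A (u ⋈ d) (v ⋈ d)) :
    K.EA (A ∪ Set.range d) u v := by
  intro C hC hu
  obtain ⟨S, hS, hC⟩ := hC.split
  rw [hC] at hu ⊢
  exact h S hS hu

lemma ea_range {u v : α → 𝕄} {d : δ → 𝕄} : K.EA (Set.range d) u v ↔ K.E (u ⋈ d) (v ⋈ d) := by
  constructor
  · intro h
    exact (h.add d fun i => Or.inr ⟨i, rfl⟩).e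
  · intro h
    simpa using h.ea.of_add

lemma EA.const {A : Set 𝕄} {u v : α → 𝕄} (h : K.EA A u v) (i : α) (hi : u i ∈ K.M ∪ A)
    (heq : K.DA A fun x : (Fin 2 → 𝕄) => x 0 = x 1) : v i = u i := by
  have := h (fun x => x i = u i) (heq.pull (fun x => ![x i, u i]) (by
    intro j; fin_cases j
    · exact Or.inl ⟨i, fun x => rfl⟩
    · exact Or.inr ⟨u i, hi, fun x => rfl⟩)) rfl
  exact this

lemma ea_of_finite {A : Set 𝕄} {u v : α → 𝕄}
    (h : ∀ s : Finset α, K.EA A (fun i : s => u i) (fun i : s => v i)) : K.EA A u v := by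
  intro C hC hu
  obtain ⟨s, C0, h0, hC⟩ := hC.supp
  rw [hC] at hu ⊢
  exact h s C0 h0 hu

lemma ea_of_directed {A : Set 𝕄} {u v : α → 𝕄} (I : ℕ → Set α) (hI : Monotone I)
    (hc : ∀ i, ∃ n, i ∈ I n)
    (h : ∀ n, K.EA A (fun i : I n => u i) (fun i : I n => v i)) : K.EA A u v := by
  apply ea_of_finite
  intro s
  choose f hf using hc
  let N := s.sup f
  have : ∀ i : s, i.1 ∈ I N := fun i => hI (Finset.le_sup (f := f) i.2) (hf i.1)
  exact (h N).of_comp (fun i => ⟨i.1, this i⟩) (fun _ => rfl) (fun _ => rfl)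

/-! ### Saturation -/

lemma sat [Countable α] {A : Set 𝕄} (hA : A.Countable) {ι : Type*} (C : ι → (α → 𝕄) → Prop)
    (hC : ∀ i, K.DA A (C i)) (h : ∀ s : Finset ι, ∃ x, ∀ i ∈ s, C i x) : ∃ x, ∀ i, C i x := by
  classical
  obtain ⟨e, he⟩ : ∃ e : ℕ → 𝕄, A ⊆ Set.range e := by
    rcases A.eq_empty_or_nonempty with rfl | hne
    · exact ⟨fun _ => Classical.choice K.ne, by simp⟩
    · obtain ⟨e, he⟩ := hA.exists_eq_range hne
      exact ⟨e, he.le⟩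
  have h1 : ∀ i, ∃ S : (α ⊕ ℕ → 𝕄) → Prop, K.D S ∧ ∀ x, C i x ↔ S (x ⋈ e) :=
    fun i => ((hC i).mono he).range
  choose S hS hCS using h1
  obtain ⟨x, hx⟩ := K.d_sat e (Set.range S) (by rintro _ ⟨i, rfl⟩; exact hS i) (by
    intro s hs
    choose f hf using fun C : s => hs C.1 C.2
    obtain ⟨x, hx⟩ := h (Finset.univ.image f)
    refine ⟨x, fun C hC => ?_⟩
    have := hx (f ⟨C, hC⟩) (by simp)
    rw [hCS, hf] at this
    exact this)
  exact ⟨x, fun i => (hCS i x).2 (hx _ ⟨i, rfl⟩)⟩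

/-- Homogeneity. -/
lemma EA.homog [Countable α] [Countable δ] {A : Set 𝕄} (hA : A.Countable) {u v : α → 𝕄}
    (h : K.EA A u v) (d : δ → 𝕄) : ∃ d', K.EA A (u ⋈ d) (v ⋈ d') := by
  classical
  obtain ⟨d', hd'⟩ := sat (K := K) (A := A ∪ Set.range v) (hA.union (Set.countable_range v))
    (ι := {C : (α ⊕ δ → 𝕄) → Prop // K.DA A C ∧ C (u ⋈ d)}) (fun C y => C.1 (v ⋈ y))
    (fun C => (C.2.1.mono (by simp)).sub' v fun i => Or.inr (Or.inr ⟨i, rfl⟩)) (by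
      intro s
      have h1 : K.DA A fun z : α → 𝕄 => ∃ y, ∀ C ∈ s, C.1 (z ⋈ y) :=
        (DA.ball s fun C _ => C.2.1).ex
      exact h _ h1 ⟨d, fun C _ => C.2.2⟩)
  exact ⟨d', fun C hC hu => hd' ⟨C, hC, hu⟩⟩

lemma E.homog [Countable α] [Countable δ] {u v : α → 𝕄}
    (h : K.E u v) (d : δ → 𝕄) : ∃ d', K.E (u ⋈ d) (v ⋈ d') := by
  obtain ⟨d', hd⟩ := h.ea.homog Set.countable_empty d
  exact ⟨d', hd.e⟩

end Ctx
end NSOP3Paper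

namespace NSOP3Paper
open Filter

lemma exists_seq {X : Type*} (G : ℕ → (ℕ → X) → X → Prop)
    (hloc : ∀ n f g, (∀ i < n, f i = g i) → ∀ x, G n f x → G n g x)
    (hex : ∀ n f, ∃ x, G n f x) [Nonempty X] : ∃ f : ℕ → X, ∀ n, G n f (f n) := by
  classical
  choose F hF using hex
  let f : ℕ → X := fun n => Nat.strongRec (motive := fun _ => X)
    (fun n ih => F n (fun i => if h : i < n then ih i h else Classical.arbitrary X)) n
  have hf : ∀ n, f n = F n (fun i => if i < n then f i else Classical.arbitrary X) := by
    intro n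
    simp only [f]
    conv_lhs => rw [Nat.strongRec]
    rfl
  refine ⟨f, fun n => ?_⟩
  have := hF n (fun i => if i < n then f i else Classical.arbitrary X)
  rw [← hf] at this
  exact hloc n _ _ (fun i hi => by simp [hi]) _ this

/-- Elements occurring in the tuples of index `< i`. -/
def below {𝕄 : Type w} {β : Type} (d : ℕ → β → 𝕄) (i : ℕ) : Set 𝕄 :=
  {y | ∃ j < i, ∃ k, d j k = y}

lemma below_congr {𝕄 : Type w} {β : Type} {d d' : ℕ → β → 𝕄} {i : ℕ}
    (h : ∀ j < i, d j = d' j) : below d i = below d' i := by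
  ext y
  constructor
  · rintro ⟨j, hj, k, rfl⟩; exact ⟨j, hj, k, by rw [h j hj]⟩
  · rintro ⟨j, hj, k, rfl⟩; exact ⟨j, hj, k, by rw [h j hj]⟩

lemma mem_below {𝕄 : Type w} {β : Type} {d : ℕ → β → 𝕄} {i j : ℕ} (h : j < i) (k : β) :
    d j k ∈ below d i := ⟨j, h, k, rfl⟩

lemma below_mono {𝕄 : Type w} {β : Type} {d : ℕ → β → 𝕄} {i j : ℕ} (h : i ≤ j) :
    below d i ⊆ below d j := by
  rintro y ⟨t, ht, k, rfl⟩; exact ⟨t, by omega, k, rfl⟩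

lemma below_countable {𝕄 : Type w} {β : Type} [Countable β] (d : ℕ → β → 𝕄) (i : ℕ) :
    (below d i).Countable := by
  have : below d i ⊆ Set.range (fun q : ℕ × β => d q.1 q.2) := by
    rintro y ⟨t, ht, k, rfl⟩; exact ⟨(t, k), rfl⟩
  exact (Set.countable_range _).mono this

lemma below_zero {𝕄 : Type w} {β : Type} (d : ℕ → β → 𝕄) : below d 0 = ∅ := by
  ext y; simp [below]

lemma below_eq_range {𝕄 : Type w} {β : Type} (d : ℕ → β → 𝕄) (n : ℕ) :
    below d n = Set.range (fun q : Fin n × β => d q.1 q.2) := by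
  ext y
  constructor
  · rintro ⟨t, ht, k, rfl⟩; exact ⟨(⟨t, ht⟩, k), rfl⟩
  · rintro ⟨⟨t, k⟩, rfl⟩; exact ⟨t, t.2, k, rfl⟩

namespace Ctx

variable {𝕄 : Type w} (K : Ctx 𝕄) {α β γ δ ξ : Type}

def Realizes (U : Ultrafilter (α → 𝕄)) (A : Set 𝕄) (d : α → 𝕄) : Prop :=
  ∀ C, K.DA A C → (∀ᶠ x in (U : Filter (α → 𝕄)), C x) → C d

def Inv (U : Ultrafilter (α → 𝕄)) : Prop :=
  ∀ (P : Type) (S : (α ⊕ P → 𝕄) → Prop) (e e' : P → 𝕄), K.D S → K.E e e' →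
    (∀ᶠ x in (U : Filter (α → 𝕄)), S (x ⋈ e)) → ∀ᶠ x in (U : Filter (α → 𝕄)), S (x ⋈ e')

def Coh (U : Ultrafilter (α → 𝕄)) : Prop := ∀ᶠ x in (U : Filter (α → 𝕄)), ∀ i, x i ∈ K.M

def FS (A : Set 𝕄) (d : α → 𝕄) : Prop :=
  ∀ C, K.DA A C → C d → ∃ m : α → 𝕄, (∀ i, m i ∈ K.M) ∧ C m

def Gen (A : Set 𝕄) (d : α → 𝕄) : Prop := ∃ U, K.Inv U ∧ K.Realizes U A d

def Mor (U : Ultrafilter (α → 𝕄)) (d : ℕ → α → 𝕄) : Prop :=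
  ∀ i, K.Realizes U (below d i) (d i)

variable {K}

lemma Realizes.iff {U : Ultrafilter (α → 𝕄)} {A : Set 𝕄} {d : α → 𝕄} (h : K.Realizes U A d)
    {C : (α → 𝕄) → Prop} (hC : K.DA A C) : (∀ᶠ x in (U : Filter (α → 𝕄)), C x) ↔ C d := by
  refine ⟨h C hC, fun hd => ?_⟩
  by_contra hn
  rw [← Ultrafilter.eventually_not] at hn
  exact h _ hC.not hn hd

lemma Realizes.mono {U : Ultrafilter (α → 𝕄)} {A B : Set 𝕄} {d : α → 𝕄}
    (h : K.Realizes U B d) (hAB : A ⊆ B) : K.Realizes U A d :=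
  fun C hC hU => h C (hC.mono hAB) hU

lemma Realizes.ea {U : Ultrafilter (α → 𝕄)} {A : Set 𝕄} {d d' : α → 𝕄}
    (h : K.Realizes U A d) (h' : K.Realizes U A d') : K.EA A d d' :=
  fun C hC hd => h' C hC ((h.iff hC).2 hd)

lemma Realizes.of_ea {U : Ultrafilter (α → 𝕄)} {A : Set 𝕄} {d d' : α → 𝕄}
    (h : K.Realizes U A d) (h' : K.EA A d d') : K.Realizes U A d' :=
  fun C hC hU => h' C hC (h C hC hU)

lemma Realizes.map {U : Ultrafilter (α → 𝕄)} {A : Set 𝕄} {d : α → 𝕄}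
    (h : K.Realizes U A d) (g : β → α) : K.Realizes (U.map (· ∘ g)) A (d ∘ g) :=
  fun C hC hU => h (fun x => C (x ∘ g)) (hC.comp g) hU

lemma Coh.map {U : Ultrafilter (α → 𝕄)} (h : K.Coh U) (g : β → α) : K.Coh (U.map (· ∘ g)) := by
  change ∀ᶠ x in (U : Filter (α → 𝕄)), ∀ i, (x ∘ g) i ∈ K.M
  filter_upwards [h] with x hx i using hx _

lemma Inv.map {U : Ultrafilter (α → 𝕄)} (h : K.Inv U) (g : β → α) :
    K.Inv (U.map (· ∘ g)) := by
  intro P S e e' hS he hU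
  have := h P (fun y => S (y ∘ Sum.map g id)) e e' (K.d_comp _ hS) he (by
    simpa [Sum.elim_comp_map] using hU)
  simpa [Sum.elim_comp_map] using this

lemma Gen.map {A : Set 𝕄} {d : α → 𝕄} (h : K.Gen A d) (g : β → α) : K.Gen A (d ∘ g) := by
  obtain ⟨U, hU, hd⟩ := h
  exact ⟨_, hU.map g, hd.map g⟩

lemma Gen.mono {A B : Set 𝕄} {d : α → 𝕄} (h : K.Gen B d) (hAB : A ⊆ B) : K.Gen A d := by
  obtain ⟨U, hU, hd⟩ := h
  exact ⟨_, hU, hd.mono hAB⟩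

lemma Coh.inv {U : Ultrafilter (α → 𝕄)} (h : K.Coh U) : K.Inv U := by
  intro P S e e' hS he hU
  by_contra hn
  rw [← Ultrafilter.eventually_not] at hn
  obtain ⟨x, hx, h1, h2⟩ := (h.and (hU.and hn)).exists
  refine h2 (he (fun y => S (x ⋈ y)) ?_ h1)
  exact hS.pull _ (by
    rintro (i | i)
    · exact Or.inr ⟨_, hx i, fun _ => rfl⟩
    · exact Or.inl ⟨i, fun _ => rfl⟩)

lemma FS.mono {A B : Set 𝕄} {d : α → 𝕄} (h : K.FS B d) (hAB : A ⊆ B) : K.FS A d :=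
  fun C hC hd => h C (hC.mono hAB) hd

lemma FS.map {A : Set 𝕄} {d : α → 𝕄} (h : K.FS A d) (g : β → α) : K.FS A (d ∘ g) := by
  intro C hC hd
  obtain ⟨m, hm, hCm⟩ := h _ (hC.comp g) hd
  exact ⟨m ∘ g, fun i => hm _, hCm⟩

lemma FS.of_comp {A B : Set 𝕄} {d : α → 𝕄} (h : K.FS A d) (hBA : B ⊆ A) (g : β → α)
    {d' : β → 𝕄} (hd : ∀ i, d' i = d (g i)) : K.FS B d' := by
  have : d' = d ∘ g := funext hd
  rw [this]; exact (h.map g).mono hBA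

lemma FS.of_ea {A : Set 𝕄} {d d' : α → 𝕄} (h : K.FS A d) (h' : K.EA A d d') : K.FS A d' :=
  fun C hC hd => h C hC ((h'.iff hC).2 hd)

lemma fs_empty (d : α → 𝕄) : K.FS ∅ d := fun _ hC hd => K.d_tv hC.d d hd

lemma Coh.fs {U : Ultrafilter (α → 𝕄)} (h : K.Coh U) {A : Set 𝕄} {d : α → 𝕄}
    (hd : K.Realizes U A d) : K.FS A d := by
  intro C hC hCd
  obtain ⟨m, hm⟩ := (h.and ((hd.iff hC).2 hCd)).exists
  exact ⟨m, hm⟩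

lemma FS.coh {A : Set 𝕄} {d : α → 𝕄} (h : K.FS A d) : ∃ U, K.Coh U ∧ K.Realizes U A d := by
  classical
  obtain ⟨U, hU⟩ := Ultrafilter.exists_ultrafilter_of_finite_inter_nonempty
    ({s : Set (α → 𝕄) | ∃ C, K.DA A C ∧ C d ∧ s = {x | (∀ i, x i ∈ K.M) ∧ C x}}) (by
      intro T hT
      have hT' : ∀ s : T, ∃ C, K.DA A C ∧ C d ∧ s.1 = {x | (∀ i, x i ∈ K.M) ∧ C x} :=
        fun s => hT s.2
      choose C hC hCd hs using hT'
      obtain ⟨m, hm, hCm⟩ := h (fun x => ∀ s ∈ (Finset.univ : Finset T), C s x)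
        (DA.ball _ fun s _ => hC s) (fun s _ => hCd s)
      refine ⟨m, ?_⟩
      simp only [Set.mem_sInter]
      intro s hsT
      have := hs ⟨s, hsT⟩
      simp only at this
      rw [this]
      exact ⟨hm, hCm _ (Finset.mem_univ _)⟩)
  refine ⟨U, ?_, ?_⟩
  · have : {x : α → 𝕄 | (∀ i, x i ∈ K.M) ∧ True} ∈ U := hU ⟨fun _ => True, DA.const _ _, trivial, rfl⟩
    filter_upwards [this] with x hx using hx.1
  · intro C hC hCU
    by_contra hn
    have h2 : {x : α → 𝕄 | (∀ i, x i ∈ K.M) ∧ ¬ C x} ∈ U := hU ⟨_, hC.not, hn, rfl⟩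
    obtain ⟨x, hx1, hx2⟩ := (hCU.and h2).exists
    exact hx2.2 hx1

lemma FS.gen {A : Set 𝕄} {d : α → 𝕄} (h : K.FS A d) : K.Gen A d := by
  obtain ⟨U, hU, hd⟩ := h.coh
  exact ⟨U, hU.inv, hd⟩

lemma exists_realizes [Countable α] (U : Ultrafilter (α → 𝕄)) {A : Set 𝕄} (hA : A.Countable) :
    ∃ d, K.Realizes U A d := by
  obtain ⟨d, hd⟩ := sat (K := K) hA
    (ι := {C : (α → 𝕄) → Prop // K.DA A C ∧ ∀ᶠ x in (U : Filter (α → 𝕄)), C x})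
    (fun C => C.1) (fun C => C.2.1) (by
      intro s
      have : ∀ᶠ x in (U : Filter (α → 𝕄)), ∀ C ∈ s, C.1 x := by
        rw [Filter.eventually_all_finset]
        exact fun C _ => C.2.2
      exact this.exists)
  exact ⟨d, fun C hC hU => hd ⟨C, hC, hU⟩⟩

/-- Limits of tuples along an ultrafilter. -/
lemma exists_limit {I : Type*} [Countable α] (V : Ultrafilter I) (e : I → α → 𝕄) :
    ∃ e' : α → 𝕄, ∀ C, K.D C → (∀ᶠ i in (V : Filter I), C (e i)) → C e' := by
  obtain ⟨d, hd⟩ := exists_realizes (K := K) (V.map e) Set.countable_empty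
  exact ⟨d, fun C hC h => hd C (hC.da _) h⟩

lemma exists_limit_over {I : Type*} [Countable α] (V : Ultrafilter I) (e : I → α → 𝕄)
    {A : Set 𝕄} (hA : A.Countable) :
    ∃ e' : α → 𝕄, ∀ C, K.DA A C → (∀ᶠ i in (V : Filter I), C (e i)) → C e' := by
  obtain ⟨d, hd⟩ := exists_realizes (K := K) (V.map e) hA
  exact ⟨d, fun C hC h => hd C hC h⟩

lemma exists_mor [Countable α] (U : Ultrafilter (α → 𝕄)) {A : Set 𝕄} (hA : A.Countable) :
    ∃ d : ℕ → α → 𝕄, ∀ i, K.Realizes U (A ∪ below d i) (d i) := by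
  have : Nonempty (α → 𝕄) := ⟨fun _ => Classical.choice K.ne⟩
  apply exists_seq (fun i d x => K.Realizes U (A ∪ below d i) x)
  · intro n f g hfg x hx
    rwa [← below_congr hfg]
  · intro n f
    exact exists_realizes U (hA.union (below_countable f n))

lemma exists_mix [Countable α] (U : ℕ → Ultrafilter (α → 𝕄)) {A : Set 𝕄} (hA : A.Countable) :
    ∃ d : ℕ → α → 𝕄, ∀ i, K.Realizes (U i) (A ∪ below d i) (d i) := by
  have : Nonempty (α → 𝕄) := ⟨fun _ => Classical.choice K.ne⟩
  apply exists_seq (fun i d x => K.Realizes (U i) (A ∪ below d i) x)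
  · intro n f g hfg x hx
    rwa [← below_congr hfg]
  · intro n f
    exact exists_realizes (U n) (hA.union (below_countable f n))

lemma Inv.pair {U : Ultrafilter (α → 𝕄)} (hU : K.Inv U) {e e' : δ → 𝕄} (he : K.E e e')
    {d d' : α → 𝕄} (hd : K.Realizes U (Set.range e) d) (hd' : K.Realizes U (Set.range e') d') :
    K.E (d ⋈ e) (d' ⋈ e') := by
  intro S hS h
  have h1 := (hd.iff (hS.sub e fun i => ⟨i, rfl⟩)).2 h
  exact (hd'.iff (hS.sub e' fun i => ⟨i, rfl⟩)).1 (hU _ _ _ _ hS he h1)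

lemma EA.preserve {A : Set 𝕄} {u v : α → 𝕄} (h : K.EA A u v) {U : Ultrafilter (δ → 𝕄)}
    (hU : K.Inv U) {d : δ → 𝕄} (hd : K.Realizes U (A ∪ Set.range u ∪ Set.range v) d) :
    K.EA (A ∪ Set.range d) u v := by
  intro C hC hu
  obtain ⟨S, ⟨P, T, e, hT, he, hST⟩, hCS⟩ := hC.split
  rw [hCS, hST] at hu ⊢
  have h1 : K.E (u ⋈ e) (v ⋈ e) := (h.add e fun i => Or.inr (he i)).e
  let T' : (δ ⊕ (α ⊕ P) → 𝕄) → Prop := fun y =>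
    T (((y ∘ Sum.inr ∘ Sum.inl) ⋈ (y ∘ Sum.inl)) ⋈ (y ∘ Sum.inr ∘ Sum.inr))
  have hT' : K.D T' := hT.pull _ (by
    rintro ((i | i) | i) <;> exact Or.inl ⟨_, fun _ => rfl⟩)
  have key : ∀ t : α → 𝕄, (∀ i, t i ∈ A ∪ Set.range u ∪ Set.range v) →
      ((∀ᶠ x in (U : Filter (δ → 𝕄)), T' (x ⋈ (t ⋈ e))) ↔ T ((t ⋈ d) ⋈ e)) := by
    intro t ht
    have := hd.iff (hT'.sub (t ⋈ e) (A := A ∪ Set.range u ∪ Set.range v) (by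
      rintro (i | i)
      · exact ht i
      · exact Or.inl (Or.inl (he i))))
    exact this
  rw [← key u fun i => Or.inl (Or.inr ⟨i, rfl⟩)] at hu
  rw [← key v fun i => Or.inr ⟨i, rfl⟩]
  exact hU _ _ _ _ hT' h1 hu

lemma mix_unique (U : ℕ → Ultrafilter (β → 𝕄)) {e e' : δ → 𝕄} (he : K.E e e')
    {d d' : ℕ → β → 𝕄} (n : ℕ) (hU : ∀ i < n, K.Inv (U i))
    (hd : ∀ i < n, K.Realizes (U i) (Set.range e ∪ below d i) (d i))
    (hd' : ∀ i < n, K.Realizes (U i) (Set.range e' ∪ below d' i) (d' i)) :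
    K.E (e ⋈ fun q : Fin n × β => d q.1 q.2) (e' ⋈ fun q : Fin n × β => d' q.1 q.2) := by
  induction n with
  | zero =>
    refine he.of_comp (fun i => Sum.elim id (fun q => Fin.elim0 q.1) i) ?_ ?_
    · rintro (i | i)
      · rfl
      · exact i.1.elim0
    · rintro (i | i)
      · rfl
      · exact i.1.elim0
  | succ n ih =>
    have h1 := ih (fun i hi => hU i (by omega)) (fun i hi => hd i (by omega))
      (fun i hi => hd' i (by omega))
    have h2 := (hU n (by omega)).pair h1 (d := d n) (d' := d' n)
      ((hd n (by omega)).mono (by rw [Set.Sum.elim_range, below_eq_range]))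
      ((hd' n (by omega)).mono (by rw [Set.Sum.elim_range, below_eq_range]))
    let g : δ ⊕ Fin (n + 1) × β → β ⊕ (δ ⊕ Fin n × β) := fun i => match i with
      | Sum.inl i => Sum.inr (Sum.inl i)
      | Sum.inr q => if h : q.1.1 < n then Sum.inr (Sum.inr (⟨q.1.1, h⟩, q.2)) else Sum.inl q.2
    have hg : ∀ (e : δ → 𝕄) (d : ℕ → β → 𝕄) i, (e ⋈ fun q : Fin (n + 1) × β => d q.1 q.2) i =
        (d n ⋈ (e ⋈ fun q : Fin n × β => d q.1 q.2)) (g i) := by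
      intro e d i
      rcases i with i | ⟨i, k⟩
      · rfl
      · by_cases h : i.1 < n
        · simp [g, h]
        · have : i.1 = n := by omega
          simp [g, this]
    exact h2.of_comp g (hg e d) (hg e' d')

lemma Mor.unique {U : Ultrafilter (β → 𝕄)} (hU : K.Inv U) {d d' : ℕ → β → 𝕄}
    (hd : K.Mor U d) (hd' : K.Mor U d') (n : ℕ) :
    K.E (fun q : Fin n × β => d q.1 q.2) (fun q : Fin n × β => d' q.1 q.2) := by
  have := mix_unique (K := K) (fun _ => U) (E.refl (Empty.elim : Empty → 𝕄)) (d := d) (d' := d') n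
    (fun _ _ => hU) (fun i _ => by simpa [Set.range_eq_empty] using hd i)
    (fun i _ => by simpa [Set.range_eq_empty] using hd' i)
  exact this.of_comp Sum.inr (fun _ => rfl) (fun _ => rfl)

lemma Mor.sub {U : Ultrafilter (β → 𝕄)} {d : ℕ → β → 𝕄}
    (hd : K.Mor U d) {f : ℕ → ℕ} (hf : StrictMono f) : K.Mor U (d ∘ f) := by
  intro i
  refine (hd (f i)).mono ?_
  rintro y ⟨j, hj, k, rfl⟩
  exact ⟨f j, hf hj, k, rfl⟩

lemma Mor.map {U : Ultrafilter (β → 𝕄)} {d : ℕ → β → 𝕄}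
    (hd : K.Mor U d) (g : α → β) : K.Mor (U.map (· ∘ g)) (fun i => d i ∘ g) := by
  intro i
  refine ((hd i).map g).mono ?_
  rintro y ⟨j, hj, k, rfl⟩
  exact ⟨j, hj, _, rfl⟩

lemma Mor.e {U : Ultrafilter (β → 𝕄)} {d : ℕ → β → 𝕄}
    (hd : K.Mor U d) {b : β → 𝕄} (hb : K.Realizes U ∅ b) (i : ℕ) : K.E (d i) b :=
  (((hd i).mono (Set.empty_subset _)).ea hb).e

end Ctx
end NSOP3Paper

namespace NSOP3Paper
open Filter
namespace Ctx

variable {𝕄 : Type w} (K : Ctx 𝕄) {α β γ δ ξ : Type} {J : Type}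

def InX (X : J → Set 𝕄) (f : β → J) (b : β → 𝕄) : Prop := ∀ i, b i ∈ X (f i)

structure NS (X : J → Set 𝕄) : Prop where
  closed : ∀ j y y', K.E (fun _ : Unit => y) (fun _ : Unit => y') → y ∈ X j → y' ∈ X j
  bound : ∀ {ξ β : Type} (S : (ξ ⊕ β → 𝕄) → Prop) (f : β → J), Countable ξ → Countable β →
    K.D S → ∃ N : ℕ, ∀ B : List Bool → β → 𝕄,
    (∀ η, InX X f (B η)) →
    (∀ η : List Bool, η.length = N → ∃ x, ∀ i < N, S (x ⋈ B (η.take (i + 1)))) →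
    (∀ η₁ η₂ : List Bool, (η₁ ++ [false]) <+: η₂ → η₂.length ≤ N →
      ¬ ∃ x, S (x ⋈ B η₂) ∧ S (x ⋈ B (η₁ ++ [true]))) → False

variable {K}

lemma NS.inX {X : J → Set 𝕄} (h : K.NS X) {f : β → J} {b b' : β → 𝕄} (hE : K.E b b')
    (hb : InX X f b) : InX X f b' := fun i =>
  h.closed _ _ _ (hE.of_comp (fun _ : Unit => i) (fun _ => rfl) (fun _ => rfl)) (hb i)

/-- The base of an array at stage `i`. -/
def abase (c : ℕ → Bool → β → 𝕄) (A : Set 𝕄) (i : ℕ) : Set 𝕄 :=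
  {y | y ∈ A ∨ ∃ j < i, ∃ t k, c j t k = y}

lemma abase_mono (c : ℕ → Bool → β → 𝕄) (A : Set 𝕄) {i j : ℕ} (h : i ≤ j) :
    abase c A i ⊆ abase c A j := by
  rintro y (hy | ⟨t, ht, s, k, rfl⟩)
  · exact Or.inl hy
  · exact Or.inr ⟨t, by omega, s, k, rfl⟩

lemma abase_countable [Countable β] (c : ℕ → Bool → β → 𝕄) {A : Set 𝕄} (hA : A.Countable)
    (i : ℕ) : (abase c A i).Countable := by
  have : abase c A i ⊆ A ∪ Set.range (fun q : ℕ × Bool × β => c q.1 q.2.1 q.2.2) := by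
    rintro y (hy | ⟨t, ht, s, k, rfl⟩)
    · exact Or.inl hy
    · exact Or.inr ⟨(t, s, k), rfl⟩
  exact (hA.union (Set.countable_range _)).mono this

/-- Auxiliary configurations for the array lemma. -/
structure Conf (K : Ctx 𝕄) (X : J → Set 𝕄) (f : β → J) (S : (ξ ⊕ β → 𝕄) → Prop) (k ℓ n : ℕ)
    (c : ℕ → Bool → β → 𝕄) (e : ℕ → β → 𝕄) : Prop where
  cX : ∀ i t, InX X f (c i t)
  eX : ∀ i, InX X f (e i)
  eq : ∀ i < n, K.EA (abase c (below e ℓ) i) (c i false) (c i true)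
  con : ∃ x, (∀ i < n, S (x ⋈ c i false)) ∧ ∀ j < ℓ, S (x ⋈ e j)
  inc : ∀ s : Finset ℕ, (∀ i ∈ s, i < n) → s.card + ℓ = k →
    ¬ ∃ x, (∀ i ∈ s, S (x ⋈ c i true)) ∧ ∀ j < ℓ, S (x ⋈ e j)

lemma conf_step {X : J → Set 𝕄} {f : β → J} {S : (ξ ⊕ β → 𝕄) → Prop} {k ℓ n m : ℕ}
    {c : ℕ → Bool → β → 𝕄} {e : ℕ → β → 𝕄} (h : Conf K X f S k ℓ n c e)
    (hno : ∀ c e, ¬ Conf K X f S k (ℓ + 1) m c e) {p q : ℕ} (hpq : p < q) (hq : q + m ≤ n)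
    (hp : p < n) :
    ¬ ∃ x, S (x ⋈ c p true) ∧ (∀ i < m, S (x ⋈ c (q + i) false)) ∧ ∀ j < ℓ, S (x ⋈ e j) := by
  classical
  rintro ⟨x, hx1, hx2, hx3⟩
  let e' : ℕ → β → 𝕄 := fun j => if j < ℓ then e j else c p true
  have he'1 : ∀ j < ℓ, e' j = e j := fun j hj => by simp [e', hj]
  have he'2 : e' ℓ = c p true := by simp [e']
  refine hno (fun i => c (q + i)) e' ⟨fun i t => h.cX _ _, fun i => ?_, fun i hi => ?_,
    ⟨x, hx2, ?_⟩, ?_⟩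
  · by_cases hi : i < ℓ
    · rw [he'1 i hi]; exact h.eX i
    · simp only [e', hi, if_false]; exact h.cX _ _
  · refine (h.eq (q + i) (by omega)).mono ?_
    rintro y (⟨j, hj, k, rfl⟩ | ⟨j, hj, t, k, rfl⟩)
    · by_cases hjl : j < ℓ
      · rw [he'1 j hjl]; exact Or.inl ⟨j, hjl, k, rfl⟩
      · have : j = ℓ := by omega
        rw [this, he'2]; exact Or.inr ⟨p, by omega, true, k, rfl⟩
    · exact Or.inr ⟨q + j, by omega, t, k, rfl⟩
  · intro j hj
    by_cases hjl : j < ℓ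
    · rw [he'1 j hjl]; exact hx3 j hjl
    · have : j = ℓ := by omega
      rw [this, he'2]; exact hx1
  · rintro s hs hcard ⟨x, hx, hx'⟩
    let s' : Finset ℕ := insert p (s.image (q + ·))
    have hps : p ∉ s.image (q + ·) := by
      simp only [Finset.mem_image, not_exists, not_and]; intro a _ ; omega
    refine h.inc s' ?_ ?_ ⟨x, ?_, ?_⟩
    · intro i hi
      rcases Finset.mem_insert.1 hi with rfl | hi
      · exact hp
      · obtain ⟨j, hj, rfl⟩ := Finset.mem_image.1 hi
        have := hs j hj; omega
    · rw [Finset.card_insert_of_notMem hps,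
        Finset.card_image_of_injective _ (add_right_injective q)]
      omega
    · intro i hi
      rcases Finset.mem_insert.1 hi with rfl | hi
      · have := hx' ℓ (by omega); rwa [he'2] at this
      · obtain ⟨j, hj, rfl⟩ := Finset.mem_image.1 hi
        exact hx j hj
    · intro j hj
      have := hx' j (by omega); rwa [he'1 j hj] at this

/-- Block of consecutive `false` entries. -/
def blk (c : ℕ → Bool → β → 𝕄) (m p : ℕ) : Fin (m + 1) × β → 𝕄 := fun q => c (p + q.1) false q.2

lemma conf_tree [Countable β] {X : J → Set 𝕄} (hX : K.NS X) {f : β → J}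
    {S : (ξ ⊕ β → 𝕄) → Prop} (hS : K.D S) {k ℓ n m : ℕ}
    {c : ℕ → Bool → β → 𝕄} {e : ℕ → β → 𝕄} (h : Conf K X f S k ℓ n c e)
    (hno : ∀ c e, ¬ Conf K X f S k (ℓ + 1) m c e)
    (T : (ξ → 𝕄) → (Fin (m + 1) × β → 𝕄) → Prop)
    (hT : T = fun x y => (∀ t, S (x ⋈ fun k => y (t, k))) ∧ ∀ j < ℓ, S (x ⋈ e j)) (r : ℕ) :
    ∀ p, p + r * (m + 1) ≤ n → ∃ B : List Bool → Fin (m + 1) × β → 𝕄,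
      (∀ η, InX X (fun q => f q.2) (B η)) ∧
      (∀ η : List Bool, η.length = r → K.EA (abase c (below e ℓ) p)
        (fun q : Fin r × (Fin (m + 1) × β) => B (η.take (q.1 + 1)) q.2)
        (fun q : Fin r × (Fin (m + 1) × β) => blk c m (p + q.1 * (m + 1)) q.2)) ∧
      (∀ η₁ η₂ : List Bool, (η₁ ++ [false]) <+: η₂ → η₂.length ≤ r →
        ¬ ∃ x, T x (B η₂) ∧ T x (B (η₁ ++ [true]))) := by
  classical
  have hTd : K.DA (below e ℓ) fun z : (ξ ⊕ Fin (m + 1) × β) → 𝕄 => T (z ∘ Sum.inl) (z ∘ Sum.inr) := by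
    subst hT
    refine DA.and (DA.all_fin fun t => ?_) (DA.lt ℓ fun j hj => ?_)
    · exact (hS.da _).pull _ (by rintro (i | i) <;> exact Or.inl ⟨_, fun _ => rfl⟩)
    · refine (hS.da _).pull _ ?_
      rintro (i | i)
      · exact Or.inl ⟨_, fun _ => rfl⟩
      · exact Or.inr ⟨_, Or.inr (mem_below hj i), fun _ => rfl⟩
  induction r with
  | zero =>
    intro p hp
    refine ⟨fun _ => blk c m 0, fun η i => h.cX _ _ _, fun η hη => ?_, ?_⟩
    · intro C hC hu
      convert hu using 1
      funext q; exact q.1.elim0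
    · rintro η₁ η₂ ⟨s, rfl⟩ h2
      simp at h2
  | succ r ih =>
    intro p hp
    have hp' : p + (m + 1) + r * (m + 1) ≤ n := by rw [Nat.succ_mul] at hp; omega
    have hpn : p + m + 1 ≤ n := by
      have : 0 ≤ r * (m + 1) := Nat.zero_le _
      omega
    obtain ⟨B, hBX, hBp, hBi⟩ := ih (p + (m + 1)) hp'
    have hcnt := abase_countable c (below_countable e ℓ) p
    obtain ⟨d', hd'⟩ := (h.eq p (by omega)).homog hcnt
      ((blk c m p) ⋈ fun q : List Bool × (Fin (m + 1) × β) => B q.1 q.2)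
    let blk1 : Fin (m + 1) × β → 𝕄 := fun q =>
      if q.1 = 0 then c p true q.2 else d' (Sum.inl q)
    let B2 : List Bool → Fin (m + 1) × β → 𝕄 := fun η q => d' (Sum.inr (η, q))
    have hE : K.EA (abase c (below e ℓ) p)
        ((blk c m p) ⋈ fun q : List Bool × (Fin (m + 1) × β) => B q.1 q.2)
        (blk1 ⋈ fun q : List Bool × (Fin (m + 1) × β) => B2 q.1 q.2) := by
      refine hd'.of_comp (fun i => match i with
        | Sum.inl q => if q.1 = 0 then Sum.inl q.2 else Sum.inr (Sum.inl q)
        | Sum.inr q => Sum.inr (Sum.inr q)) ?_ ?_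
      · rintro (⟨t, k⟩ | i)
        · by_cases ht : t = 0
          · subst ht; simp [blk]
          · simp [ht]
        · rfl
      · rintro (⟨t, k⟩ | i)
        · by_cases ht : t = 0
          · subst ht; simp [blk1]
          · simp [ht, blk1]
        · rfl
    let B' : List Bool → Fin (m + 1) × β → 𝕄 := fun η => match η with
      | [] => blk c m p
      | false :: η => if η = [] then blk c m p else B η
      | true :: η => if η = [] then blk1 else B2 η
    have hblk1 : B' [true] = blk1 := rfl
    have hfalse : ∀ η, η ≠ [] → B' (false :: η) = B η := fun η hη => by simp [B', hη]
    have htrue : ∀ η, η ≠ [] → B' (true :: η) = B2 η := fun η hη => by simp [B', hη]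
    have hbX : InX X (fun q : Fin (m + 1) × β => f q.2) (blk c m p) := fun i => h.cX _ _ _
    have hb1X : InX X (fun q : Fin (m + 1) × β => f q.2) blk1 :=
      hX.inX (hE.e.of_comp Sum.inl (fun _ => rfl) (fun _ => rfl)) hbX
    have hB2X : ∀ η, InX X (fun q : Fin (m + 1) × β => f q.2) (B2 η) := fun η =>
      hX.inX (hE.e.of_comp (fun q => Sum.inr (η, q)) (fun _ => rfl) (fun _ => rfl)) (hBX η)
    -- the path equivalence
    have hg : ∀ (u : Fin (m + 1) × β → 𝕄) (G : ℕ → Fin (m + 1) × β → 𝕄)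
        (i : Fin (r + 1) × (Fin (m + 1) × β)),
        (if i.1.1 = 0 then u i.2 else G (i.1.1 - 1) i.2) =
        ((fun q : Fin r × (Fin (m + 1) × β) => G q.1 q.2) ⋈ u)
        (if hh : i.1.1 = 0 then Sum.inr i.2 else Sum.inl (⟨i.1.1 - 1, by omega⟩, i.2)) := by
      intro u G i
      by_cases hi : i.1.1 = 0 <;> simp [hi]
    have hpath0 : ∀ η : List Bool, η.length = r → K.EA (abase c (below e ℓ) p)
        (fun q : Fin (r + 1) × (Fin (m + 1) × β) =>
          if q.1.1 = 0 then blk c m p q.2 else B (η.take (q.1.1 - 1 + 1)) q.2)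
        (fun q : Fin (r + 1) × (Fin (m + 1) × β) => blk c m (p + q.1 * (m + 1)) q.2) := by
      intro η hη
      have h1 := ((hBp η hη).add (blk c m p) fun i => Or.inr
        (Or.inr ⟨p + i.1, by have := i.1.2; omega, false, i.2, rfl⟩)).mono
        (abase_mono c _ (show p ≤ p + (m + 1) by omega))
      refine h1.of_comp _ (hg (blk c m p) fun i => B (η.take (i + 1))) ?_
      intro i
      rw [← hg (blk c m p) fun i => blk c m (p + (m + 1) + i * (m + 1))]
      by_cases hi : i.1.1 = 0
      · simp [hi]
      · simp only [hi, if_false]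
        congr 1
        obtain ⟨t, ht⟩ : ∃ t, i.1.1 = t + 1 := ⟨i.1.1 - 1, by omega⟩
        rw [ht]; simp; ring
    refine ⟨B', ?_, ?_, ?_⟩
    · intro η
      rcases η with _ | ⟨_ | _, η⟩
      · exact hbX
      · by_cases hη : η = []
        · subst hη; exact hbX
        · rw [hfalse η hη]; exact hBX η
      · by_cases hη : η = []
        · subst hη; exact hb1X
        · rw [htrue η hη]; exact hB2X η
    · intro η hη
      rcases η with _ | ⟨t, η⟩
      · simp at hη
      have hη' : η.length = r := by simpa using hη
      have hne : ∀ i : Fin (r + 1), i.1 ≠ 0 → η.take i.1 ≠ [] := by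
        intro i hi h0
        have := congrArg List.length h0
        rw [List.length_take, hη', List.length_nil] at this
        omega
      rcases t with _ | _
      · refine (hpath0 η hη').of_comp id ?_ (fun _ => rfl)
        intro q
        by_cases hq : q.1.1 = 0
        · simp [hq, B']
        · have : q.1.1 - 1 + 1 = q.1.1 := by omega
          simp only [id, hq, if_false, this, List.take_succ_cons]
          rw [hfalse _ (hne _ hq)]
      · refine EA.trans ?_ (hpath0 η hη')
        refine EA.symm (hE.of_comp (fun q : Fin (r + 1) × (Fin (m + 1) × β) =>
          if q.1.1 = 0 then Sum.inl q.2 else Sum.inr (η.take q.1.1, q.2)) ?_ ?_)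
        · intro q
          by_cases hq : q.1.1 = 0
          · simp [hq]
          · have : q.1.1 - 1 + 1 = q.1.1 := by omega
            simp [hq, this]
        · intro q
          by_cases hq : q.1.1 = 0
          · simp [hq, B']
          · simp only [hq, if_false, List.take_succ_cons]
            rw [htrue _ (hne _ hq)]; rfl
    · intro η₁ η₂ hpre hlen
      obtain ⟨s, rfl⟩ := hpre
      rcases η₁ with _ | ⟨t, η₁⟩
      · -- root splitting
        change ¬ ∃ x, T x (B' (false :: s)) ∧ T x (B' [true])
        rw [hblk1]
        by_cases hs : s = []
        · subst hs
          rintro ⟨x, hx1, hx2⟩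
          rw [hT] at hx1 hx2
          refine conf_step h hno (show p < p + 1 by omega) (by omega) (by omega) ⟨x, ?_, ?_, hx1.2⟩
          · have := hx2.1 0; simpa [blk1] using this
          · intro i hi
            have := hx1.1 ⟨i + 1, by omega⟩
            have e1 : p + (i + 1) = p + 1 + i := by omega
            simpa [B', blk, e1] using this
        · rw [hfalse s hs]
          rintro ⟨x, hx1, hx2⟩
          have hx2' : S (x ⋈ c p true) := by
            rw [hT] at hx2
            have := hx2.1 0; simpa [blk1] using this
          simp only [List.nil_append, List.length_append, List.length_cons, List.length_nil] at hlen
          have hsl : 0 < s.length := List.length_pos_of_ne_nil hs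
          let η : List Bool := s ++ List.replicate (r - s.length) false
          have hη : η.length = r := by simp [η]; omega
          let i : Fin r := ⟨s.length - 1, by omega⟩
          have h1 := (hBp η hη).of_comp (fun q : Fin (m + 1) × β => (i, q)) (fun _ => rfl)
            (fun _ => rfl)
          have hsi : η.take (i.1 + 1) = s := by
            have : i.1 + 1 = s.length := by simp [i]; omega
            rw [this]; simp [η]
          simp only [hsi] at h1
          have h2 : K.DA (abase c (below e ℓ) (p + (m + 1))) fun y : Fin (m + 1) × β → 𝕄 =>
              ∃ x, T x y ∧ S (x ⋈ c p true) := by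
            refine DA.ex_of (DA.and ?_ ?_)
            · exact (hTd.mono fun y hy => Or.inl hy).pull
                (fun z => (z ∘ Sum.inr) ⋈ (z ∘ Sum.inl)) (by
                  rintro (i | i) <;> exact Or.inl ⟨_, fun _ => rfl⟩)
            · refine (hS.da _).pull _ ?_
              rintro (i | i)
              · exact Or.inl ⟨_, fun _ => rfl⟩
              · exact Or.inr ⟨_, Or.inr (Or.inr ⟨p, by omega, true, i, rfl⟩), fun _ => rfl⟩
          obtain ⟨x', hx', hx''⟩ := h1 _ h2 ⟨x, hx1, hx2'⟩
          rw [hT] at hx'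
          have hi : (i.1 + 1) * (m + 1) ≤ r * (m + 1) := Nat.mul_le_mul_right _ (by omega)
          rw [Nat.succ_mul] at hi
          refine conf_step h hno (p := p) (q := p + (m + 1) + i.1 * (m + 1)) (by omega) (by omega)
            (by omega) ⟨x', hx'', ?_, hx'.2⟩
          intro j hj
          exact hx'.1 ⟨j, by omega⟩
      · have hpre' : (η₁ ++ [false]) <+: (η₁ ++ [false]) ++ s := List.prefix_append _ _
        have hlen' : ((η₁ ++ [false]) ++ s).length ≤ r := by
          simp at hlen ⊢; omega
        have h0 := hBi η₁ _ hpre' hlen'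
        rcases t with _ | _
        · change ¬ ∃ x, T x (B' (false :: ((η₁ ++ [false]) ++ s))) ∧ T x (B' (false :: (η₁ ++ [true])))
          rw [hfalse _ (by simp), hfalse _ (by simp)]
          exact h0
        · change ¬ ∃ x, T x (B' (true :: ((η₁ ++ [false]) ++ s))) ∧ T x (B' (true :: (η₁ ++ [true])))
          rw [htrue _ (by simp), htrue _ (by simp)]
          intro hcon
          refine h0 ?_
          have h3 : K.DA (abase c (below e ℓ) p)
              fun y : (Fin (m + 1) × β) ⊕ (Fin (m + 1) × β) → 𝕄 =>
              ∃ x, T x (y ∘ Sum.inl) ∧ T x (y ∘ Sum.inr) := by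
            have hTd' := hTd.mono (show below e ℓ ⊆ abase c (below e ℓ) p from fun y hy => Or.inl hy)
            refine DA.ex_of (DA.and ?_ ?_)
            · exact hTd'.pull (fun z => (z ∘ Sum.inr) ⋈ (z ∘ Sum.inl ∘ Sum.inl)) (by
                  rintro (i | i) <;> exact Or.inl ⟨_, fun _ => rfl⟩)
            · exact hTd'.pull (fun z => (z ∘ Sum.inr) ⋈ (z ∘ Sum.inl ∘ Sum.inr)) (by
                  rintro (i | i) <;> exact Or.inl ⟨_, fun _ => rfl⟩)
          have h4 : K.EA (abase c (below e ℓ) p)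
              (B ((η₁ ++ [false]) ++ s) ⋈ B (η₁ ++ [true]))
              (B2 ((η₁ ++ [false]) ++ s) ⋈ B2 (η₁ ++ [true])) :=
            hE.of_comp (fun i => Sum.elim (fun q => Sum.inr ((η₁ ++ [false]) ++ s, q))
              (fun q => Sum.inr (η₁ ++ [true], q)) i)
              (by rintro (i | i) <;> rfl) (by rintro (i | i) <;> rfl)
          have := (h4.iff h3).2 hcon
          exact this

/-- The array lemma. -/
lemma NS.array [Countable β] [Countable ξ] {X : J → Set 𝕄} (hX : K.NS X) (f : β → J)
    {S : (ξ ⊕ β → 𝕄) → Prop} (hS : K.D S) (k : ℕ) :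
    ∃ n : ℕ, ∀ c : ℕ → Bool → β → 𝕄, (∀ i t, InX X f (c i t)) →
      (∀ i < n, K.EA (abase c ∅ i) (c i false) (c i true)) →
      (∃ x, ∀ i < n, S (x ⋈ c i false)) →
      (∀ s : Finset ℕ, (∀ i ∈ s, i < n) → s.card = k → ¬ ∃ x, ∀ i ∈ s, S (x ⋈ c i true)) →
      False := by
  classical
  by_contra hcon
  push Not at hcon
  let G : ℕ → Prop := fun ℓ => ∀ n, ∃ c e, Conf K X f S k ℓ n c e
  have G0 : G 0 := by
    intro n
    obtain ⟨c, h1, h2, ⟨x, hx⟩, h4, -⟩ := hcon n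
    refine ⟨c, fun i => c i false, h1, fun i => h1 _ _, ?_, ⟨x, hx, by simp⟩, ?_⟩
    · intro i hi
      rw [below_zero]; exact h2 i hi
    · rintro s hs hc ⟨x, hx, -⟩
      obtain ⟨i, hi, hi'⟩ := h4 s hs (by omega) x
      exact hi' (hx i hi)
  have Gk : ¬ G k := by
    intro h
    obtain ⟨c, e, hc⟩ := h 0
    obtain ⟨x, -, hx⟩ := hc.con
    exact hc.inc ∅ (by simp) (by simp) ⟨x, by simp, hx⟩
  obtain ⟨ℓ, hℓ, hℓ'⟩ : ∃ ℓ, G ℓ ∧ ¬ G (ℓ + 1) := by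
    by_contra hno
    push Not at hno
    exact Gk (Nat.rec G0 (fun n ih => hno n ih) k)
  simp only [G, not_forall] at hℓ'
  obtain ⟨m, hm⟩ := hℓ'
  push Not at hm
  let S' : (ξ ⊕ ((Fin (m + 1) × β) ⊕ (Fin ℓ × β)) → 𝕄) → Prop := fun z =>
    (∀ t : Fin (m + 1), S ((z ∘ Sum.inl) ⋈ fun k => z (Sum.inr (Sum.inl (t, k))))) ∧
    (∀ t : Fin ℓ, S ((z ∘ Sum.inl) ⋈ fun k => z (Sum.inr (Sum.inr (t, k)))))
  have hS' : K.D S' := by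
    refine DA.d (DA.and (DA.all_fin fun t => ?_) (DA.all_fin fun t => ?_))
    · exact (hS.da _).pull _ (by rintro (i | i) <;> exact Or.inl ⟨_, fun _ => rfl⟩)
    · exact (hS.da _).pull _ (by rintro (i | i) <;> exact Or.inl ⟨_, fun _ => rfl⟩)
  obtain ⟨N, hN⟩ := hX.bound S' (Sum.elim (fun q => f q.2) fun q => f q.2) inferInstance
    inferInstance hS'
  obtain ⟨c, e, hc⟩ := hℓ (0 + N * (m + 1))
  obtain ⟨B, hBX, hBp, hBi⟩ := conf_tree hX hS hc hm _ rfl N 0 le_rfl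
  have hST : ∀ x η, S' (x ⋈ (B η ⋈ fun q : Fin ℓ × β => e q.1 q.2)) ↔
      (∀ t, S (x ⋈ fun k => B η (t, k))) ∧ ∀ j < ℓ, S (x ⋈ e j) := by
    intro x η
    refine and_congr Iff.rfl ?_
    constructor
    · intro h j hj; exact h ⟨j, hj⟩
    · intro h j; exact h j.1 j.2
  refine hN (fun η => B η ⋈ fun q : Fin ℓ × β => e q.1 q.2) ?_ ?_ ?_
  · intro η i
    rcases i with i | i
    · exact hBX η i
    · exact hc.eX _ _
  · intro η hη
    obtain ⟨x, hx1, hx2⟩ := hc.con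
    have hd : K.DA (abase c (below e ℓ) 0) fun y : Fin N × (Fin (m + 1) × β) → 𝕄 =>
        ∃ x, (∀ i : Fin N, ∀ t, S (x ⋈ fun k => y (i, (t, k)))) ∧ ∀ j < ℓ, S (x ⋈ e j) := by
      refine DA.ex_of (DA.and (DA.all_fin fun i => DA.all_fin fun t => ?_)
        (DA.lt ℓ fun j hj => ?_))
      · exact (hS.da _).pull _ (by rintro (i | i) <;> exact Or.inl ⟨_, fun _ => rfl⟩)
      · refine (hS.da _).pull _ ?_
        rintro (i | i)
        · exact Or.inl ⟨_, fun _ => rfl⟩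
        · exact Or.inr ⟨_, Or.inr (Or.inl ⟨j, hj, i, rfl⟩), fun _ => rfl⟩
    obtain ⟨x', hx', hx''⟩ := ((hBp η hη).iff hd).2 ⟨x, fun i t => by
      have h1 : (i.1 + 1) * (m + 1) ≤ N * (m + 1) := Nat.mul_le_mul_right _ (by omega)
      rw [Nat.succ_mul] at h1
      exact hx1 (0 + i.1 * (m + 1) + t.1) (by have := t.2; omega), hx2⟩
    exact ⟨x', fun i hi => (hST _ _).2 ⟨fun t => hx' ⟨i, hi⟩ t, hx''⟩⟩
  · rintro η₁ η₂ hpre hlen ⟨x, h1, h2⟩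
    exact hBi η₁ η₂ hpre hlen ⟨x, (hST _ _).1 h1, (hST _ _).1 h2⟩

end Ctx
end NSOP3Paper

namespace NSOP3Paper
open Filter
namespace Ctx

variable {𝕄 : Type w} (K : Ctx 𝕄) {α β γ δ ξ : Type} {J : Type}

def WkS (S : (ξ ⊕ β → 𝕄) → Prop) (b : β → 𝕄) : Prop :=
  ∀ n : ℕ, ∃ c : ℕ → β → 𝕄, (∀ i < n, K.E (c i) b ∧ K.Gen (below c i) (c i)) ∧
    ∃ x, ∀ i < n, S (x ⋈ c i)

def StS (S : (ξ ⊕ β → 𝕄) → Prop) (b : β → 𝕄) : Prop :=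
  ∀ U : Ultrafilter (β → 𝕄), K.Inv U → K.Realizes U ∅ b → ∀ d, K.Mor U d →
    ∀ n : ℕ, ∃ x, ∀ i < n, S (x ⋈ d i)

def Wk (a : α → 𝕄) (b : β → 𝕄) : Prop :=
  ∀ S : (α ⊕ β → 𝕄) → Prop, K.D S → S (a ⋈ b) → K.WkS S b

def Good (X : J → Set 𝕄) (b : β → 𝕄) : Prop := ∃ f, InX X f b

variable {K}

lemma exists_mor' [Countable α] (U : Ultrafilter (α → 𝕄)) : ∃ d : ℕ → α → 𝕄, K.Mor U d := by
  obtain ⟨d, hd⟩ := exists_mor (K := K) U Set.countable_empty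
  exact ⟨d, fun i => by simpa using hd i⟩

lemma mix_unique' (U : ℕ → Ultrafilter (β → 𝕄)) {d d' : ℕ → β → 𝕄} (n : ℕ)
    (hU : ∀ i < n, K.Inv (U i)) (hd : ∀ i < n, K.Realizes (U i) (below d i) (d i))
    (hd' : ∀ i < n, K.Realizes (U i) (below d' i) (d' i)) :
    K.E (fun q : Fin n × β => d q.1 q.2) (fun q : Fin n × β => d' q.1 q.2) := by
  have := mix_unique (K := K) U (E.refl (Empty.elim : Empty → 𝕄)) (d := d) (d' := d') n
    hU (fun i hi => by simpa [Set.range_eq_empty] using hd i hi)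
    (fun i hi => by simpa [Set.range_eq_empty] using hd' i hi)
  exact this.of_comp Sum.inr (fun _ => rfl) (fun _ => rfl)

lemma D.con {S : (ξ ⊕ β → 𝕄) → Prop} (hS : K.D S) (n : ℕ) :
    K.D fun y : Fin n × β → 𝕄 => ∃ x, ∀ i : Fin n, S (x ⋈ fun k => y (i, k)) := by
  refine DA.d (DA.ex_of (DA.all_fin fun i => ?_))
  exact (hS.da _).pull _ (by rintro (i | i) <;> exact Or.inl ⟨_, fun _ => rfl⟩)

lemma E.con {S : (ξ ⊕ β → 𝕄) → Prop} (hS : K.D S) {n : ℕ} {d d' : ℕ → β → 𝕄}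
    (h : K.E (fun q : Fin n × β => d q.1 q.2) (fun q : Fin n × β => d' q.1 q.2))
    (hx : ∃ x, ∀ i < n, S (x ⋈ d i)) : ∃ x, ∀ i < n, S (x ⋈ d' i) := by
  obtain ⟨x, hx⟩ := hx
  obtain ⟨x', hx'⟩ := h _ (hS.con n) ⟨x, fun i => hx i i.2⟩
  exact ⟨x', fun i hi => hx' ⟨i, hi⟩⟩

lemma EA.mix {V : ℕ → Ultrafilter (β → 𝕄)} {d : ℕ → β → 𝕄} (hV : ∀ i, K.Inv (V i))
    (hd : ∀ i, K.Realizes (V i) (below d i) (d i)) {u v : α → 𝕄} {N : ℕ}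
    (hu : Set.range u ⊆ below d N) (hv : Set.range v ⊆ below d N) (h : K.E u v) (s : ℕ) :
    K.EA {y | ∃ j, N ≤ j ∧ j < s ∧ ∃ k, d j k = y} u v := by
  induction s with
  | zero => exact h.ea.mono (by rintro y ⟨j, _, h, _⟩; omega)
  | succ s ih =>
    by_cases hs : N ≤ s
    · refine (ih.preserve (hV s) ((hd s).mono ?_)).mono ?_
      · rintro y ((⟨j, h1, h2, k, rfl⟩ | hy) | hy)
        · exact ⟨j, h2, k, rfl⟩
        · exact below_mono hs (hu hy)
        · exact below_mono hs (hv hy)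
      · rintro y ⟨j, h1, h2, k, rfl⟩
        rcases Nat.lt_succ_iff_lt_or_eq.1 h2 with h3 | rfl
        · exact Or.inl ⟨j, h1, h3, k, rfl⟩
        · exact Or.inr ⟨k, rfl⟩
    · exact ih.mono (by rintro y ⟨j, h1, h2, k, rfl⟩; exact ⟨j, h1, by omega, k, rfl⟩)

lemma Mor.con_sub {U : Ultrafilter (β → 𝕄)} (hU : K.Inv U) {d d' : ℕ → β → 𝕄}
    (hd : K.Mor U d) (hd' : K.Mor U d') {S : (ξ ⊕ β → 𝕄) → Prop} (hS : K.D S)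
    (s : Finset ℕ) (h : ∃ x, ∀ i ∈ s, S (x ⋈ d i)) : ∃ x, ∀ i < s.card, S (x ⋈ d' i) := by
  obtain ⟨x, hx⟩ := h
  let g := s.orderEmbOfFin rfl
  let d'' : ℕ → β → 𝕄 := fun i => if h : i < s.card then d (g ⟨i, h⟩) else d 0
  have hd'' : ∀ i (h : i < s.card), d'' i = d (g ⟨i, h⟩) := fun i h => by simp [d'', h]
  refine E.con hS (mix_unique' (fun _ => U) s.card (d := d'') (fun _ _ => hU) ?_ (fun i _ => hd' i))
    ⟨x, fun i hi => ?_⟩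
  · intro i hi
    rw [hd'' i hi]
    refine (hd (g ⟨i, hi⟩)).mono ?_
    rintro y ⟨j, hj, k, rfl⟩
    rw [hd'' j (by omega)]
    exact ⟨g ⟨j, by omega⟩, g.strictMono (by simpa using hj), k, rfl⟩
  · rw [hd'' i hi]; exact hx _ (s.orderEmbOfFin_mem rfl _)

/-- The Kim lemma. -/
lemma WkS.st [Countable β] [Countable ξ] {X : J → Set 𝕄} (hX : K.NS X) {b : β → 𝕄}
    (hb : Good X b) {S : (ξ ⊕ β → 𝕄) → Prop} (hS : K.D S) (h : K.WkS S b) : K.StS S b := by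
  classical
  obtain ⟨f, hf⟩ := hb
  intro U hU hUb d hd k
  by_contra hk
  obtain ⟨n, hn⟩ := hX.array f hS k
  obtain ⟨c, hc, hcon⟩ := h n
  have hc' : ∀ i, ∃ W, i < n → K.Inv W ∧ K.Realizes W (below c i) (c i) := by
    intro i
    by_cases hi : i < n
    · obtain ⟨W, hW⟩ := (hc i hi).2
      exact ⟨W, fun _ => hW⟩
    · exact ⟨U, fun h => (hi h).elim⟩
  choose W0 hW0 using hc'
  let W : ℕ → Ultrafilter (β → 𝕄) := fun i => if i < n then W0 i else U
  have hWinv : ∀ i, K.Inv (W i) := by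
    intro i
    by_cases hi : i < n
    · simp only [W, hi, if_true]; exact (hW0 i hi).1
    · simp only [W, hi, if_false]; exact hU
  let V : ℕ → Ultrafilter (β → 𝕄) := fun i => if i % 2 = 0 then W (i / 2) else U
  have hV0 : ∀ t, V (2 * t) = W t := fun t => by simp [V]
  have hV1 : ∀ t, V (2 * t + 1) = U := fun t => by simp [V, Nat.add_mod]
  have hVinv : ∀ i, K.Inv (V i) := by
    intro i
    by_cases hi : i % 2 = 0
    · simp only [V, hi, if_true]; exact hWinv _
    · simp only [V, hi, if_false]; exact hU
  obtain ⟨v, hv⟩ := exists_mix (K := K) V Set.countable_empty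
  replace hv : ∀ i, K.Realizes (V i) (below v i) (v i) := fun i => by simpa using hv i
  have hv1b : ∀ t, K.E (v (2 * t + 1)) b := by
    intro t
    have := hv (2 * t + 1)
    rw [hV1] at this
    exact ((this.mono (Set.empty_subset _)).ea hUb).e
  have hv0b : ∀ t, K.E (v (2 * t)) b := by
    intro t
    have := hv (2 * t)
    rw [hV0] at this
    by_cases ht : t < n
    · simp only [W, ht, if_true] at this
      exact ((this.mono (Set.empty_subset _)).ea ((hW0 t ht).2.mono (Set.empty_subset _))).e.trans
        (hc t ht).1
    · simp only [W, ht, if_false] at this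
      exact ((this.mono (Set.empty_subset _)).ea hUb).e
  let c' : ℕ → Bool → β → 𝕄 := fun i t => v (2 * (n - 1 - i) + if t then 1 else 0)
  have hmor1 : K.Mor U (fun t => v (2 * t + 1)) := by
    intro t
    have := hv (2 * t + 1)
    rw [hV1] at this
    refine this.mono ?_
    rintro y ⟨j, hj, k, rfl⟩
    exact ⟨2 * j + 1, by omega, k, rfl⟩
  refine hn c' ?_ ?_ ?_ ?_
  · intro i t
    rcases t with _ | _
    · exact hX.inX (hv0b _).symm hf
    · exact hX.inX (hv1b _).symm hf
  · intro i hi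
    refine (EA.mix hVinv hv (u := c' i false) (v := c' i true) (N := 2 * (n - 1 - i) + 2) ?_ ?_
      ((hv0b _).trans (hv1b _).symm) (2 * n)).mono ?_
    · rintro _ ⟨k, rfl⟩; exact mem_below (by simp) _
    · rintro _ ⟨k, rfl⟩; exact mem_below (by simp) _
    · rintro y (hy | ⟨j, hj, t, k, rfl⟩)
      · exact hy.elim
      · refine ⟨2 * (n - 1 - j) + if t then 1 else 0, ?_, ?_, k, rfl⟩ <;> split_ifs <;> omega
  · obtain ⟨x, hx⟩ := E.con hS (d := c) (d' := fun t => v (2 * t))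
      (mix_unique' W n (fun i _ => hWinv i) (fun i hi => by
        simp only [W, hi, if_true]; exact (hW0 i hi).2) (fun i _ => by
        have := hv (2 * i)
        rw [hV0] at this
        refine this.mono ?_
        rintro y ⟨j, hj, k, rfl⟩
        exact ⟨2 * j, by omega, k, rfl⟩)) hcon
    exact ⟨x, fun i hi => hx (n - 1 - i) (by omega)⟩
  · rintro s hs hcard ⟨x, hx⟩
    have hinj : Set.InjOn (fun i => n - 1 - i) (s : Set ℕ) := by
      intro i hi j hj hij
      have := hs i hi; have := hs j hj
      simp only at hij; omega
    have := Mor.con_sub hU hmor1 hd hS (s.image fun i => n - 1 - i) ⟨x, fun i hi => by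
      obtain ⟨j, hj, rfl⟩ := Finset.mem_image.1 hi
      exact hx j hj⟩
    rw [Finset.card_image_of_injOn hinj, hcard] at this
    exact hk this

/-! ### Weak independence -/

lemma Gen.of_ea {A : Set 𝕄} {d d' : α → 𝕄} (h : K.Gen A d) (h' : K.EA A d d') : K.Gen A d' := by
  obtain ⟨U, hU, hd⟩ := h
  exact ⟨U, hU, hd.of_ea h'⟩

lemma WkS.of_e {S : (ξ ⊕ β → 𝕄) → Prop} {b b' : β → 𝕄} (h : K.WkS S b) (hb : K.E b b') :
    K.WkS S b' := by
  intro n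
  obtain ⟨c, hc, hx⟩ := h n
  exact ⟨c, fun i hi => ⟨(hc i hi).1.trans hb, (hc i hi).2⟩, hx⟩

lemma WkS.imp {S S' : (ξ ⊕ β → 𝕄) → Prop} {b : β → 𝕄} (h : K.WkS S b)
    (hS : ∀ z, S z → S' z) : K.WkS S' b := by
  intro n
  obtain ⟨c, hc, x, hx⟩ := h n
  exact ⟨c, hc, x, fun i hi => hS _ (hx i hi)⟩

lemma Wk.of_e {a a' : α → 𝕄} {b b' : β → 𝕄} (h : K.Wk a b) (he : K.E (a ⋈ b) (a' ⋈ b')) :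
    K.Wk a' b' := by
  intro S hS hab
  exact (h S hS ((he.iff hS).2 hab)).of_e (he.of_comp Sum.inr (fun _ => rfl) (fun _ => rfl))

lemma Wk.reindex {a : α → 𝕄} {b : β → 𝕄} (h : K.Wk a b) (g : γ → α) (g' : δ → β) :
    K.Wk (a ∘ g) (b ∘ g') := by
  intro S hS hab n
  obtain ⟨c, hc, x, hx⟩ := h (fun z => S (z ∘ Sum.map g g')) (K.d_comp _ hS) (by
    simpa [Sum.elim_comp_map] using hab) n
  refine ⟨fun i => c i ∘ g', fun i hi => ⟨(hc i hi).1.comp g', ?_⟩, x ∘ g, fun i hi => ?_⟩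
  · refine ((hc i hi).2.map g').mono ?_
    rintro y ⟨j, hj, k, rfl⟩
    exact ⟨j, hj, _, rfl⟩
  · simpa [Sum.elim_comp_map] using hx i hi

lemma Wk.of_comp {a : α → 𝕄} {b : β → 𝕄} (h : K.Wk a b) (g : γ → α) (g' : δ → β)
    {a' : γ → 𝕄} {b' : δ → 𝕄} (ha : ∀ i, a' i = a (g i)) (hb : ∀ i, b' i = b (g' i)) :
    K.Wk a' b' := by
  have h1 : a' = a ∘ g := funext ha
  have h2 : b' = b ∘ g' := funext hb
  rw [h1, h2]; exact h.reindex g g'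

/-- Limit principle. -/
lemma limit_principle [Countable α] [Countable β] {b : β → 𝕄} {D : ℕ → β → 𝕄}
    (hD : ∀ i, K.E (D i) b) (hG : ∀ i, K.Gen (below D i) (D i)) (a : α → 𝕄) :
    ∃ a' : α → 𝕄, K.Wk a' b ∧ ∀ C, K.D C → (∀ i, C (a ⋈ D i)) → C (a' ⋈ b) := by
  have h1 : ∀ i, ∃ a' : α → 𝕄, K.E (D i ⋈ a) (b ⋈ a') := fun i => (hD i).homog a
  choose a' ha' using h1
  have h2 : ∀ i, K.E (a ⋈ D i) (a' i ⋈ b) := fun i =>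
    (ha' i).of_comp Sum.swap (by rintro (i | i) <;> rfl) (by rintro (i | i) <;> rfl)
  obtain ⟨a'', ha''⟩ := exists_limit_over (K := K) (hyperfilter ℕ) a' (Set.countable_range b)
  have h3 : ∀ C, K.D C → (∀ᶠ i in (hyperfilter ℕ : Filter ℕ), C (a ⋈ D i)) → C (a'' ⋈ b) := by
    intro C hC h
    refine ha'' (fun x => C (x ⋈ b)) (hC.sub b fun i => ⟨i, rfl⟩) ?_
    filter_upwards [h] with i hi using (h2 i) C hC hi
  refine ⟨a'', ?_, fun C hC h => h3 C hC (Eventually.of_forall h)⟩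
  intro S hS hab n
  have h4 : ∀ᶠ i in (hyperfilter ℕ : Filter ℕ), S (a ⋈ D i) := by
    by_contra hn
    rw [← Ultrafilter.eventually_not] at hn
    exact h3 _ (K.d_not hS) hn hab
  have h5 : ∃ᶠ i in atTop, S (a ⋈ D i) := h4.frequently.filter_mono Nat.hyperfilter_le_atTop
  obtain ⟨φ, hφ, hS⟩ := extraction_of_frequently_atTop h5
  refine ⟨D ∘ φ, fun i _ => ⟨hD _, (hG (φ i)).mono ?_⟩, a, fun i _ => hS i⟩
  rintro y ⟨j, hj, k, rfl⟩
  exact ⟨φ j, hφ hj, k, rfl⟩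

lemma e_flat {d d' : ℕ → β → 𝕄} {A : Set 𝕄}
    (h : ∀ n, K.EA A (fun q : Fin n × β => d q.1 q.2) (fun q : Fin n × β => d' q.1 q.2)) :
    K.EA A (flat d) (flat d') := by
  apply ea_of_finite
  intro s
  let N := s.sup (fun q => q.1) + 1
  have : ∀ i : s, i.1.1 < N := fun i => Nat.lt_succ_of_le (Finset.le_sup (f := fun q => q.1) i.2)
  exact (h N).of_comp (fun i => (⟨i.1.1, this i⟩, i.1.2)) (fun _ => rfl) (fun _ => rfl)

lemma Mor.unique_flat {U : Ultrafilter (β → 𝕄)} (hU : K.Inv U) {d d' : ℕ → β → 𝕄}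
    (hd : K.Mor U d) (hd' : K.Mor U d') : K.E (flat d) (flat d') :=
  (e_flat fun n => (hd.unique hU hd' n).ea).e

lemma FS.fin {A : Set 𝕄} {d : ℕ → β → 𝕄} (n : ℕ)
    (h : ∀ i < n, K.FS (A ∪ below d i) (d i)) : K.FS A (fun q : Fin n × β => d q.1 q.2) := by
  induction n with
  | zero =>
    intro C hC hd
    exact ⟨_, fun q => q.1.elim0, hd⟩
  | succ n ih =>
    intro C hC hd
    let G : ((Fin n × β → 𝕄)) → (β → 𝕄) → (Fin (n + 1) × β → 𝕄) := fun u y q =>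
      if h : q.1.1 < n then u (⟨q.1.1, h⟩, q.2) else y q.2
    have h0 : (fun q : Fin (n + 1) × β => d q.1 q.2) = G (fun q => d q.1 q.2) (d n) := by
      funext q
      by_cases hq : q.1.1 < n
      · simp [G, hq]
      · have : q.1.1 = n := by omega
        simp [G, this]
    rw [h0] at hd
    obtain ⟨m, hm, hCm⟩ := h n (by omega) (fun y => C (G (fun q => d q.1 q.2) y))
      ((hC.mono Set.subset_union_left).pull _ (by
        intro q
        by_cases hq : q.1.1 < n
        · exact Or.inr ⟨d q.1 q.2, Or.inr (Or.inr (mem_below hq _)), fun x => by simp [G, hq]⟩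
        · exact Or.inl ⟨q.2, fun x => by simp [G, hq]⟩)) hd
    obtain ⟨m', hm', hCm'⟩ := ih (fun i hi => h i (by omega)) (fun u => C (G u m))
      (hC.pull _ (by
        intro q
        by_cases hq : q.1.1 < n
        · exact Or.inl ⟨(⟨q.1.1, hq⟩, q.2), fun x => by simp [G, hq]⟩
        · exact Or.inr ⟨m q.2, Or.inl (hm _), fun x => by simp [G, hq]⟩)) hCm
    refine ⟨_, fun q => ?_, hCm'⟩
    by_cases hq : q.1.1 < n
    · simp [G, hq, hm']
    · simp [G, hq, hm]

lemma FS.of_finite {A : Set 𝕄} {d : α → 𝕄} (h : ∀ s : Finset α, K.FS A (fun i : s => d i)) :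
    K.FS A d := by
  classical
  intro C hC hd
  obtain ⟨s, C0, h0, hC⟩ := hC.supp
  rw [hC] at hd
  obtain ⟨m, hm, hCm⟩ := h s C0 h0 hd
  obtain ⟨z, hz⟩ := exists_mem K
  refine ⟨fun i => if hi : i ∈ s then m ⟨i, hi⟩ else z, fun i => ?_, ?_⟩
  · by_cases hi : i ∈ s <;> simp [hi, hm, hz]
  · rw [hC]; simpa using hCm

lemma FS.flat {A : Set 𝕄} {d : ℕ → β → 𝕄}
    (h : ∀ i, K.FS (A ∪ below d i) (d i)) : K.FS A (flat d) := by
  apply FS.of_finite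
  intro s
  let N := s.sup (fun q => q.1) + 1
  have : ∀ i : s, i.1.1 < N := fun i => Nat.lt_succ_of_le (Finset.le_sup (f := fun q => q.1) i.2)
  exact (FS.fin N fun i _ => h i).of_comp subset_rfl (fun i => (⟨i.1.1, this i⟩, i.1.2))
    (fun _ => rfl)

/-- Realizing simultaneously the type along sequences. -/
lemma exists_along [Countable α] [Countable β] {a : α → 𝕄} {b : β → 𝕄} {ι : Type} [Countable ι]
    (d : ι → β → 𝕄)
    (h : ∀ S, K.D S → S (a ⋈ b) → ∀ s : Finset ι, ∃ x : α → 𝕄, ∀ i ∈ s, S (x ⋈ d i)) :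
    ∃ x : α → 𝕄, ∀ i, K.E (a ⋈ b) (x ⋈ d i) := by
  classical
  obtain ⟨x, hx⟩ := sat (K := K) (A := Set.range (NSOP3Paper.flat d)) (Set.countable_range _)
    (ι := {S : (α ⊕ β → 𝕄) → Prop // K.D S ∧ S (a ⋈ b)} × ι) (fun p x => p.1.1 (x ⋈ d p.2))
    (fun p => p.1.2.1.sub _ fun k => ⟨(p.2, k), rfl⟩) (by
      intro s
      obtain ⟨x, hx⟩ := h (fun z => ∀ p ∈ s, p.1.1 z)
        (DA.d (DA.ball s fun p _ => p.1.2.1.da _)) (fun p _ => p.1.2.2) (s.image Prod.snd)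
      exact ⟨x, fun p hp => hx p.2 (Finset.mem_image_of_mem _ hp) p hp⟩)
  exact ⟨x, fun i S hS hab => hx (⟨S, hS, hab⟩, i)⟩

lemma Wk.along [Countable α] [Countable β] {X : J → Set 𝕄} (hX : K.NS X) {a : α → 𝕄}
    {b : β → 𝕄} (hb : Good X b) (h : K.Wk a b) {U : Ultrafilter (β → 𝕄)} (hU : K.Inv U)
    (hUb : K.Realizes U ∅ b) {d : ℕ → β → 𝕄} (hd : K.Mor U d) :
    ∃ x : α → 𝕄, ∀ i, K.E (a ⋈ b) (x ⋈ d i) := by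
  apply exists_along
  intro S hS hab s
  obtain ⟨x, hx⟩ := (h S hS hab).st hX hb hS U hU hUb d hd (s.sup id + 1)
  exact ⟨x, fun i hi => hx i (Nat.lt_succ_of_le (Finset.le_sup (f := id) hi))⟩

/-- The chain condition. -/
lemma Wk.chain [Countable α] [Countable β] {X : J → Set 𝕄} (hX : K.NS X) {a : α → 𝕄}
    {b : β → 𝕄} (hb : Good X b) (h : K.Wk a b) {U : Ultrafilter (β → 𝕄)} (hU : K.Coh U)
    (hUb : K.Realizes U ∅ b) {d : ℕ → β → 𝕄} (hd : K.Mor U d) :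
    ∃ x : α → 𝕄, (∀ i, K.E (a ⋈ b) (x ⋈ d i)) ∧ K.Wk x (NSOP3Paper.flat d) := by
  classical
  -- blocks
  have : Nonempty (ℕ → β → 𝕄) := ⟨fun _ _ => Classical.choice K.ne⟩
  obtain ⟨D, hD⟩ : ∃ D : ℕ → ℕ → β → 𝕄, ∀ i, ∀ j,
      K.Realizes U (below (fun i => NSOP3Paper.flat (D i)) i ∪ below (D i) j) (D i j) := by
    apply exists_seq (fun i (D : ℕ → ℕ → β → 𝕄) (x : ℕ → β → 𝕄) => ∀ j,
      K.Realizes U (below (fun i => NSOP3Paper.flat (D i)) i ∪ below x j) (x j))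
    · intro n f g hfg x hx j
      have : below (fun i => NSOP3Paper.flat (f i)) n = below (fun i => NSOP3Paper.flat (g i)) n :=
        below_congr fun i hi => by rw [hfg i hi]
      rw [← this]; exact hx j
    · intro n f
      exact exists_mor U (below_countable _ n)
  have hDm : ∀ i, K.Mor U (D i) := fun i j => (hD i j).mono Set.subset_union_right
  obtain ⟨x, hx⟩ : ∃ x : α → 𝕄, ∀ q : ℕ × ℕ, K.E (a ⋈ b) (x ⋈ D q.1 q.2) := by
    apply exists_along
    intro S hS hab s
    let A := s.sup (fun q => q.1) + 1
    let B := s.sup (fun q => q.2) + 1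
    have hB : 0 < B := Nat.succ_pos _
    obtain ⟨e, he⟩ := exists_mor' (K := K) U
    have h1 := (h S hS hab).st hX hb hS U hU.inv hUb e he (A * B)
    obtain ⟨x, hx⟩ := E.con hS (d := e) (d' := fun t => D (t / B) (t % B))
      (mix_unique' (fun _ => U) (A * B) (fun _ _ => hU.inv) (fun i _ => he i) (by
        intro i _
        refine (hD (i / B) (i % B)).mono ?_
        rintro y ⟨j, hj, k, rfl⟩
        rcases Nat.lt_or_ge (j / B) (i / B) with hlt | hge
        · exact Or.inl ⟨j / B, hlt, (j % B, k), rfl⟩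
        · have heq : j / B = i / B := le_antisymm (Nat.div_le_div_right hj.le) hge
          right
          change D (j / B) (j % B) k ∈ _
          rw [heq]
          refine ⟨j % B, ?_, k, rfl⟩
          have h1 := Nat.div_add_mod j B
          have h2 := Nat.div_add_mod i B
          rw [heq] at h1
          omega)) h1
    refine ⟨x, fun q hq => ?_⟩
    have hq1 : q.1 < A := Nat.lt_succ_of_le (Finset.le_sup (f := fun q => q.1) hq)
    have hq2 : q.2 < B := Nat.lt_succ_of_le (Finset.le_sup (f := fun q => q.2) hq)
    have h3 := hx (B * q.1 + q.2) (by
      have : (q.1 + 1) * B ≤ A * B := Nat.mul_le_mul_right _ hq1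
      rw [Nat.succ_mul] at this
      rw [Nat.mul_comm B]; omega)
    rwa [Nat.mul_add_div hB, Nat.div_eq_of_lt hq2, Nat.mul_add_mod, Nat.mod_eq_of_lt hq2,
      Nat.add_zero] at h3
  have hFS : ∀ i, K.FS (below (fun i => NSOP3Paper.flat (D i)) i) (NSOP3Paper.flat (D i)) :=
    fun i => FS.flat fun j => hU.fs (hD i j)
  obtain ⟨a', ha', hC⟩ := limit_principle (K := K) (b := NSOP3Paper.flat d)
    (D := fun i => NSOP3Paper.flat (D i))
    (fun i => (hDm i).unique_flat hU.inv hd) (fun i => (hFS i).gen) x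
  refine ⟨a', fun j S hS hab => ?_, ha'⟩
  have := hC (fun z => S ((z ∘ Sum.inl) ⋈ fun k => z (Sum.inr (j, k))))
    (hS.pull _ (by rintro (i | i) <;> exact Or.inl ⟨_, fun _ => rfl⟩))
    (fun i => hx (i, j) S hS hab)
  exact this

end Ctx
end NSOP3Paper

namespace NSOP3Paper
open Filter

/-! ### Spine addresses -/

def IsSA (f : ℕ → Fin 3 → ℕ) : Prop := ∀ k, StrictMono (f k)

def adr (f : ℕ → Fin 3 → ℕ) (k : ℕ) (e : Fin 3) : List ℕ :=
  (List.range k).map (fun i => f i 0) ++ [f k e]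

lemma adr_zero (f : ℕ → Fin 3 → ℕ) (e : Fin 3) : adr f 0 e = [f 0 e] := rfl

lemma adr_succ (f : ℕ → Fin 3 → ℕ) (k : ℕ) (e : Fin 3) :
    adr f (k + 1) e = f 0 0 :: adr (fun i => f (i + 1)) k e := by
  simp [adr, List.range_succ_eq_map, Function.comp_def]

lemma adr_congr {f g : ℕ → Fin 3 → ℕ} {k : ℕ} (h : ∀ i ≤ k, f i = g i) (e : Fin 3) :
    adr f k e = adr g k e := by
  unfold adr
  rw [h k le_rfl]
  congr 1
  apply List.map_congr_left
  intro i hi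
  rw [h i (List.mem_range.1 hi).le]

lemma three_color {κ : Type*} [Finite κ] (g : ℕ → ℕ → κ) :
    ∃ s : Fin 3 → ℕ, StrictMono s ∧ g (s 0) (s 2) = g (s 1) (s 2) := by
  classical
  cases nonempty_fintype κ
  let N := Fintype.card κ + 1
  obtain ⟨x, y, hxy, h⟩ := Fintype.exists_ne_map_eq_of_card_lt (fun i : Fin N => g i N)
    (by simp [N])
  have key : ∀ x y : Fin N, x < y → g x N = g y N →
      ∃ s : Fin 3 → ℕ, StrictMono s ∧ g (s 0) (s 2) = g (s 1) (s 2) := by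
    intro x y hxy h
    refine ⟨![x, y, N], ?_, by simpa using h⟩
    have := x.2; have := y.2
    rw [Fin.strictMono_iff_lt_succ]
    intro i
    fin_cases i
    · simpa using hxy
    · simp
  rcases lt_or_gt_of_ne hxy with h1 | h1
  · exact key x y h1 h
  · exact key y x h1 h.symm

namespace Ctx

variable {𝕄 : Type w} (K : Ctx 𝕄) {α β γ δ ξ : Type} {J : Type}

/-! ### Trees -/

def Tree (c : γ → 𝕄) (b : β → 𝕄) : ℕ → (List ℕ → γ ⊕ β → 𝕄) → Prop
  | 0, T => ∀ ν, K.E ((T [] ∘ Sum.inl) ⋈ (T ν ∘ Sum.inr)) (c ⋈ b)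
  | n + 1, T => (∀ ν, K.E ((T [] ∘ Sum.inl) ⋈ (T ν ∘ Sum.inr)) (c ⋈ b)) ∧
      ∀ j, Tree c b n (fun ν => T (j :: ν)) ∧
        K.FS (below (fun i => flat (fun ν => T (i :: ν))) j) (flat (fun ν => T (j :: ν)))

variable {K}

lemma Tree.root {c : γ → 𝕄} {b : β → 𝕄} {n : ℕ} {T : List ℕ → γ ⊕ β → 𝕄} (h : K.Tree c b n T) :
    ∀ ν, K.E ((T [] ∘ Sum.inl) ⋈ (T ν ∘ Sum.inr)) (c ⋈ b) := by
  cases n with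
  | zero => exact h
  | succ n => exact h.1

lemma FS.of_e {u u' : δ → 𝕄} {v v' : α → 𝕄} (h : K.FS (Set.range u) v)
    (he : K.E (v ⋈ u) (v' ⋈ u')) : K.FS (Set.range u') v' := by
  intro C hC hv
  obtain ⟨S, hS, hCS⟩ := hC.range
  rw [hCS] at hv
  obtain ⟨m, hm, hSm⟩ := h (fun x => S (x ⋈ u)) (hS.sub u fun i => ⟨i, rfl⟩) ((he.iff hS).2 hv)
  refine ⟨m, hm, ?_⟩
  rw [hCS]
  have h1 : K.E u u' := he.of_comp Sum.inr (fun _ => rfl) (fun _ => rfl)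
  refine h1 (fun y => S (m ⋈ y)) (hS.pull _ ?_) hSm
  rintro (i | i)
  · exact Or.inr ⟨_, hm i, fun _ => rfl⟩
  · exact Or.inl ⟨i, fun _ => rfl⟩

lemma Tree.of_e {c : γ → 𝕄} {b : β → 𝕄} {n : ℕ} {T T' : List ℕ → γ ⊕ β → 𝕄}
    (h : K.Tree c b n T) (he : K.E (flat T) (flat T')) : K.Tree c b n T' := by
  induction n generalizing T T' with
  | zero =>
    intro ν
    refine E.trans (E.symm ?_) (h ν)
    refine he.of_comp (Sum.elim (fun k => ([], Sum.inl k)) (fun k => (ν, Sum.inr k))) ?_ ?_ <;>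
      rintro (i | i) <;> rfl
  | succ n ih =>
    refine ⟨fun ν => ?_, fun j => ⟨ih (h.2 j).1 ?_, ?_⟩⟩
    · refine E.trans (E.symm ?_) (h.1 ν)
      refine he.of_comp (Sum.elim (fun k => ([], Sum.inl k)) (fun k => (ν, Sum.inr k))) ?_ ?_ <;>
        rintro (i | i) <;> rfl
    · exact he.of_comp (fun q => (j :: q.1, q.2)) (fun _ => rfl) (fun _ => rfl)
    · have h1 := (h.2 j).2
      rw [below_eq_range] at h1 ⊢
      refine h1.of_e ?_
      refine he.of_comp (Sum.elim (fun q => (j :: q.1, q.2))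
        (fun q => (q.1.1 :: q.2.1, q.2.2))) ?_ ?_ <;> rintro (i | i) <;> rfl

lemma exists_tree [Countable γ] [Countable β] {X : J → Set 𝕄} (hX : K.NS X)
    {c : γ → 𝕄} {b : β → 𝕄} (hb : Good X b) (h : K.Wk c b) (n : ℕ) :
    ∃ T : List ℕ → γ ⊕ β → 𝕄, K.Tree c b n T ∧ (∀ ν, K.E (T ν ∘ Sum.inl) c) ∧
      K.Wk (T [] ∘ Sum.inl) (fun q : List ℕ × β => T q.1 (Sum.inr q.2)) := by
  induction n with
  | zero =>
    refine ⟨fun _ => c ⋈ b, fun ν => ?_, fun ν => ?_, ?_⟩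
    · simpa using E.refl _
    · simpa using E.refl _
    · exact h.of_comp id (fun q => q.2) (fun _ => rfl) (fun _ => rfl)
  | succ n ih =>
    obtain ⟨T, hT, hTc, hW⟩ := ih
    obtain ⟨R, hR, hRT⟩ := (fs_empty (K := K) (flat T)).coh
    obtain ⟨t, ht⟩ := exists_mor' (K := K) R
    let g : List ℕ × β → List ℕ × (γ ⊕ β) := fun q => (q.1, Sum.inr q.2)
    have hgood : Good X (fun q : List ℕ × β => T q.1 (Sum.inr q.2)) := by
      obtain ⟨f, hf⟩ := hb
      refine ⟨fun q => f q.2, fun q => ?_⟩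
      have h1 : K.E b (T q.1 ∘ Sum.inr) :=
        (hT.root q.1).symm.of_comp Sum.inr (fun _ => rfl) (fun _ => rfl)
      exact hX.inX h1 hf q.2
    have hte : ∀ j, K.E (flat T) (t j) := fun j => (ht.e hRT j).symm
    obtain ⟨a, ha, haW⟩ := hW.chain hX hgood (hR.map g) (hRT.map g) (ht.map g)
    let T' : List ℕ → γ ⊕ β → 𝕄 := fun ν => match ν with
      | [] => a ⋈ fun k => t 0 ([], Sum.inr k)
      | j :: ν => fun k => t j (ν, k)
    have hflat : ∀ j, flat (fun ν => T' (j :: ν)) = t j := fun j => rfl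
    have hac : K.E (a ⋈ fun k => t 0 ([], Sum.inr k)) (c ⋈ b) := by
      refine E.trans (E.symm ?_) (hT.root [])
      refine (ha 0).of_comp (Sum.elim Sum.inl (fun k => Sum.inr ([], k))) ?_ ?_ <;>
        rintro (i | i) <;> rfl
    refine ⟨T', ⟨fun ν => ?_, fun j => ⟨hT.of_e (hte j), ?_⟩⟩, fun ν => ?_, ?_⟩
    · cases ν with
      | nil => exact hac
      | cons j ν =>
        refine E.trans (E.symm ?_) (hT.root ν)
        refine (ha j).of_comp (Sum.elim Sum.inl (fun k => Sum.inr (ν, k))) ?_ ?_ <;>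
          rintro (i | i) <;> rfl
    · simp only [hflat]
      exact hR.fs (ht j)
    · cases ν with
      | nil => exact hac.of_comp Sum.inl (fun _ => rfl) (fun _ => rfl)
      | cons j ν =>
        refine E.trans (E.symm ?_) (hTc ν)
        exact (hte j).of_comp (fun k => (ν, Sum.inl k)) (fun _ => rfl) (fun _ => rfl)
    · refine haW.of_comp id (fun q => match q with
        | ([], k) => (0, ([], k))
        | (j :: ν, k) => (j, (ν, k))) (fun _ => rfl) ?_
      rintro ⟨_ | ⟨j, ν⟩, k⟩ <;> rfl

/-- Nodes below the spine. -/
lemma Tree.spine_e {c : γ → 𝕄} {b : β → 𝕄} {n : ℕ} {T : List ℕ → γ ⊕ β → 𝕄}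
    (h : K.Tree c b n T) (f : ℕ → Fin 3 → ℕ) {i j : ℕ} (hi : i < n) (hj : i < j) (e : Fin 3) :
    K.E ((T (adr f i 0) ∘ Sum.inl) ⋈ (T (adr f j e) ∘ Sum.inr)) (c ⋈ b) := by
  induction i generalizing T f n j with
  | zero =>
    obtain ⟨n, rfl⟩ := Nat.exists_eq_succ_of_ne_zero (by omega : n ≠ 0)
    obtain ⟨j, rfl⟩ := Nat.exists_eq_succ_of_ne_zero (by omega : j ≠ 0)
    rw [adr_zero, Nat.succ_eq_add_one, adr_succ]
    exact (h.2 (f 0 0)).1.root _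
  | succ i ih =>
    obtain ⟨n, rfl⟩ := Nat.exists_eq_succ_of_ne_zero (by omega : n ≠ 0)
    obtain ⟨j, rfl⟩ := Nat.exists_eq_succ_of_ne_zero (by omega : j ≠ 0)
    rw [adr_succ, Nat.succ_eq_add_one, adr_succ]
    exact ih (h.2 (f 0 0)).1 _ (by omega) (by omega)

lemma Tree.b_e {c : γ → 𝕄} {b : β → 𝕄} {n : ℕ} {T : List ℕ → γ ⊕ β → 𝕄}
    (h : K.Tree c b n T) (ν : List ℕ) : K.E (T ν ∘ Sum.inr) b :=
  (h.root ν).of_comp Sum.inr (fun _ => rfl) (fun _ => rfl)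

/-- Labels of the spine array coming before `(i, e)` in the Morley order. -/
def spineBase (T : List ℕ → δ → 𝕄) (f : ℕ → Fin 3 → ℕ) (i : ℕ) (e : Fin 3) : Set 𝕄 :=
  {y | ∃ j e' k, (i < j ∨ (i = j ∧ e' < e)) ∧ T (adr f j e') k = y}

lemma Tree.spine_fs {c : γ → 𝕄} {b : β → 𝕄} {n : ℕ} {T : List ℕ → γ ⊕ β → 𝕄}
    (h : K.Tree c b n T) {f : ℕ → Fin 3 → ℕ} (hf : IsSA f) {i : ℕ} (hi : i < n) {e : Fin 3}
    (he : 0 < e) : K.FS (spineBase T f i e) (T (adr f i e)) := by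
  induction i generalizing T f n with
  | zero =>
    obtain ⟨n, rfl⟩ := Nat.exists_eq_succ_of_ne_zero (by omega : n ≠ 0)
    refine (h.2 (f 0 e)).2.of_comp ?_ (fun k => ([], k)) (fun _ => rfl)
    rintro y ⟨j, e', k, hj | ⟨rfl, hj⟩, rfl⟩
    · obtain ⟨j, rfl⟩ := Nat.exists_eq_succ_of_ne_zero (by omega : j ≠ 0)
      rw [Nat.succ_eq_add_one, adr_succ]
      exact ⟨f 0 0, hf 0 he, (_, k), rfl⟩
    · exact ⟨f 0 e', hf 0 hj, ([], k), rfl⟩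
  | succ i ih =>
    obtain ⟨n, rfl⟩ := Nat.exists_eq_succ_of_ne_zero (by omega : n ≠ 0)
    rw [adr_succ]
    refine (ih (h.2 (f 0 0)).1 (f := fun i => f (i + 1)) (fun k => hf _) (by omega)).mono ?_
    rintro y ⟨j, e', k, hj, rfl⟩
    obtain ⟨j, rfl⟩ := Nat.exists_eq_succ_of_ne_zero (by omega : j ≠ 0)
    rw [Nat.succ_eq_add_one, adr_succ]
    exact ⟨j, e', k, by omega, rfl⟩

/-! ### Extraction -/

lemma extract [Countable δ] (T : ℕ → List ℕ → δ → 𝕄) : ∃ arr : ℕ → Fin 3 → δ → 𝕄,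
    (∀ C : (ℕ × Fin 3 × δ → 𝕄) → Prop, K.D C →
      (∃ n0, ∀ n ≥ n0, ∀ f, IsSA f → C (fun q => T n (adr f q.1 q.2.1) q.2.2)) →
      C (fun q => arr q.1 q.2.1 q.2.2)) ∧
    ∀ j, K.EA {y | ∃ i e k, (i < j ∨ (i = j ∧ e = 2)) ∧ arr i e k = y} (arr j 0) (arr j 1) := by
  classical
  -- the shape of the equality conditions
  let G : (j : ℕ) → Fin 3 → (ℕ × Fin 3 × δ → 𝕄) → (δ ⊕ (ℕ × Fin 3 × δ) → 𝕄) := fun j e z =>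
    (fun k => z (j, e, k)) ⋈ fun q => if q.1 < j ∨ (q.1 = j ∧ q.2.1 = 2) then z q else z (j, 2, q.2.2)
  have hG : ∀ (S : (δ ⊕ (ℕ × Fin 3 × δ) → 𝕄) → Prop), K.D S → ∀ j e, K.D fun z => S (G j e z) := by
    intro S hS j e
    refine hS.pull _ ?_
    rintro (k | q)
    · exact Or.inl ⟨_, fun _ => rfl⟩
    · by_cases hq : q.1 < j ∨ (q.1 = j ∧ q.2.1 = 2)
      · exact Or.inl ⟨q, fun z => by simp [G, hq]⟩
      · exact Or.inl ⟨(j, 2, q.2.2), fun z => by simp [G, hq]⟩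
  let I1 := {C : (ℕ × Fin 3 × δ → 𝕄) → Prop // K.D C ∧ ∃ n0, ∀ n ≥ n0, ∀ f, IsSA f →
    C (fun q => T n (adr f q.1 q.2.1) q.2.2)}
  let I2 := {S : (δ ⊕ (ℕ × Fin 3 × δ) → 𝕄) → Prop // K.D S} × ℕ
  obtain ⟨z, hz⟩ := sat (K := K) (A := ∅) Set.countable_empty (ι := I1 ⊕ I2)
    (Sum.elim (fun C => C.1) (fun S z => S.1.1 (G S.2 0 z) ↔ S.1.1 (G S.2 1 z))) (by
      rintro (C | S)
      · exact C.2.1.da _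
      · have h0 := (hG S.1.1 S.1.2 S.2 0).da ∅
        have h1 := (hG S.1.1 S.1.2 S.2 1).da ∅
        exact ((h0.imp h1).and (h1.imp h0)).congr fun x => iff_iff_implies_and_implies) (by
      intro s
      have : ∃ n, ∀ C : I1, Sum.inl C ∈ s → ∀ f, IsSA f →
          C.1 (fun q => T n (adr f q.1 q.2.1) q.2.2) := by
        choose n0 hn0 using fun C : I1 => C.2.2
        refine ⟨s.sup (Sum.elim n0 fun _ => 0), fun C hC f hf => hn0 C _ ?_ f hf⟩
        exact Finset.le_sup (f := Sum.elim n0 fun _ => 0) hC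
      obtain ⟨n, hn⟩ := this
      let val : (ℕ → Fin 3 → ℕ) → ℕ × Fin 3 × δ → 𝕄 := fun f q => T n (adr f q.1 q.2.1) q.2.2
      have : ∃ f : ℕ → Fin 3 → ℕ, ∀ j, StrictMono (f j) ∧
          ∀ S : I2, Sum.inr S ∈ s → S.2 = j →
          (S.1.1 (G j 0 (val (Function.update f j (f j)))) ↔
            S.1.1 (G j 1 (val (Function.update f j (f j))))) := by
        apply exists_seq (fun j f (x : Fin 3 → ℕ) => StrictMono x ∧
          ∀ S : I2, Sum.inr S ∈ s → S.2 = j →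
          (S.1.1 (G j 0 (val (Function.update f j x))) ↔
            S.1.1 (G j 1 (val (Function.update f j x)))))
        · rintro j f g hfg x ⟨hx, h⟩
          refine ⟨hx, fun S hS hj => ?_⟩
          have : ∀ e, G j e (val (Function.update f j x)) = G j e (val (Function.update g j x)) := by
            intro e
            have hc : ∀ i ≤ j, ∀ e k, val (Function.update f j x) (i, e, k) =
                val (Function.update g j x) (i, e, k) := by
              intro i hi e k
              simp only [val]
              rw [adr_congr]
              intro i' hi'
              by_cases h : i' = j
              · subst h; simp
              · rw [Function.update_of_ne h, Function.update_of_ne h]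
                exact hfg i' (by omega)
            funext q
            rcases q with k | ⟨i, e, k⟩
            · exact hc j le_rfl _ _
            · simp only [G, Sum.elim_inr]
              split_ifs with h
              · exact hc i (by omega) _ _
              · exact hc j le_rfl _ _
          rw [← this, ← this]
          exact h S hS hj
        · intro j f
          let v : ℕ → ℕ → (s → Prop) := fun i i'' S => match S.1 with
            | Sum.inl _ => True
            | Sum.inr S => S.1.1 (G j 0 (val (Function.update f j ![i, 0, i''])))
          obtain ⟨x, hx, hv⟩ := three_color v
          refine ⟨x, hx, fun S hS hj => ?_⟩
          have h1 := congrFun hv ⟨Sum.inr S, hS⟩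
          simp only [v] at h1
          have hadr : ∀ i < j, ∀ (y y' : Fin 3 → ℕ) e,
              adr (Function.update f j y) i e = adr (Function.update f j y') i e := by
            intro i hi y y' e
            apply adr_congr
            intro i' hi'
            rw [Function.update_of_ne (by omega), Function.update_of_ne (by omega)]
          have hadj : ∀ (y y' : Fin 3 → ℕ) e e', y e = y' e' →
              adr (Function.update f j y) j e = adr (Function.update f j y') j e' := by
            intro y y' e e' hy
            simp only [adr, Function.update_self, hy]
            congr 1
            apply List.map_congr_left
            intro i hi
            have := List.mem_range.1 hi
            rw [Function.update_of_ne (by omega), Function.update_of_ne (by omega)]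
          have h2 : ∀ e (y : Fin 3 → ℕ), y 0 = x e → y 2 = x 2 →
              G j 0 (val (Function.update f j y)) = G j e (val (Function.update f j x)) := by
            intro e y h0 h2
            funext q
            rcases q with k | ⟨i, e', k⟩
            · simp only [G, Sum.elim_inl, val]
              rw [hadj _ _ _ _ h0]
            · simp only [G, Sum.elim_inr]
              split_ifs with h
              · rcases h with h | ⟨rfl, rfl⟩
                · simp only [val]; rw [hadr i h]
                · simp only [val]; rw [hadj _ _ _ _ h2]
              · simp only [val]; rw [hadj _ _ _ _ h2]
          rw [h2 0 ![x 0, 0, x 2] rfl rfl, h2 1 ![x 1, 0, x 2] rfl rfl] at h1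
          exact iff_of_eq h1
      obtain ⟨f, hf⟩ := this
      simp only [Function.update_eq_self] at hf
      refine ⟨val f, ?_⟩
      rintro (C | S) hC
      · exact hn C hC f fun k => (hf k).1
      · exact (hf S.2).2 S hC rfl)
  refine ⟨fun i e k => z (i, e, k), fun C hC h => hz (Sum.inl ⟨C, hC, h⟩), fun j => ?_⟩
  have hr : K.EA (Set.range fun q : ℕ × Fin 3 × δ =>
      if q.1 < j ∨ (q.1 = j ∧ q.2.1 = 2) then z q else z (j, 2, q.2.2))
      (fun k => z (j, 0, k)) (fun k => z (j, 1, k)) := by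
    rw [ea_range]
    intro S hS h
    exact (hz (Sum.inr (⟨S, hS⟩, j))).1 h
  refine hr.mono ?_
  rintro y ⟨i, e, k, h, rfl⟩
  exact ⟨(i, e, k), by simp only [h, if_true]⟩

end Ctx
end NSOP3Paper

namespace NSOP3Paper
open Filter
namespace Ctx

variable {𝕄 : Type w} {K : Ctx 𝕄} {α β γ δ ξ : Type} {J J' : Type}

/-- Symmetry. -/
lemma Wk.symm [Countable α] [Countable β] {X : J → Set 𝕄} (hX : K.NS X) {Y : J' → Set 𝕄}
    (hY : K.NS Y) {a : α → 𝕄} {b : β → 𝕄} (ha : Good X a) (hb : Good Y b) (h : K.Wk a b) :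
    K.Wk b a := by
  classical
  intro S hS hba
  by_contra hn
  simp only [WkS, not_forall, not_exists, not_and] at hn
  obtain ⟨N, hN⟩ := hn
  obtain ⟨f, hf⟩ := ha
  choose T hT hTc hTW using exists_tree hY hb h
  obtain ⟨arr, harr, hEA⟩ := extract (K := K) T
  obtain ⟨n, hn⟩ := hX.array f hS N
  have hE : ∀ i e, K.E a (fun k => arr i e (Sum.inl k)) := by
    intro i e C hC hCa
    refine harr (fun z => C (fun k => z (i, e, Sum.inl k)))
      (hC.pull _ fun _ => Or.inl ⟨_, fun _ => rfl⟩) ⟨0, fun n _ f _ => ?_⟩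
    exact (hTc n (adr f i e)).symm C hC hCa
  refine hn (fun i t k => arr i (if t then 1 else 0) (Sum.inl k)) ?_ ?_ ?_ ?_
  · intro i t
    exact hX.inX (hE _ _) hf
  · intro i hi
    have := (hEA i).of_comp (u' := fun k => arr i 0 (Sum.inl k))
      (v' := fun k => arr i 1 (Sum.inl k)) Sum.inl (fun _ => rfl) (fun _ => rfl)
    refine (this.mono ?_)
    rintro y (hy | ⟨j, hj, t, k, rfl⟩)
    · exact hy.elim
    · exact ⟨j, _, _, Or.inl hj, rfl⟩
  · refine harr (fun z => ∃ x, ∀ i < n, S (x ⋈ fun k => z (i, 0, Sum.inl k))) ?_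
      ⟨n, fun n' hn' f _ => ⟨T n' (adr f n 0) ∘ Sum.inr, fun i hi => ?_⟩⟩
    · refine DA.d (DA.ex_of (DA.lt _ fun i _ => ?_))
      exact (hS.da _).pull _ (by rintro (i | i) <;> exact Or.inl ⟨_, fun _ => rfl⟩)
    · have h1 := (hT n').spine_e f (i := i) (j := n) (by omega) hi 0
      have h2 := h1.of_comp (u' := (T n' (adr f n 0) ∘ Sum.inr) ⋈ (T n' (adr f i 0) ∘ Sum.inl))
        (v' := b ⋈ a) Sum.swap (by rintro (i | i) <;> rfl) (by rintro (i | i) <;> rfl)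
      exact h2.symm S hS hba
  · intro s hs hcard
    refine harr (fun z => ¬ ∃ x, ∀ i ∈ s, S (x ⋈ fun k => z (i, 1, Sum.inl k))) ?_
      ⟨n, fun n' hn' f hf => ?_⟩
    · refine K.d_not (DA.d (DA.ex_of (DA.ball _ fun i _ => ?_)))
      exact (hS.da _).pull _ (by rintro (i | i) <;> exact Or.inl ⟨_, fun _ => rfl⟩)
    · rintro ⟨x, hx⟩
      let g := s.orderEmbOfFin hcard
      let ix : ℕ → ℕ := fun i => if h : i < N then g ⟨N - 1 - i, by omega⟩ else 0
      have hix : ∀ i < N, ix i ∈ s := by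
        intro i hi
        simp only [ix, hi, dif_pos]; exact s.orderEmbOfFin_mem hcard _
      have hlt : ∀ i j, i < j → j < N → ix j < ix i := by
        intro i j hij hj
        have hi : i < N := by omega
        simp only [ix, hi, hj, dif_pos]
        apply g.strictMono
        simp only [Fin.mk_lt_mk]; omega
      have key := hN (fun i k => T n' (adr f (ix i) 1) (Sum.inl k))
      refine absurd (key (fun i hi => ⟨hTc n' (adr f (ix i) 1), ?_⟩) x) ?_
      swap
      · rintro ⟨i, hi, hni⟩
        exact hni (hx _ (hix i hi))
      refine (((hT n').spine_fs hf (i := ix i) (e := 1) ?_ (by decide)).map Sum.inl).gen.mono ?_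
      · have := hs _ (hix i hi); omega
      · rintro y ⟨j, hj, k, rfl⟩
        exact ⟨ix j, 1, _, Or.inl (hlt j i hj hi), rfl⟩

/-- Left extension of coheirs. -/
lemma Coh.extend {V : Ultrafilter (β → 𝕄)} (hV : K.Coh V) {b : β → 𝕄} (c : γ → 𝕄)
    (hb : K.Realizes V ∅ b) : ∃ W : Ultrafilter (β ⊕ γ → 𝕄), K.Coh W ∧
      W.map (· ∘ Sum.inl) = V ∧ K.Realizes W ∅ (b ⋈ c) := by
  classical
  obtain ⟨W, hW⟩ := Ultrafilter.exists_ultrafilter_of_finite_inter_nonempty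
    ({s : Set (β ⊕ γ → 𝕄) | ∃ C, ∃ v ∈ V, K.D C ∧ C (b ⋈ c) ∧
      s = {x | (∀ i, x i ∈ K.M) ∧ C x ∧ x ∘ Sum.inl ∈ v}}) (by
      intro T hT
      have hT' : ∀ s : T, ∃ C, ∃ v ∈ V, K.D C ∧ C (b ⋈ c) ∧
        s.1 = {x | (∀ i, x i ∈ K.M) ∧ C x ∧ x ∘ Sum.inl ∈ v} := fun s => hT s.2
      choose C v hv hC hCd hs using hT'
      have h1 : K.D fun x => ∀ s ∈ Finset.univ, C s x :=
        DA.d (DA.ball _ fun s _ => (hC s).da _)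
      have h2 : ∀ᶠ x in (V : Filter (β → 𝕄)), ∃ y, ∀ s ∈ Finset.univ, C s (x ⋈ y) :=
        (hb.iff ((D.ex h1).da _)).2 ⟨c, fun s _ => hCd s⟩
      have h3 : ∀ᶠ x in (V : Filter (β → 𝕄)), ∀ s ∈ Finset.univ, x ∈ v s := by
        rw [Filter.eventually_all_finset]
        exact fun s _ => hv s
      obtain ⟨x, hx, ⟨y, hy⟩, hxv⟩ := (hV.and (h2.and h3)).exists
      obtain ⟨m, hm, hmy⟩ := K.d_tv (C := fun y => ∀ s ∈ Finset.univ, C s (x ⋈ y)) (h1.pull _ (by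
        rintro (i | i)
        · exact Or.inr ⟨_, hx i, fun _ => rfl⟩
        · exact Or.inl ⟨_, fun _ => rfl⟩)) y hy
      refine ⟨x ⋈ m, ?_⟩
      simp only [Set.mem_sInter]
      intro t ht
      have hst := hs ⟨t, ht⟩
      change t = _ at hst
      rw [hst]
      refine ⟨?_, hmy _ (Finset.mem_univ _), ?_⟩
      · rintro (i | i)
        · exact hx i
        · exact hm i
      · simpa using hxv ⟨t, ht⟩ (Finset.mem_univ _))
  refine ⟨W, ?_, ?_, ?_⟩
  · have := hW ⟨fun _ => True, Set.univ, Filter.univ_mem, K.d_true, trivial, rfl⟩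
    filter_upwards [this] with x hx using hx.1
  · apply Ultrafilter.eq_of_le
    intro v hv
    have := hW ⟨fun _ => True, v, hv, K.d_true, trivial, rfl⟩
    change ∀ᶠ x in (W : Filter (β ⊕ γ → 𝕄)), x ∘ Sum.inl ∈ v
    filter_upwards [this] with x hx using hx.2.2
  · intro C hC h
    by_contra hn
    have := hW ⟨_, Set.univ, Filter.univ_mem, K.d_not hC.d, hn, rfl⟩
    have h2 : ∀ᶠ x in (W : Filter (β ⊕ γ → 𝕄)), ¬ C x := by
      filter_upwards [this] with x hx using hx.2.1
    obtain ⟨x, h3, h4⟩ := (h.and h2).exists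
    exact h4 h3

lemma E.swap {u u' : α → 𝕄} {v v' : β → 𝕄} (h : K.E (u ⋈ v) (u' ⋈ v')) : K.E (v ⋈ u) (v' ⋈ u') :=
  h.of_comp Sum.swap (by rintro (i | i) <;> rfl) (by rintro (i | i) <;> rfl)

lemma E.left {u u' : α → 𝕄} {v v' : β → 𝕄} (h : K.E (u ⋈ v) (u' ⋈ v')) : K.E u u' :=
  h.of_comp Sum.inl (fun _ => rfl) (fun _ => rfl)

lemma E.right {u u' : α → 𝕄} {v v' : β → 𝕄} (h : K.E (u ⋈ v) (u' ⋈ v')) : K.E v v' :=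
  h.of_comp Sum.inr (fun _ => rfl) (fun _ => rfl)

lemma Good.pair {Y : J → Set 𝕄} {b : β → 𝕄} {c : γ → 𝕄} (hb : Good Y b) (hc : Good Y c) :
    Good Y (b ⋈ c) := by
  obtain ⟨f, hf⟩ := hb
  obtain ⟨g, hg⟩ := hc
  refine ⟨f ⋈ g, ?_⟩
  rintro (i | i)
  · exact hf i
  · exact hg i

lemma Good.of_e {Y : J → Set 𝕄} (hY : K.NS Y) {b b' : β → 𝕄} (hb : Good Y b) (h : K.E b b') :
    Good Y b' := by
  obtain ⟨f, hf⟩ := hb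
  exact ⟨f, hY.inX h hf⟩

/-- Weak independence theorem. -/
lemma Wk.wit [Countable α] [Countable β] [Countable γ] {X : J → Set 𝕄} (hX : K.NS X)
    {Y : J' → Set 𝕄} (hY : K.NS Y) {a a' : α → 𝕄} {b : β → 𝕄} {c : γ → 𝕄} (ha : Good X a)
    (hb : Good Y b) (hc : Good Y c) (haa : K.E a a') (hab : K.Wk a b) (hac : K.Wk a' c)
    (hbc : K.FS (Set.range c) b) :
    ∃ x : α → 𝕄, K.E (x ⋈ b) (a ⋈ b) ∧ K.E (x ⋈ c) (a' ⋈ c) ∧ K.Wk x (b ⋈ c) := by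
  obtain ⟨c1, hc1⟩ := haa.symm.homog c
  have hc1g : Good Y c1 := hc.of_e hY hc1.right
  have hba := hab.symm hX hY ha hb
  have hca := (hac.of_e hc1).symm hX hY ha hc1g
  obtain ⟨U, hU, hUa⟩ := (fs_empty (K := K) a).coh
  obtain ⟨d, hd⟩ := exists_mor' (K := K) U
  obtain ⟨b2, hb2⟩ := hba.along hX ha hU.inv hUa hd
  obtain ⟨c2, hc2⟩ := hca.along hX ha hU.inv hUa hd
  obtain ⟨y, hy, hyC⟩ := limit_principle (K := K) (fun i => hd.e hUa i)
    (fun i => (hU.fs (hd i)).gen) (b2 ⋈ c2)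
  obtain ⟨b3, c3, rfl⟩ : ∃ (b3 : β → 𝕄) (c3 : γ → 𝕄), y = b3 ⋈ c3 :=
    ⟨y ∘ Sum.inl, y ∘ Sum.inr, (Sum.elim_comp_inl_inr y).symm⟩
  have hb3 : K.E (b ⋈ a) (b3 ⋈ a) := by
    intro S hS h
    have := hyC (fun z => S ((fun k => z (Sum.inl (Sum.inl k))) ⋈ fun k => z (Sum.inr k)))
      (hS.pull _ (by rintro (i | i) <;> exact Or.inl ⟨_, fun _ => rfl⟩)) (fun i => hb2 i S hS h)
    exact this
  have hc3 : K.E (c1 ⋈ a) (c3 ⋈ a) := by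
    intro S hS h
    have := hyC (fun z => S ((fun k => z (Sum.inl (Sum.inr k))) ⋈ fun k => z (Sum.inr k)))
      (hS.pull _ (by rintro (i | i) <;> exact Or.inl ⟨_, fun _ => rfl⟩)) (fun i => hc2 i S hS h)
    exact this
  have hg3 : Good Y (b3 ⋈ c3) := (hb.of_e hY hb3.left).pair (hc1g.of_e hY hc3.left)
  have hW3 : K.Wk a (b3 ⋈ c3) := hy.symm hY hX hg3 ha
  obtain ⟨V, hV, hVb⟩ := hbc.coh
  obtain ⟨W, hW, hWV, hWr⟩ := hV.extend c3
    ((hVb.mono (Set.empty_subset _)).of_ea hb3.left.ea)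
  obtain ⟨e, he⟩ := exists_mor' (K := K) W
  obtain ⟨x, hx, hxW⟩ := hW3.chain hY hg3 hW hWr he
  have he0 : K.E (e 0) (b3 ⋈ c3) := he.e hWr 0
  have hc0 : K.E (e 0 ∘ Sum.inr) c :=
    (he0.of_comp Sum.inr (fun _ => rfl) (fun _ => rfl)).trans (hc3.left.symm.trans hc1.right.symm)
  have h1 : K.Realizes V (Set.range (e 0 ∘ Sum.inr)) (e 1 ∘ Sum.inl) := by
    rw [← hWV]
    refine ((he 1).map Sum.inl).mono ?_
    rintro _ ⟨k, rfl⟩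
    exact ⟨0, by omega, _, rfl⟩
  have h2 : K.E ((e 1 ∘ Sum.inl) ⋈ (e 0 ∘ Sum.inr)) (b ⋈ c) := hV.inv.pair hc0 h1 hVb
  obtain ⟨x', hx'⟩ := h2.homog x
  have h3 := hx'.swap
  refine ⟨x', ?_, ?_, ?_⟩
  · have e1 : K.E (x ⋈ (e 1 ∘ Sum.inl)) (x' ⋈ b) := h3.of_comp (Sum.map id Sum.inl)
      (by rintro (i | i) <;> rfl) (by rintro (i | i) <;> rfl)
    have e2 : K.E (a ⋈ b3) (x ⋈ (e 1 ∘ Sum.inl)) := (hx 1).of_comp (Sum.map id Sum.inl)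
      (by rintro (i | i) <;> rfl) (by rintro (i | i) <;> rfl)
    exact (e1.symm.trans e2.symm).trans hb3.symm.swap
  · have e1 : K.E (x ⋈ (e 0 ∘ Sum.inr)) (x' ⋈ c) := h3.of_comp (Sum.map id Sum.inr)
      (by rintro (i | i) <;> rfl) (by rintro (i | i) <;> rfl)
    have e2 : K.E (a ⋈ c3) (x ⋈ (e 0 ∘ Sum.inr)) := (hx 0).of_comp (Sum.map id Sum.inr)
      (by rintro (i | i) <;> rfl) (by rintro (i | i) <;> rfl)
    exact ((e1.symm.trans e2.symm).trans hc3.symm.swap).trans hc1.symm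
  · refine Wk.of_e ?_ h3
    exact hxW.of_comp id (Sum.elim (fun k => (1, Sum.inl k)) fun k => (0, Sum.inr k))
      (fun _ => rfl) (by rintro (i | i) <;> rfl)

lemma wk_empty [IsEmpty β] (a : α → 𝕄) (b : β → 𝕄) : K.Wk a b := by
  intro S hS hab n
  refine ⟨fun _ => b, fun i _ => ⟨E.refl _, (fs_empty (K := K) b).gen.mono ?_⟩, a, fun i _ => hab⟩
  rintro y ⟨_, _, k, _⟩
  exact isEmptyElim k

/-- Iterated weak independence theorem inside a big tuple `T`. -/
lemma wit_seq {Lab : Type} [Countable Lab] [Countable α] {X : J → Set 𝕄} (hX : K.NS X)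
    {Y : J' → Set 𝕄} (hY : K.NS Y) {a : α → 𝕄} (ha : Good X a) {T : Lab → 𝕄} (hT : Good Y T)
    (I : ℕ → Set Lab) (u : ℕ → α → 𝕄) (r : ℕ) (hu : ∀ t < r, K.E a (u t))
    (hW : ∀ t < r, K.Wk (u t) (fun i : I t => T i))
    (hF : ∀ t < r, K.FS {y | ∃ j < t, ∃ i ∈ I j, T i = y} (fun i : I t => T i)) :
    ∃ x : α → 𝕄, K.E a x ∧ K.Wk x (fun i : {i | ∃ t < r, i ∈ I t} => T i) ∧
      ∀ t < r, K.E (x ⋈ fun i : I t => T i) (u t ⋈ fun i : I t => T i) := by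
  have hg : ∀ s : Set Lab, Good Y (fun i : s => T i) := by
    obtain ⟨f, hf⟩ := hT
    exact fun s => ⟨fun i => f i, fun i => hf i⟩
  induction r with
  | zero =>
    have : IsEmpty {i : Lab | ∃ t < 0, i ∈ I t} := ⟨fun i => by
      obtain ⟨t, ht, _⟩ := i.2; omega⟩
    exact ⟨a, E.refl _, wk_empty _ _, fun t ht => by omega⟩
  | succ r ih =>
    obtain ⟨x, hax, hxW, hx⟩ := ih (fun t ht => hu t (by omega)) (fun t ht => hW t (by omega))
      (fun t ht => hF t (by omega))
    have hur := hu r (by omega)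
    obtain ⟨x', h1, h2, h3⟩ := Wk.wit hX hY (ha.of_e hX hur) (hg _) (hg _) (hur.symm.trans hax)
      (hW r (by omega)) hxW ((hF r (by omega)).mono (by
        rintro _ ⟨⟨i, t, ht, hi⟩, rfl⟩
        exact ⟨t, ht, i, hi, rfl⟩))
    refine ⟨x', hur.trans h1.left.symm, ?_, fun t ht => ?_⟩
    · classical
      have hdec : ∀ i : {i | ∃ t < r + 1, i ∈ I t}, i.1 ∉ I r → ∃ t < r, i.1 ∈ I t := by
        rintro ⟨i, t, ht, hi⟩ hn
        refine ⟨t, ?_, hi⟩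
        rcases Nat.lt_succ_iff_lt_or_eq.1 ht with h | rfl
        · exact h
        · exact (hn hi).elim
      refine h3.of_comp id (fun i => if h : i.1 ∈ I r then Sum.inl ⟨i.1, h⟩ else
        Sum.inr ⟨i.1, hdec i h⟩) (fun _ => rfl) ?_
      intro i
      by_cases h : i.1 ∈ I r <;> simp [h]
    · rcases Nat.lt_succ_iff_lt_or_eq.1 ht with h | rfl
      · have := h2.of_comp (u' := x' ⋈ fun i : I t => T i) (v' := x ⋈ fun i : I t => T i)
          (Sum.map id fun i => ⟨i.1, t, h, i.2⟩) (by rintro (i | i) <;> rfl)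
          (by rintro (i | i) <;> rfl)
        exact this.trans (hx t h)
      · exact h1

/-- Transport of weak independence to a subtuple. -/
lemma Wk.range [Countable α] [Countable β] {Lab : Type} {T : Lab → 𝕄} {a : α → 𝕄} {b : β → 𝕄}
    (h : K.Wk a b) (u : β → Lab) (hu : K.E b (T ∘ u)) :
    ∃ x : α → 𝕄, K.E a x ∧ K.Wk x (fun i : Set.range u => T i) ∧ K.E (a ⋈ b) (x ⋈ (T ∘ u)) := by
  obtain ⟨x, hx⟩ := hu.homog a
  refine ⟨x, hx.right, ?_, hx.swap⟩
  refine (h.of_e hx.swap).of_comp id (fun i => i.2.choose) (fun _ => rfl) fun i => ?_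
  rw [Function.comp, i.2.choose_spec]

end Ctx
end NSOP3Paper

namespace NSOP3Paper
open Filter

/-- Iterated ultrafilter quantifier. -/
def RQ (P : Finset ℕ → Prop) : ℕ → Finset ℕ → Prop
  | 0, s => P s
  | m + 1, s => ∀ᶠ j in (hyperfilter ℕ : Filter ℕ), RQ P m (insert j s)

lemma rq_not (P : Finset ℕ → Prop) (m : ℕ) : ∀ s, ¬ RQ P m s → RQ (fun t => ¬ P t) m s := by
  induction m with
  | zero => intro s h; exact h
  | succ m ih =>
    intro s h
    have := Ultrafilter.eventually_not.2 h
    exact this.mono fun j hj => ih _ hj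

lemma ramsey_aux (P : Finset ℕ → Prop) (r : ℕ) (h0 : RQ P r ∅) :
    ∃ h : ℕ → ℕ, StrictMono h ∧ ∀ t : Finset ℕ, t.card = r → P (t.image h) := by
  classical
  have step : ∀ (n : ℕ) (h : ℕ → ℕ),
      (∀ t ⊆ Finset.range n, t.card ≤ r → RQ P (r - t.card) (t.image h)) →
      ∃ j, (∀ i < n, h i < j) ∧ ∀ t ⊆ Finset.range n, t.card + 1 ≤ r →
        RQ P (r - (t.card + 1)) (insert j (t.image h)) := by
    intro n h hh
    have h1 : ∀ᶠ j in (hyperfilter ℕ : Filter ℕ), ∀ i ∈ Finset.range n, h i < j := by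
      rw [Filter.eventually_all_finset]
      intro i _
      exact Nat.hyperfilter_le_atTop (eventually_gt_atTop (h i))
    have h2 : ∀ᶠ j in (hyperfilter ℕ : Filter ℕ), ∀ t ∈ (Finset.range n).powerset,
        t.card + 1 ≤ r → RQ P (r - (t.card + 1)) (insert j (t.image h)) := by
      rw [Filter.eventually_all_finset]
      intro t ht
      by_cases hr : t.card + 1 ≤ r
      · have := hh t (Finset.mem_powerset.1 ht) (by omega)
        obtain ⟨q, hq⟩ : ∃ q, r - t.card = q + 1 := ⟨r - t.card - 1, by omega⟩
        rw [hq] at this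
        have hq2 : r - (t.card + 1) = q := by omega
        rw [hq2]
        exact Filter.Eventually.mono this fun j hj _ => hj
      · exact Filter.Eventually.of_forall fun j hj => (hr hj).elim
    obtain ⟨j, hj1, hj2⟩ := (h1.and h2).exists
    exact ⟨j, fun i hi => hj1 i (Finset.mem_range.2 hi),
      fun t ht => hj2 t (Finset.mem_powerset.2 ht)⟩
  -- strong recursion with the invariant
  let Good' : ℕ → (ℕ → ℕ) → Prop := fun n h =>
    (∀ i j, i < j → j < n → h i < h j) ∧
      ∀ t ⊆ Finset.range n, t.card ≤ r → RQ P (r - t.card) (t.image h)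
  have step2 : ∀ n h, Good' n h → ∃ j, Good' (n + 1) (Function.update h n j) := by
    rintro n h ⟨hm, hh⟩
    obtain ⟨j, hj1, hj2⟩ := step n h hh
    have hup : ∀ i < n, Function.update h n j i = h i := fun i hi =>
      Function.update_of_ne (by omega) _ _
    have himg : ∀ t ⊆ Finset.range n, t.image (Function.update h n j) = t.image h := by
      intro t ht
      apply Finset.image_congr
      intro i hi
      exact hup i (Finset.mem_range.1 (ht hi))
    refine ⟨j, ?_, ?_⟩
    · intro a b hab hb
      rcases Nat.lt_succ_iff_lt_or_eq.1 hb with hb | rfl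
      · rw [hup a (by omega), hup b hb]; exact hm a b hab hb
      · rw [hup a hab, Function.update_self]; exact hj1 a hab
    · intro t ht hc
      by_cases hn : n ∈ t
      · have ht' : t.erase n ⊆ Finset.range n := by
          intro i hi
          have := ht (Finset.mem_of_mem_erase hi)
          have := Finset.ne_of_mem_erase hi
          simp at *; omega
        have hcard : (t.erase n).card + 1 = t.card := Finset.card_erase_add_one hn
        have := hj2 _ ht' (by omega)
        rw [hcard] at this
        have e : t.image (Function.update h n j) = insert j ((t.erase n).image h) := by
          conv_lhs => rw [← Finset.insert_erase hn]
          rw [Finset.image_insert, Function.update_self, himg _ ht']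
        rw [e]; exact this
      · have ht' : t ⊆ Finset.range n := by
          intro i hi
          have := ht hi
          have : i ≠ n := fun h => hn (h ▸ hi)
          simp at *; omega
        rw [himg _ ht']; exact hh t ht' hc
  choose! nx hnx using step2
  let H : ℕ → ℕ → ℕ := fun n => Nat.rec (fun _ => 0) (fun n h => Function.update h n (nx n h)) n
  have hH : ∀ n, Good' n (H n) := by
    intro n
    induction n with
    | zero =>
      refine ⟨fun _ _ _ h => by omega, fun t ht hc => ?_⟩
      have : t = ∅ := by simpa using ht
      subst this
      simpa using h0
    | succ n ih => exact hnx n _ ih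
  have hst : ∀ n i, i < n → H n i = H (i + 1) i := by
    intro n i hi
    induction n with
    | zero => omega
    | succ n ih =>
      rcases Nat.lt_succ_iff_lt_or_eq.1 hi with h | rfl
      · rw [← ih h]
        exact Function.update_of_ne (by omega) _ _
      · rfl
  refine ⟨fun i => H (i + 1) i, ?_, ?_⟩
  · intro i j hij
    have := (hH (j + 1)).1 i j hij (by omega)
    rw [hst (j + 1) i (by omega)] at this
    exact this
  · intro t ht
    obtain ⟨n, hn⟩ : ∃ n, t ⊆ Finset.range n := Finset.exists_nat_subset_range t
    have := (hH n).2 t hn (by omega)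
    rw [ht, Nat.sub_self] at this
    have e : t.image (fun i => H (i + 1) i) = t.image (H n) := by
      apply Finset.image_congr
      intro i hi
      exact (hst n i (Finset.mem_range.1 (hn hi))).symm
    rw [e]; exact this

lemma ramsey (P : Finset ℕ → Prop) (r : ℕ) :
    ∃ h : ℕ → ℕ, StrictMono h ∧ ((∀ t : Finset ℕ, t.card = r → P (t.image h)) ∨
      ∀ t : Finset ℕ, t.card = r → ¬ P (t.image h)) := by
  by_cases h0 : RQ P r ∅
  · obtain ⟨h, h1, h2⟩ := ramsey_aux P r h0
    exact ⟨h, h1, Or.inl h2⟩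
  · obtain ⟨h, h1, h2⟩ := ramsey_aux _ r (rq_not P r ∅ h0)
    exact ⟨h, h1, Or.inr h2⟩

end NSOP3Paper

namespace NSOP3Paper
open Filter
namespace Ctx

variable {𝕄 : Type w} {K : Ctx 𝕄} {α β γ δ ξ : Type} {J J' : Type}

/-- No definable relation without 3-cycles has an infinite chain. -/
def N3 (K : Ctx 𝕄) : Prop := ∀ (ζ : Type) [Finite ζ] (R : (ζ ⊕ ζ → 𝕄) → Prop), K.D R →
  ∀ z : ℕ → ζ → 𝕄, (∀ i j, i < j → R (z i ⋈ z j)) →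
    ∃ x1 x2 x3 : ζ → 𝕄, R (x1 ⋈ x2) ∧ R (x2 ⋈ x3) ∧ R (x3 ⋈ x1)

lemma N3.fin (hN : K.N3) [Finite ξ] {R : (ξ ⊕ ξ → 𝕄) → Prop} (hR : K.D R)
    (h : ∀ r : ℕ, ∃ z : ℕ → ξ → 𝕄, ∀ i j, i < j → j < r → R (z i ⋈ z j)) :
    ∃ x1 x2 x3 : ξ → 𝕄, R (x1 ⋈ x2) ∧ R (x2 ⋈ x3) ∧ R (x3 ⋈ x1) := by
  obtain ⟨z, hz⟩ := sat (K := K) (α := ℕ × ξ) Set.countable_empty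
    (fun (q : ℕ × ℕ) z => q.1 < q.2 → R ((fun k => z (q.1, k)) ⋈ fun k => z (q.2, k)))
    (fun q => (DA.const _ _).imp ((hR.pull _
      (by rintro (i | i) <;> exact Or.inl ⟨_, fun _ => rfl⟩)).da _))
    (fun s => by
      obtain ⟨z, hz⟩ := h (s.sup Prod.snd + 1)
      refine ⟨fun q => z q.1 q.2, fun q hq hlt => hz _ _ hlt ?_⟩
      exact Nat.lt_succ_of_le (Finset.le_sup (f := Prod.snd) hq))
  exact hN ξ R hR (fun i k => z (i, k)) fun i j hij => hz (i, j) hij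

lemma array_sop3 [Finite α] [Finite β] [Finite γ] {Y : J → Set 𝕄} (hY : K.NS Y) (hN : K.N3)
    {φ : (α ⊕ β → 𝕄) → Prop} {ψ : (α ⊕ γ → 𝕄) → Prop} (hφ : K.D φ) (hψ : K.D ψ)
    (B : ℕ → β → 𝕄) (C0 C1 : ℕ → γ → 𝕄) (fB : β → J) (fC : γ → J)
    (hB : ∀ i, InX Y fB (B i)) (hC0 : ∀ i, InX Y fC (C0 i)) (hC1 : ∀ i, InX Y fC (C1 i))
    (hE : ∀ j, K.EA {y | (∃ i < j, ∃ k, C0 i k = y ∨ C1 i k = y) ∨ ∃ i ≤ j, ∃ k, B i k = y}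
      (C0 j) (C1 j))
    (inc : ∀ i j, i < j → ¬ ∃ x, φ (x ⋈ B j) ∧ ψ (x ⋈ C0 i))
    (con : ∀ s n, ∃ x, (∀ i ≤ s, φ (x ⋈ B i)) ∧ ∀ j, s ≤ j → j < n → ψ (x ⋈ C1 j)) : False := by
  classical
  -- homogeneous consistency
  have key : ∀ k : ℕ, ∃ h : ℕ → ℕ, StrictMono h ∧ ∀ t : Finset ℕ, t.card = 2 * k →
      ∃ x, ∀ i ∈ t, ((t.filter (· < i)).card < k → φ (x ⋈ B (h i))) ∧
        (k ≤ (t.filter (· < i)).card → ψ (x ⋈ C0 (h i))) := by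
    intro k
    let P : Finset ℕ → Prop := fun H => ∃ x, ∀ i ∈ H,
      ((H.filter (· < i)).card < k → φ (x ⋈ B i)) ∧
        (k ≤ (H.filter (· < i)).card → ψ (x ⋈ C0 i))
    obtain ⟨h, hh, hP⟩ := ramsey P (2 * k)
    have hfil : ∀ (t : Finset ℕ) i, ((t.image h).filter (· < h i)).card =
        (t.filter (· < i)).card := by
      intro t i
      rw [Finset.filter_image, Finset.card_image_of_injective _ hh.injective]
      simp only [hh.lt_iff_lt]
    refine ⟨h, hh, ?_⟩
    rcases hP with hP | hP
    · intro t ht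
      obtain ⟨x, hx⟩ := hP t ht
      refine ⟨x, fun i hi => ?_⟩
      have := hx (h i) (Finset.mem_image_of_mem _ hi)
      rwa [hfil] at this
    · exfalso
      let S : (α ⊕ (γ ⊕ Fin k × β) → 𝕄) → Prop := fun z =>
        ψ ((fun i => z (Sum.inl i)) ⋈ fun i => z (Sum.inr (Sum.inl i))) ∧
          ∀ l : Fin k, φ ((fun i => z (Sum.inl i)) ⋈ fun i => z (Sum.inr (Sum.inr (l, i))))
      have hS : K.D S := by
        refine DA.d (DA.and ?_ (DA.all_fin fun l => ?_))
        · exact (hψ.da _).pull _ (by rintro (i | i) <;> exact Or.inl ⟨_, fun _ => rfl⟩)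
        · exact (hφ.da _).pull _ (by rintro (i | i) <;> exact Or.inl ⟨_, fun _ => rfl⟩)
      obtain ⟨n, hn⟩ := hY.array (fC ⋈ fun q => fB q.2) hS k
      refine hn (fun i t => (if t then C0 (h (k + i)) else C1 (h (k + i))) ⋈
        fun q => B (h q.1) q.2) ?_ ?_ ?_ ?_
      · intro i t
        rintro (j | j)
        · cases t
          · exact hC1 _ _
          · exact hC0 _ _
        · exact hB _ _
      · intro i hi
        have h1 := ((hE (h (k + i))).symm).add (fun q : Fin k × β => B (h q.1) q.2) (by
          intro q
          refine Or.inr (Or.inr ⟨h q.1, ?_, _, rfl⟩)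
          apply hh.monotone; omega)
        refine EA.mono h1 ?_
        rintro y (hy | ⟨j, hj, t, (q | q), rfl⟩)
        · exact hy.elim
        · refine Or.inl ⟨h (k + j), hh (by omega), q, ?_⟩
          cases t
          · exact Or.inr rfl
          · exact Or.inl rfl
        · refine Or.inr ⟨h q.1, hh.monotone (by omega), _, rfl⟩
      · obtain ⟨x, hx1, hx2⟩ := con (h k) (h (k + n))
        refine ⟨x, fun i hi => ⟨hx2 _ (hh.monotone (by omega)) (hh (by omega)), fun l => ?_⟩⟩
        exact hx1 (h l) (hh.monotone l.2.le)
      · rintro s hs hcard ⟨x, hx⟩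
        have hdis : Disjoint (Finset.range k) (s.image (k + ·)) := by
          rw [Finset.disjoint_left]
          intro i hi hi'
          simp at hi hi'; omega
        refine hP (Finset.range k ∪ s.image (k + ·)) ?_ ⟨x, ?_⟩
        · rw [Finset.card_union_of_disjoint hdis, Finset.card_range,
            Finset.card_image_of_injective _ (add_right_injective k), hcard]; omega
        · intro i hi
          obtain ⟨i, hi0, rfl⟩ := Finset.mem_image.1 hi
          rw [hfil]
          rcases Finset.mem_union.1 hi0 with hi | hi
          · have hik : i < k := Finset.mem_range.1 hi
            refine ⟨fun _ => ?_, fun hle => ?_⟩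
            · obtain ⟨j, hj⟩ : s.Nonempty := by
                rw [← Finset.card_pos]; omega
              exact (hx j hj).2 ⟨i, hik⟩
            · exfalso
              have : (Finset.range k ∪ s.image (k + ·)).filter (· < i) ⊆ Finset.range i := by
                intro j hj
                simpa using (Finset.mem_filter.1 hj).2
              have := Finset.card_le_card this
              rw [Finset.card_range] at this
              omega
          · obtain ⟨j, hj, rfl⟩ := Finset.mem_image.1 hi
            refine ⟨fun hlt => ?_, fun _ => (hx j hj).1⟩
            exfalso
            have : Finset.range k ⊆ (Finset.range k ∪ s.image (k + ·)).filter (· < k + j) := by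
              intro i hi
              refine Finset.mem_filter.2 ⟨Finset.mem_union_left _ hi, ?_⟩
              have := Finset.mem_range.1 hi; omega
            have := Finset.card_le_card this
            rw [Finset.card_range] at this
            omega
  -- the relation
  let R : ((α ⊕ β ⊕ γ) ⊕ (α ⊕ β ⊕ γ) → 𝕄) → Prop := fun z =>
    φ ((fun i => z (Sum.inl (Sum.inl i))) ⋈ fun i => z (Sum.inr (Sum.inr (Sum.inl i)))) ∧
    ψ ((fun i => z (Sum.inr (Sum.inl i))) ⋈ fun i => z (Sum.inl (Sum.inr (Sum.inr i)))) ∧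
    ¬ ∃ w : α → 𝕄, φ (w ⋈ fun i => z (Sum.inl (Sum.inr (Sum.inl i)))) ∧
      ψ (w ⋈ fun i => z (Sum.inr (Sum.inr (Sum.inr i))))
  have hR : K.D R := by
    refine DA.d (DA.and ?_ (DA.and ?_ (DA.not (DA.ex_of (DA.and ?_ ?_)))))
    · exact (hφ.da _).pull _ (by rintro (i | i) <;> exact Or.inl ⟨_, fun _ => rfl⟩)
    · exact (hψ.da _).pull _ (by rintro (i | i) <;> exact Or.inl ⟨_, fun _ => rfl⟩)
    · exact (hφ.da _).pull _ (by rintro (i | i) <;> exact Or.inl ⟨_, fun _ => rfl⟩)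
    · exact (hψ.da _).pull _ (by rintro (i | i) <;> exact Or.inl ⟨_, fun _ => rfl⟩)
  obtain ⟨x1, x2, x3, h12, h23, h31⟩ := hN.fin hR (by
    intro r
    obtain ⟨h, hh, hP⟩ := key r
    have hx : ∀ s, ∃ x : α → 𝕄, (∀ i, s ≤ i → i < s + r → φ (x ⋈ B (h i))) ∧
        ∀ i, s + r < i → i ≤ s + 2 * r → ψ (x ⋈ C0 (h i)) := by
      intro s
      have hdis : Disjoint (Finset.Ico s (s + r)) (Finset.Ioc (s + r) (s + 2 * r)) := by
        rw [Finset.disjoint_left]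
        intro i hi hi'
        simp at hi hi'; omega
      obtain ⟨x, hx⟩ := hP (Finset.Ico s (s + r) ∪ Finset.Ioc (s + r) (s + 2 * r)) (by
        rw [Finset.card_union_of_disjoint hdis]; simp; omega)
      refine ⟨x, fun i hi1 hi2 => ?_, fun i hi1 hi2 => ?_⟩
      · refine (hx i (Finset.mem_union_left _ (Finset.mem_Ico.2 ⟨hi1, hi2⟩))).1 ?_
        have : (Finset.Ico s (s + r) ∪ Finset.Ioc (s + r) (s + 2 * r)).filter (· < i) ⊆
            Finset.Ico s i := by
          intro j hj
          simp at hj ⊢; omega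
        have := Finset.card_le_card this
        rw [Nat.card_Ico] at this
        omega
      · refine (hx i (Finset.mem_union_right _ (Finset.mem_Ioc.2 ⟨hi1, hi2⟩))).2 ?_
        have : Finset.Ico s (s + r) ⊆
            (Finset.Ico s (s + r) ∪ Finset.Ioc (s + r) (s + 2 * r)).filter (· < i) := by
          intro j hj
          simp at hj ⊢; omega
        have := Finset.card_le_card this
        rw [Nat.card_Ico] at this
        omega
    choose x hx1 hx2 using hx
    refine ⟨fun i => x (r - 1 - i) ⋈ (B (h (r - 1 - i + r)) ⋈ C0 (h (r - 1 - i + r))),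
      fun i j hij hj => ⟨?_, ?_, ?_⟩⟩
    · exact hx1 _ _ (by omega) (by omega)
    · exact hx2 _ _ (by omega) (by omega)
    · exact inc _ _ (hh (by omega)))
  exact h12.2.2 ⟨_, h31.1, h23.2.1⟩

end Ctx
end NSOP3Paper

namespace NSOP3Paper
open Filter
namespace Ctx

variable {𝕄 : Type w} {K : Ctx 𝕄} {α β γ δ ξ : Type} {J J' : Type}

lemma Tree.con [Countable α] [Countable β] [Countable γ] {X : J → Set 𝕄} (hX : K.NS X)
    {Y : J' → Set 𝕄} (hY : K.NS Y) {a a' : α → 𝕄} {b : β → 𝕄} {c : γ → 𝕄} (ha : Good X a)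
    (hb : Good Y b) (hc : Good Y c) (haa : K.E a a') (hab : K.Wk a b) (hac : K.Wk a' c)
    {n : ℕ} {T : List ℕ → γ ⊕ β → 𝕄} (hT : K.Tree c b n T) (hTc : ∀ ν, K.E (T ν ∘ Sum.inl) c)
    {U : Ultrafilter (List ℕ × (γ ⊕ β) → 𝕄)} (hU : K.Inv U)
    (hUT : K.Realizes U ∅ (NSOP3Paper.flat T)) {d : ℕ → List ℕ × (γ ⊕ β) → 𝕄} (hd : K.Mor U d)
    {f : ℕ → Fin 3 → ℕ} (hf : IsSA f) {s q : ℕ} (hs : s < n) (hq : s + q ≤ n) :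
    ∃ x : α → 𝕄, ∀ l, (∀ i ≤ s, K.E (a ⋈ b) (x ⋈ fun k => d l (adr f i 2, Sum.inr k))) ∧
      ∀ j, s ≤ j → j < s + q → K.E (a' ⋈ c) (x ⋈ fun k => d l (adr f j 1, Sum.inl k)) := by
  classical
  let g1 : ℕ → γ → List ℕ × (γ ⊕ β) := fun t k => (adr f (s + q - 1 - t) 1, Sum.inl k)
  let g2 : ℕ → β → List ℕ × (γ ⊕ β) := fun t k => (adr f (s - (t - q)) 2, Sum.inr k)
  obtain ⟨I, hI1, hI2⟩ : ∃ I : ℕ → Set (List ℕ × (γ ⊕ β)), (∀ t < q, I t = Set.range (g1 t)) ∧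
      ∀ t, q ≤ t → I t = Set.range (g2 t) :=
    ⟨fun t => if t < q then Set.range (g1 t) else Set.range (g2 t), fun t ht => if_pos ht,
      fun t ht => if_neg (by omega)⟩
  have hTg : Good Y (NSOP3Paper.flat T) := by
    obtain ⟨fb, hfb⟩ := hb
    obtain ⟨fc, hfc⟩ := hc
    refine ⟨fun p => (fc ⋈ fb) p.2, ?_⟩
    rintro ⟨ν, k | k⟩
    · exact hY.inX (hTc ν).symm hfc k
    · exact hY.inX (hT.b_e ν).symm hfb k
  have hu : ∀ t, ∃ x : α → 𝕄, K.E a x ∧ K.Wk x (fun i : I t => NSOP3Paper.flat T i) ∧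
      (t < q → K.E (a' ⋈ c) (x ⋈ (NSOP3Paper.flat T ∘ g1 t))) ∧
      (q ≤ t → K.E (a ⋈ b) (x ⋈ (NSOP3Paper.flat T ∘ g2 t))) := by
    intro t
    by_cases ht : t < q
    · obtain ⟨x, h1, h2, h3⟩ := hac.range (T := NSOP3Paper.flat T) (g1 t) (hTc _).symm
      refine ⟨x, haa.trans h1, ?_, fun _ => h3, fun h => by omega⟩
      rw [hI1 t ht]; exact h2
    · obtain ⟨x, h1, h2, h3⟩ := hab.range (T := NSOP3Paper.flat T) (g2 t) (hT.b_e _).symm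
      refine ⟨x, h1, ?_, fun h => by omega, fun _ => h3⟩
      rw [hI2 t (by omega)]; exact h2
  choose u hu1 hu2 hu3 hu4 using hu
  obtain ⟨x, hax, hxW, hx⟩ := wit_seq hX hY ha hTg I u (q + (s + 1)) (fun t _ => hu1 t)
    (fun t _ => hu2 t) (by
      intro t ht
      by_cases htq : t < q
      · have h1 := hT.spine_fs hf (i := s + q - 1 - t) (e := 1) (by omega) (by decide)
        rw [hI1 t htq]
        refine h1.of_comp ?_ (fun i => Sum.inl i.2.choose) ?_
        · rintro y ⟨j, hj, i, hi, rfl⟩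
          rw [hI1 j (by omega)] at hi
          obtain ⟨k, rfl⟩ := hi
          exact ⟨s + q - 1 - j, 1, Sum.inl k, Or.inl (by omega), rfl⟩
        · rintro ⟨i, hi⟩
          change NSOP3Paper.flat T i = NSOP3Paper.flat T (g1 t hi.choose)
          rw [hi.choose_spec]
      · have h1 := hT.spine_fs hf (i := s - (t - q)) (e := 2) (by omega) (by decide)
        rw [hI2 t (by omega)]
        refine h1.of_comp ?_ (fun i => Sum.inr i.2.choose) ?_
        · rintro y ⟨j, hj, i, hi, rfl⟩
          by_cases hjq : j < q
          · rw [hI1 j hjq] at hi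
            obtain ⟨k, rfl⟩ := hi
            refine ⟨s + q - 1 - j, 1, Sum.inl k, ?_, rfl⟩
            rcases Nat.lt_or_ge (s - (t - q)) (s + q - 1 - j) with h | h
            · exact Or.inl h
            · exact Or.inr ⟨by omega, by decide⟩
          · rw [hI2 j (by omega)] at hi
            obtain ⟨k, rfl⟩ := hi
            exact ⟨s - (j - q), 2, Sum.inr k, Or.inl (by omega), rfl⟩
        · rintro ⟨i, hi⟩
          change NSOP3Paper.flat T i = NSOP3Paper.flat T (g2 t hi.choose)
          rw [hi.choose_spec])
  have hTg' : Good Y (fun i : {i | ∃ t < q + (s + 1), i ∈ I t} => NSOP3Paper.flat T i) := by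
    obtain ⟨fT, hfT⟩ := hTg
    exact ⟨fun i => fT i, fun i => hfT i⟩
  obtain ⟨x', hx'⟩ := hxW.along hY hTg' (hU.map Subtype.val) (hUT.map Subtype.val)
    (hd.map Subtype.val)
  refine ⟨x', fun l => ⟨fun i hi => ?_, fun j hj1 hj2 => ?_⟩⟩
  · have ht : q + (s - i) < q + (s + 1) := by omega
    have hmem : ∀ k : β, (adr f i 2, Sum.inr k) ∈ I (q + (s - i)) := by
      intro k
      rw [hI2 _ (by omega)]
      refine ⟨k, ?_⟩
      have : s - (q + (s - i) - q) = i := by omega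
      simp only [g2, this]
    have e0 := hu4 (q + (s - i)) (by omega)
    have eg : NSOP3Paper.flat T ∘ g2 (q + (s - i)) = fun k => T (adr f i 2) (Sum.inr k) := by
      have : s - (q + (s - i) - q) = i := by omega
      funext k
      simp only [g2, this, Function.comp, NSOP3Paper.flat]
    rw [eg] at e0
    have e1 : K.E (x ⋈ fun k => T (adr f i 2) (Sum.inr k))
        (u (q + (s - i)) ⋈ fun k => T (adr f i 2) (Sum.inr k)) :=
      (hx _ ht).of_comp (Sum.map id fun k => ⟨_, hmem k⟩) (by rintro (i | i) <;> rfl)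
        (by rintro (i | i) <;> rfl)
    have e2 : K.E (x ⋈ fun k => T (adr f i 2) (Sum.inr k))
        (x' ⋈ fun k => d l (adr f i 2, Sum.inr k)) :=
      (hx' l).of_comp (Sum.map id fun k => ⟨_, _, ht, hmem k⟩) (by rintro (i | i) <;> rfl)
        (by rintro (i | i) <;> rfl)
    exact e0.trans (e1.symm.trans e2)
  · have htq : s + q - 1 - j < q := by omega
    have ht : s + q - 1 - j < q + (s + 1) := by omega
    have hmem : ∀ k : γ, (adr f j 1, Sum.inl k) ∈ I (s + q - 1 - j) := by
      intro k
      rw [hI1 _ htq]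
      refine ⟨k, ?_⟩
      have : s + q - 1 - (s + q - 1 - j) = j := by omega
      simp only [g1, this]
    have e0 := hu3 (s + q - 1 - j) htq
    have eg : NSOP3Paper.flat T ∘ g1 (s + q - 1 - j) = fun k => T (adr f j 1) (Sum.inl k) := by
      have : s + q - 1 - (s + q - 1 - j) = j := by omega
      funext k
      simp only [g1, this, Function.comp, NSOP3Paper.flat]
    rw [eg] at e0
    have e1 : K.E (x ⋈ fun k => T (adr f j 1) (Sum.inl k))
        (u (s + q - 1 - j) ⋈ fun k => T (adr f j 1) (Sum.inl k)) :=
      (hx _ ht).of_comp (Sum.map id fun k => ⟨_, hmem k⟩) (by rintro (i | i) <;> rfl)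
        (by rintro (i | i) <;> rfl)
    have e2 : K.E (x ⋈ fun k => T (adr f j 1) (Sum.inl k))
        (x' ⋈ fun k => d l (adr f j 1, Sum.inl k)) :=
      (hx' l).of_comp (Sum.map id fun k => ⟨_, _, ht, hmem k⟩) (by rintro (i | i) <;> rfl)
        (by rintro (i | i) <;> rfl)
    exact e0.trans (e1.symm.trans e2)

end Ctx
end NSOP3Paper

namespace NSOP3Paper
open Filter
namespace Ctx

variable {𝕄 : Type w} {K : Ctx 𝕄} {α β γ δ ξ : Type} {J J' : Type}

/-- Conjunction of a condition on `(x, b)` and a condition on `(x, c)`. -/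
def Conj (S1 : (α ⊕ β → 𝕄) → Prop) (S2 : (α ⊕ γ → 𝕄) → Prop) : (α ⊕ (β ⊕ γ) → 𝕄) → Prop := fun z =>
  S1 ((fun i => z (Sum.inl i)) ⋈ fun i => z (Sum.inr (Sum.inl i))) ∧
    S2 ((fun i => z (Sum.inl i)) ⋈ fun i => z (Sum.inr (Sum.inr i)))

lemma Conj.d {S1 : (α ⊕ β → 𝕄) → Prop} {S2 : (α ⊕ γ → 𝕄) → Prop} (h1 : K.D S1) (h2 : K.D S2) :
    K.D (Conj S1 S2) := by
  refine K.d_and ?_ ?_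
  · exact h1.pull _ (by rintro (i | i) <;> exact Or.inl ⟨_, fun _ => rfl⟩)
  · exact h2.pull _ (by rintro (i | i) <;> exact Or.inl ⟨_, fun _ => rfl⟩)

/-- Consistency part of the independence theorem. -/
lemma conj_wks [Finite α] [Finite β] [Finite γ] (hN3 : K.N3) {X : J → Set 𝕄} (hX : K.NS X)
    {Y : J' → Set 𝕄} (hY : K.NS Y) {a a' : α → 𝕄} {b : β → 𝕄} {c : γ → 𝕄} (ha : Good X a)
    (hb : Good Y b) (hc : Good Y c) (haa : K.E a a') (hab : K.Wk a b) (hac : K.Wk a' c)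
    (hcb : K.Wk c b) {S1 : (α ⊕ β → 𝕄) → Prop} {S2 : (α ⊕ γ → 𝕄) → Prop} (hS1 : K.D S1)
    (hS2 : K.D S2) (h1 : S1 (a ⋈ b)) (h2 : S2 (a' ⋈ c)) : K.WkS (Conj S1 S2) (b ⋈ c) := by
  classical
  by_contra hn
  simp only [WkS, not_forall, not_exists, not_and] at hn
  obtain ⟨N, hN⟩ := hn
  choose T hT hTc hTW using exists_tree hY hb hcb
  have hR : ∀ n, ∃ U, K.Coh U ∧ K.Realizes U ∅ (NSOP3Paper.flat (T n)) :=
    fun n => (fs_empty (K := K) _).coh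
  choose U hU hUT using hR
  choose d hd using fun n => exists_mor' (K := K) (U n)
  obtain ⟨arr, harr, hEA⟩ := extract (K := K) (δ := Fin N × (γ ⊕ β))
    (fun n ν q => d n q.1 (ν, q.2))
  let φ : (α ⊕ (Fin N × β) → 𝕄) → Prop := fun z =>
    ∀ l : Fin N, S1 ((fun i => z (Sum.inl i)) ⋈ fun i => z (Sum.inr (l, i)))
  let ψ : (α ⊕ (Fin N × γ) → 𝕄) → Prop := fun z =>
    ∀ l : Fin N, S2 ((fun i => z (Sum.inl i)) ⋈ fun i => z (Sum.inr (l, i)))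
  have hφ : K.D φ := DA.d (DA.all_fin fun l => (hS1.da _).pull _
    (by rintro (i | i) <;> exact Or.inl ⟨_, fun _ => rfl⟩))
  have hψ : K.D ψ := DA.d (DA.all_fin fun l => (hS2.da _).pull _
    (by rintro (i | i) <;> exact Or.inl ⟨_, fun _ => rfl⟩))
  have hEb : ∀ i e (l : Fin N), K.E b (fun k => arr i e (l, Sum.inr k)) := by
    intro i e l C hC hCa
    refine harr (fun z => C (fun k => z (i, e, l, Sum.inr k)))
      (hC.pull _ fun _ => Or.inl ⟨_, fun _ => rfl⟩) ⟨0, fun n _ f _ => ?_⟩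
    have e1 : K.E (fun k => d n l (adr f i e, Sum.inr k)) (T n (adr f i e) ∘ Sum.inr) :=
      ((hd n).e (hUT n) l).of_comp (fun k => (adr f i e, Sum.inr k)) (fun _ => rfl) (fun _ => rfl)
    exact (e1.trans ((hT n).b_e _)).symm C hC hCa
  have hEc : ∀ i e (l : Fin N), K.E c (fun k => arr i e (l, Sum.inl k)) := by
    intro i e l C hC hCa
    refine harr (fun z => C (fun k => z (i, e, l, Sum.inl k)))
      (hC.pull _ fun _ => Or.inl ⟨_, fun _ => rfl⟩) ⟨0, fun n _ f _ => ?_⟩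
    have e1 : K.E (fun k => d n l (adr f i e, Sum.inl k)) (T n (adr f i e) ∘ Sum.inl) :=
      ((hd n).e (hUT n) l).of_comp (fun k => (adr f i e, Sum.inl k)) (fun _ => rfl) (fun _ => rfl)
    exact (e1.trans (hTc n _)).symm C hC hCa
  obtain ⟨fb, hfb⟩ := id hb
  obtain ⟨fc, hfc⟩ := id hc
  refine array_sop3 hY hN3 hφ hψ (fun i q => arr i 2 (q.1, Sum.inr q.2))
    (fun i q => arr i 0 (q.1, Sum.inl q.2)) (fun i q => arr i 1 (q.1, Sum.inl q.2))
    (fun q => fb q.2) (fun q => fc q.2) ?_ ?_ ?_ ?_ ?_ ?_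
  · rintro i ⟨l, k⟩
    exact hY.inX (hEb i 2 l) hfb k
  · rintro i ⟨l, k⟩
    exact hY.inX (hEc i 0 l) hfc k
  · rintro i ⟨l, k⟩
    exact hY.inX (hEc i 1 l) hfc k
  · intro j
    refine ((hEA j).of_comp (fun q : Fin N × γ => (q.1, Sum.inl q.2)) (fun _ => rfl)
      (fun _ => rfl)).mono ?_
    rintro y (⟨i, hi, k, (rfl | rfl)⟩ | ⟨i, hi, k, rfl⟩)
    · exact ⟨i, 0, _, Or.inl hi, rfl⟩
    · exact ⟨i, 1, _, Or.inl hi, rfl⟩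
    · rcases Nat.lt_or_eq_of_le hi with h | h
      · exact ⟨i, 2, _, Or.inl h, rfl⟩
      · exact ⟨i, 2, _, Or.inr ⟨h, rfl⟩, rfl⟩
  · intro i j hij
    refine harr (fun z => ¬ ∃ x : α → 𝕄,
      φ (x ⋈ fun q => z (j, 2, q.1, Sum.inr q.2)) ∧ ψ (x ⋈ fun q => z (i, 0, q.1, Sum.inl q.2)))
      ?_ ⟨i + 1, fun n hn f hf => ?_⟩
    · refine K.d_not (DA.d (DA.ex_of (DA.and ?_ ?_)))
      · exact (hφ.da _).pull _ (by rintro (i | i) <;> exact Or.inl ⟨_, fun _ => rfl⟩)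
      · exact (hψ.da _).pull _ (by rintro (i | i) <;> exact Or.inl ⟨_, fun _ => rfl⟩)
    · rintro ⟨x, hx1, hx2⟩
      let g : β ⊕ γ → List ℕ × (γ ⊕ β) :=
        (fun k => (adr f j 2, Sum.inr k)) ⋈ fun k => (adr f i 0, Sum.inl k)
      have key := hN (fun l => d n l ∘ g)
      refine absurd (key (fun l hl => ⟨?_, ?_⟩) x) ?_
      · have e1 : K.E (d n l ∘ g) (NSOP3Paper.flat (T n) ∘ g) := ((hd n).e (hUT n) l).comp g
        have e2 := ((hT n).spine_e f (i := i) (j := j) (by omega) hij 2).swap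
        refine e1.trans (e2.of_comp id ?_ (fun _ => rfl))
        rintro (k | k) <;> rfl
      · refine (((hU n).fs (hd n l)).map g).gen.mono ?_
        rintro y ⟨l', hl', k, rfl⟩
        exact ⟨l', hl', _, rfl⟩
      · rintro ⟨l, hl, hnl⟩
        exact hnl ⟨hx1 ⟨l, hl⟩, hx2 ⟨l, hl⟩⟩
  · intro s n0
    refine harr (fun z => ∃ x : α → 𝕄,
      (∀ i ≤ s, φ (x ⋈ fun q => z (i, 2, q.1, Sum.inr q.2))) ∧
        ∀ j, s ≤ j → j < n0 → ψ (x ⋈ fun q => z (j, 1, q.1, Sum.inl q.2)))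
      ?_ ⟨s + n0 + 1, fun n hn f hf => ?_⟩
    · have : K.D (fun z : ℕ × Fin 3 × Fin N × (γ ⊕ β) → 𝕄 => ∃ x : α → 𝕄,
        (∀ i < s + 1, φ (x ⋈ fun q => z (i, 2, q.1, Sum.inr q.2))) ∧
          ∀ j < n0, s ≤ j → ψ (x ⋈ fun q => z (j, 1, q.1, Sum.inl q.2))) := by
        refine DA.d (DA.ex_of (DA.and (DA.lt _ fun i _ => ?_) (DA.lt _ fun j _ =>
          (DA.const _ _).imp ?_)))
        · exact (hφ.da _).pull _ (by rintro (i | i) <;> exact Or.inl ⟨_, fun _ => rfl⟩)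
        · exact (hψ.da _).pull _ (by rintro (i | i) <;> exact Or.inl ⟨_, fun _ => rfl⟩)
      refine this.congr fun z => ?_
      constructor
      · rintro ⟨x, hx1, hx2⟩
        exact ⟨x, fun i hi => hx1 i (by omega), fun j hj hs => hx2 j hs hj⟩
      · rintro ⟨x, hx1, hx2⟩
        exact ⟨x, fun i hi => hx1 i (by omega), fun j hs hj => hx2 j hj hs⟩
    · obtain ⟨x, hx⟩ := Tree.con hX hY ha hb hc haa hab hac (hT n) (hTc n) (hU n).inv (hUT n)
        (hd n) hf (s := s) (q := n0) (by omega) (by omega)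
      refine ⟨x, fun i hi l => ?_, fun j hj1 hj2 l => ?_⟩
      · exact (hx l).1 i hi S1 hS1 h1
      · exact (hx l).2 j hj1 (by omega) S2 hS2 h2

/-- The independence theorem, abstract form. -/
theorem ind_thm [Finite α] [Finite β] [Finite γ] (hN3 : K.N3) {X : J → Set 𝕄} (hX : K.NS X)
    {Y : J' → Set 𝕄} (hY : K.NS Y) {a a' : α → 𝕄} {b : β → 𝕄} {c : γ → 𝕄} (ha : Good X a)
    (hb : Good Y b) (hc : Good Y c) (haa : K.E a a') (hab : K.Wk a b) (hac : K.Wk a' c)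
    (hcb : K.Wk c b) :
    ∃ x : α → 𝕄, K.E (x ⋈ b) (a ⋈ b) ∧ K.E (x ⋈ c) (a' ⋈ c) ∧ K.Wk x (b ⋈ c) := by
  classical
  obtain ⟨U, hU, hUbc⟩ := (fs_empty (K := K) (b ⋈ c)).coh
  obtain ⟨d, hd⟩ := exists_mor' (K := K) U
  let ι := {p : ((α ⊕ β → 𝕄) → Prop) × ((α ⊕ γ → 𝕄) → Prop) //
    K.D p.1 ∧ K.D p.2 ∧ p.1 (a ⋈ b) ∧ p.2 (a' ⋈ c)}
  obtain ⟨y, hy⟩ := sat (K := K) (A := Set.range (NSOP3Paper.flat d)) (Set.countable_range _)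
    (fun (p : ι × ℕ) (x : α → 𝕄) => Conj p.1.1.1 p.1.1.2 (x ⋈ d p.2))
    (by
      rintro ⟨p, i⟩
      have := Conj.d p.2.1 p.2.2.1
      exact this.sub (d i) fun k => ⟨(i, k), rfl⟩)
    (by
      intro s
      have hw := conj_wks hN3 hX hY ha hb hc haa hab hac hcb
        (S1 := fun z => ∀ p ∈ s, p.1.1.1 z) (S2 := fun z => ∀ p ∈ s, p.1.1.2 z)
        (DA.d (DA.ball _ fun p _ => p.1.2.1.da _)) (DA.d (DA.ball _ fun p _ => p.1.2.2.1.da _))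
        (fun p _ => p.1.2.2.2.1) (fun p _ => p.1.2.2.2.2)
      have hst := hw.st hY (hb.pair hc) (Conj.d (DA.d (DA.ball _ fun p _ => p.1.2.1.da _))
        (DA.d (DA.ball _ fun p _ => p.1.2.2.1.da _)))
      obtain ⟨x, hx⟩ := hst U hU.inv hUbc d hd (s.sup Prod.snd + 1)
      refine ⟨x, fun p hp => ?_⟩
      have := hx p.2 (Nat.lt_succ_of_le (Finset.le_sup (f := Prod.snd) hp))
      exact ⟨this.1 p hp, this.2 p hp⟩)
  obtain ⟨x, hxW, hx⟩ := limit_principle (K := K) (fun i => hd.e hUbc i)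
    (fun i => (hU.fs (hd i)).gen) y
  refine ⟨x, E.symm ?_, E.symm ?_, hxW⟩
  · intro S hS h
    have := hx (Conj S fun _ => True) (Conj.d hS K.d_true)
      (fun i => hy (⟨(S, fun _ => True), hS, K.d_true, h, trivial⟩, i))
    exact this.1
  · intro S hS h
    have := hx (Conj (fun _ => True) S) (Conj.d K.d_true hS)
      (fun i => hy (⟨(fun _ => True, S), K.d_true, hS, trivial, h⟩, i))
    exact this.2

end Ctx
end NSOP3Paper

namespace NSOP3Paper
open FirstOrder Language

section Wrap
variable {L : FirstOrder.Language.{u, v}} {𝕄 : Type w} [L.Structure 𝕄]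

/-- A condition definable over `M`. -/
def CD (L : FirstOrder.Language.{u, v}) {𝕄 : Type w} [L.Structure 𝕄] (M : Set 𝕄)
    {α : Type} (C : (α → 𝕄) → Prop) : Prop :=
  ∃ φ : ParamFormula L 𝕄 α, φ.ParamsIn M ∧ ∀ x, C x ↔ φ.Realize x

lemma CD.not {M : Set 𝕄} {α : Type} {C : (α → 𝕄) → Prop} (h : CD L M C) :
    CD L M fun x => ¬ C x := by
  obtain ⟨φ, hφ, h⟩ := h
  refine ⟨φ.not, hφ, fun x => ?_⟩
  beta_reduce; rw [h]; exact Iff.rfl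

lemma CD.and {M : Set 𝕄} {α : Type} {C C' : (α → 𝕄) → Prop} (h : CD L M C) (h' : CD L M C') :
    CD L M fun x => C x ∧ C' x := by
  obtain ⟨φ, hφ, h⟩ := h
  obtain ⟨φ', hφ', h'⟩ := h'
  refine ⟨⟨φ.Params ⊕ φ'.Params, φ.toFormula.relabel (Sum.map id Sum.inl) ⊓
    φ'.toFormula.relabel (Sum.map id Sum.inr), Sum.elim φ.params φ'.params⟩, ?_, fun x => ?_⟩
  · rintro (i | i)
    exacts [hφ i, hφ' i]
  · beta_reduce; rw [h, h']
    simp only [ParamFormula.Realize, Formula.realize_inf, Formula.realize_relabel,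
      Sum.elim_comp_map, Function.comp_id, Sum.elim_comp_inl, Sum.elim_comp_inr]

lemma CD.true {M : Set 𝕄} {α : Type} : CD L M fun _ : α → 𝕄 => True :=
  ⟨⟨Empty, ⊤, Empty.elim⟩, fun i => i.elim, fun x => by simp [ParamFormula.Realize]⟩

lemma CD.comp {M : Set 𝕄} {α β : Type} {C : (α → 𝕄) → Prop} (g : α → β) (h : CD L M C) :
    CD L M fun x => C (x ∘ g) := by
  obtain ⟨φ, hφ, h⟩ := h
  refine ⟨⟨φ.Params, φ.toFormula.relabel (Sum.map g id), φ.params⟩, hφ, fun x => ?_⟩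
  beta_reduce; rw [h]
  simp only [ParamFormula.Realize, Formula.realize_relabel, Sum.elim_comp_map, Function.comp_id]

lemma CD.supp {M : Set 𝕄} {α : Type} {C : (α → 𝕄) → Prop} (h : CD L M C) :
    ∃ (s : Finset α) (C0 : (s → 𝕄) → Prop), CD L M C0 ∧ ∀ x, C x ↔ C0 fun i => x i := by
  classical
  obtain ⟨φ, hφ, h⟩ := h
  let F := BoundedFormula.freeVarFinset φ.toFormula
  let s : Finset α := F.toLeft
  let f : F → s ⊕ φ.Params := fun i => match i with
    | ⟨Sum.inl j, hj⟩ => Sum.inl ⟨j, by simpa [s] using hj⟩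
    | ⟨Sum.inr j, _⟩ => Sum.inr j
  let ψ : ParamFormula L 𝕄 s := ⟨φ.Params, BoundedFormula.restrictFreeVar φ.toFormula f, φ.params⟩
  refine ⟨s, ψ.Realize, ⟨ψ, hφ, fun _ => Iff.rfl⟩, fun x => ?_⟩
  rw [h]
  have := BoundedFormula.realize_restrictFreeVar (φ := φ.toFormula) (f := f)
    (v := Sum.elim (fun i : s => x i) φ.params) (Sum.elim x φ.params) (xs := default) (by
      rintro ⟨j | j, hj⟩ <;> rfl)
  exact this.symm

lemma CD.ex {M : Set 𝕄} {α β : Type} [Finite β] {C : (α ⊕ β → 𝕄) → Prop} (h : CD L M C) :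
    CD L M fun x => ∃ y, C (Sum.elim x y) := by
  obtain ⟨φ, hφ, h⟩ := h
  let g : (α ⊕ β) ⊕ φ.Params → (α ⊕ φ.Params) ⊕ β :=
    Sum.elim (Sum.map Sum.inl id) (Sum.inl ∘ Sum.inr)
  refine ⟨⟨φ.Params, (φ.toFormula.relabel g).iExs β, φ.params⟩, hφ, fun x => ?_⟩
  simp only [ParamFormula.Realize, Formula.realize_iExs, Formula.realize_relabel, h]
  refine exists_congr fun y => ?_
  have : Sum.elim (Sum.elim x φ.params) y ∘ g = Sum.elim (Sum.elim x y) φ.params := by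
    funext i
    rcases i with (i | i) | i <;> rfl
  rw [this]

lemma CD.mem {M : Set 𝕄} {α β : Type} {C : (α ⊕ β → 𝕄) → Prop} (m : β → 𝕄) (hm : ∀ i, m i ∈ M)
    (h : CD L M C) : CD L M fun x => C (Sum.elim x m) := by
  obtain ⟨φ, hφ, h⟩ := h
  refine ⟨φ.subst m, ?_, fun x => ?_⟩
  · rintro (i | i)
    exacts [hm i, hφ i]
  · beta_reduce; rw [h]
    simp only [ParamFormula.Realize, ParamFormula.subst, Formula.realize_relabel]
    have : Sum.elim x (Sum.elim m φ.params) ∘ Sum.elim (Sum.map id Sum.inl) (Sum.inr ∘ Sum.inr)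
      = Sum.elim (Sum.elim x m) φ.params := by
      funext i
      rcases i with (i | i) | i <;> rfl
    rw [this]

lemma subst_realize {α γ : Type} (φ : ParamFormula L 𝕄 (α ⊕ γ)) (c : γ → 𝕄) (x : α → 𝕄) :
    (φ.subst c).Realize x ↔ φ.Realize (Sum.elim x c) := by
  simp only [ParamFormula.Realize, ParamFormula.subst, Formula.realize_relabel]
  have : Sum.elim x (Sum.elim c φ.params) ∘ Sum.elim (Sum.map id Sum.inl) (Sum.inr ∘ Sum.inr)
      = Sum.elim (Sum.elim x c) φ.params := by
    funext i
    rcases i with (i | i) | i <;> rfl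
  rw [this]

lemma CD.tv0 {M : L.ElementarySubstructure 𝕄} {α : Type} [Finite α] {C : (α → 𝕄) → Prop}
    (h : CD L (M : Set 𝕄) C) (d : α → 𝕄) (hd : C d) : ∃ m, (∀ i, m i ∈ (M : Set 𝕄)) ∧ C m := by
  obtain ⟨φ, hφ, h⟩ := h
  let p : φ.Params → M := fun i => ⟨φ.params i, hφ i⟩
  let ψ : L.Formula φ.Params := (φ.toFormula.relabel Sum.swap).iExs α
  have h1 : ψ.Realize (M.subtype ∘ p) := by
    rw [Formula.realize_iExs]
    refine ⟨d, ?_⟩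
    rw [Formula.realize_relabel]
    have : Sum.elim (M.subtype ∘ p) d ∘ Sum.swap = Sum.elim d φ.params := by
      funext i; rcases i with i | i <;> rfl
    rw [this]; exact (h d).1 hd
  rw [M.subtype.map_formula, Formula.realize_iExs] at h1
  obtain ⟨y, hy⟩ := h1
  refine ⟨fun i => y i, fun i => (y i).2, ?_⟩
  rw [h]
  rw [← M.subtype.map_formula, Formula.realize_relabel] at hy
  have : (M.subtype ∘ Sum.elim p y) ∘ Sum.swap = Sum.elim (fun i => (y i : 𝕄)) φ.params := by
    funext i; rcases i with i | i <;> rfl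
  rw [this] at hy
  exact hy

lemma CD.tv {M : L.ElementarySubstructure 𝕄} {α : Type} {C : (α → 𝕄) → Prop}
    (h : CD L (M : Set 𝕄) C) (d : α → 𝕄) (hd : C d) : ∃ m, (∀ i, m i ∈ (M : Set 𝕄)) ∧ C m := by
  classical
  obtain ⟨s, C0, h0, hC⟩ := h.supp
  obtain ⟨m, hm, hm0⟩ := h0.tv0 (fun i => d i) ((hC d).1 hd)
  rcases isEmpty_or_nonempty α with hα | ⟨⟨i0⟩⟩
  · exact ⟨d, fun i => hα.elim i, hd⟩
  obtain ⟨z, hz, -⟩ := CD.tv0 (M := M) (CD.true (α := Unit)) (fun _ => d i0) trivial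
  refine ⟨fun i => if hi : i ∈ s then m ⟨i, hi⟩ else z (), fun i => ?_, ?_⟩
  · by_cases hi : i ∈ s
    · simp only [hi, dite_true]; exact hm _
    · simp only [hi, dite_false]; exact hz _
  · rw [hC]
    convert hm0 with i
    simp

lemma univ_of_finite (M : L.ElementarySubstructure 𝕄) (hM : (M : Set 𝕄).Finite) (y : 𝕄) :
    y ∈ (M : Set 𝕄) := by
  classical
  by_contra hy
  have key : ∀ s : Finset 𝕄, (∀ m ∈ s, m ∈ (M : Set 𝕄)) →
      CD L (M : Set 𝕄) fun x : Unit → 𝕄 => ∀ m ∈ s, ¬ x () = m := by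
    intro s
    induction s using Finset.induction_on with
    | empty => intro _; simpa using (CD.true : CD L (M : Set 𝕄) fun _ : Unit → 𝕄 => True)
    | insert m s hms ih =>
      intro hs
      have h1 : CD L (M : Set 𝕄) fun x : Unit → 𝕄 => x () = m :=
        ⟨⟨Unit, Term.equal (Term.var (Sum.inl ())) (Term.var (Sum.inr ())), fun _ => m⟩,
          fun _ => hs m (by simp), fun x => by simp [ParamFormula.Realize, Formula.realize_equal]⟩
      simpa using h1.not.and (ih fun m hm => hs m (by simp [hm]))
  obtain ⟨m, hm, hm'⟩ := (key hM.toFinset (by simp)).tv0 (fun _ => y) (by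
    rintro m hm rfl; exact hy (by simpa using hm))
  exact hm' (m ()) (by simpa using hm ()) rfl

lemma CD.sat {M : L.ElementarySubstructure 𝕄} {κ : Cardinal.{w}} [IsMonster L 𝕄 κ]
    (hM : (M : Set 𝕄).Infinite) (hκ : Cardinal.mk ↥(M : Set 𝕄) < κ) {α : Type} [Countable α]
    (e : ℕ → 𝕄) (F : Set ((α ⊕ ℕ → 𝕄) → Prop)) (hF : ∀ C ∈ F, CD L (M : Set 𝕄) C)
    (hfin : ∀ s : Finset ((α ⊕ ℕ → 𝕄) → Prop), (∀ C ∈ s, C ∈ F) →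
      ∃ x, ∀ C ∈ s, C (Sum.elim x e)) : ∃ x, ∀ C ∈ F, C (Sum.elim x e) := by
  classical
  have hinf : Cardinal.aleph0 ≤ Cardinal.mk ↥(M : Set 𝕄) := by
    have := hM.to_subtype
    exact Cardinal.aleph0_le_mk _
  let A : Set 𝕄 := (M : Set 𝕄) ∪ Set.range e
  have hA : Cardinal.mk A < κ := by
    refine lt_of_le_of_lt ?_ hκ
    refine (Cardinal.mk_union_le _ _).trans ?_
    refine Cardinal.add_le_of_le hinf le_rfl (le_trans ?_ hinf)
    exact Cardinal.mk_le_aleph0_iff.2 (Set.countable_range e).to_subtype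
  have hα : Cardinal.mk (ULift.{w} α) < κ := lt_of_le_of_lt (Cardinal.mk_le_aleph0.trans hinf) hκ
  have : Nonempty (ParamFormula L 𝕄 (α ⊕ ℕ)) := ⟨⟨Empty, ⊤, Empty.elim⟩⟩
  choose! Φ hΦ1 hΦ2 using hF
  let T : ((α ⊕ ℕ → 𝕄) → Prop) → ParamFormula L 𝕄 (ULift.{w} α) := fun C =>
    ⟨ℕ ⊕ (Φ C).Params, (Φ C).toFormula.relabel
      (Sum.elim (Sum.map ULift.up Sum.inl) (Sum.inr ∘ Sum.inr)), Sum.elim e (Φ C).params⟩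
  have hT : ∀ C ∈ F, ∀ x : ULift.{w} α → 𝕄, (T C).Realize x ↔
      C (Sum.elim (fun i => x ⟨i⟩) e) := by
    intro C hC x
    rw [hΦ2 C hC]
    simp only [ParamFormula.Realize, T, Formula.realize_relabel]
    have : Sum.elim x (Sum.elim e (Φ C).params) ∘
        Sum.elim (Sum.map ULift.up Sum.inl) (Sum.inr ∘ Sum.inr)
        = Sum.elim (Sum.elim (fun i => x ⟨i⟩) e) (Φ C).params := by
      funext i
      rcases i with (i | i) | i <;> rfl
    rw [this]
  obtain ⟨x, hx⟩ := IsMonster.saturated (L := L) (𝕄 := 𝕄) (κ := κ) A (Set.image T F) hα hA (by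
    rintro _ ⟨C, hC, rfl⟩ (i | i)
    · exact Or.inr ⟨i, rfl⟩
    · exact Or.inl (hΦ1 C hC i)) (by
    intro S hS
    obtain ⟨S', hS', rfl⟩ := Finset.subset_set_image_iff.1 (show (S : Set _) ⊆ Set.image T F from hS)
    obtain ⟨x, hx⟩ := hfin S' hS'
    refine ⟨fun i => x i.down, ?_⟩
    intro φ hφ
    obtain ⟨C, hC, rfl⟩ := Finset.mem_image.1 hφ
    exact (hT C (hS' hC) _).2 (hx C hC))
  exact ⟨fun i => x ⟨i⟩, fun C hC => (hT C hC x).1 (hx _ ⟨C, hC, rfl⟩)⟩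

/-- The system of definable conditions over the model `M`. -/
def mkCtx (L : FirstOrder.Language.{u, v}) {𝕄 : Type w} [L.Structure 𝕄] (κ : Cardinal.{w})
    [IsMonster L 𝕄 κ] (M : L.ElementarySubstructure 𝕄) (hM : (M : Set 𝕄).Infinite)
    (hκ : Cardinal.mk ↥(M : Set 𝕄) < κ) : Ctx 𝕄 where
  M := M
  D := fun C => CD L (M : Set 𝕄) C
  d_not := CD.not
  d_and := CD.and
  d_true := CD.true
  d_comp := CD.comp
  d_supp := CD.supp
  d_ex := CD.ex
  d_mem := CD.mem
  d_tv := CD.tv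
  d_sat := CD.sat hM hκ
  ne := ⟨hM.nonempty.some⟩

end Wrap
end NSOP3Paper

namespace NSOP3Paper
open FirstOrder Language Ctx

section Wrap
variable {L : FirstOrder.Language.{u, v}} {𝕄 : Type w} [L.Structure 𝕄] {κ : Cardinal.{w}}
    [IsMonster L 𝕄 κ] {M : L.ElementarySubstructure 𝕄} {hM : (M : Set 𝕄).Infinite}
    {hκ : Cardinal.mk ↥(M : Set 𝕄) < κ}

lemma mk_n3 (h3 : IsNSOP3 L 𝕄) : (mkCtx L κ M hM hκ).N3 := by
  intro ζ _ R hR z hz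
  by_contra hno
  obtain ⟨m, ⟨e⟩⟩ := Finite.exists_equiv_fin ζ
  obtain ⟨φ, -, hφ⟩ := CD.comp (Sum.map e e) hR
  have key : ∀ x y : Fin m → 𝕄, φ.Realize (Sum.elim x y) ↔ R (Sum.elim (x ∘ e) (y ∘ e)) := by
    intro x y
    rw [← hφ]; beta_reduce; rw [Sum.elim_comp_map]
  refine h3 ⟨m, φ, fun i => z i ∘ e.symm, fun i j hij => ?_, ?_⟩
  · rw [key]
    simpa [Function.comp_assoc] using hz i j hij
  · rintro ⟨x1, x2, x3, h1, h2, h3⟩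
    rw [key] at h1 h2 h3
    exact hno ⟨_, _, _, h1, h2, h3⟩

/-- Coordinates of realizations. -/
def XP {n : ℕ} (Q : Set (ParamFormula L 𝕄 (Fin n))) (j : Fin n) : Set 𝕄 :=
  {y | ∃ e, RealizesPType L 𝕄 Q e ∧ y = e j}

lemma CD.eq {M : Set 𝕄} {α : Type} (i j : α) : CD L M fun x : α → 𝕄 => x i = x j :=
  ⟨⟨Empty, Term.equal (Term.var (Sum.inl i)) (Term.var (Sum.inl j)), Empty.elim⟩,
    fun i => i.elim, fun x => by simp [ParamFormula.Realize, Formula.realize_equal]⟩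

lemma mk_d {α : Type} (φ : ParamFormula L 𝕄 α) (hφ : φ.ParamsIn (M : Set 𝕄)) :
    (mkCtx L κ M hM hκ).D φ.Realize := ⟨φ, hφ, fun _ => Iff.rfl⟩

lemma tree_limit {K : Ctx 𝕄} {ξ β : Type} [Countable ξ] [Countable β] {nv : ℕ}
    {Q : Set ((Fin nv → 𝕄) → Prop)} (hQ : ∀ C ∈ Q, K.D C) (f : β → Fin nv)
    {S : (ξ ⊕ β → 𝕄) → Prop} (hS : K.D S)
    (h : ∀ N, ∃ B : List Bool → β → 𝕄, (∀ η i, ∃ e : Fin nv → 𝕄, (∀ C ∈ Q, C e) ∧ B η i = e (f i)) ∧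
      (∀ η : List Bool, η.length = N → ∃ x, ∀ i < N, S (x ⋈ B (η.take (i + 1)))) ∧
      (∀ η₁ η₂, (η₁ ++ [false]) <+: η₂ → η₂.length ≤ N →
        ¬∃ x, S (x ⋈ B η₂) ∧ S (x ⋈ B (η₁ ++ [true])))) :
    ∃ t : List Bool → β → Fin nv → 𝕄, (∀ η i, ∀ C ∈ Q, C (t η i)) ∧
      (∀ η : List Bool, ∃ x : ξ → 𝕄, ∀ i < η.length,
        S (x ⋈ fun j => t (η.take (i + 1)) j (f j))) ∧
      (∀ η₁ η₂, (η₁ ++ [false]) <+: η₂ →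
        ¬∃ x : ξ → 𝕄, S (x ⋈ fun j => t η₂ j (f j)) ∧ S (x ⋈ fun j => t (η₁ ++ [true]) j (f j))) := by
  classical
  let V : Type := List Bool × β × Fin nv
  let ι := (List Bool × β × Q) ⊕ List Bool ⊕ {q : List Bool × List Bool // (q.1 ++ [false]) <+: q.2}
  let C : ι → (V → 𝕄) → Prop := fun i z => match i with
    | Sum.inl (η, j, C) => C.1 fun k => z (η, j, k)
    | Sum.inr (Sum.inl η) => ∃ x : ξ → 𝕄, ∀ i < η.length,
        S (x ⋈ fun j => z (η.take (i + 1), j, f j))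
    | Sum.inr (Sum.inr q) => ¬∃ x : ξ → 𝕄, S (x ⋈ fun j => z (q.1.2, j, f j)) ∧
        S (x ⋈ fun j => z (q.1.1 ++ [true], j, f j))
  have hC : ∀ i, K.DA ∅ (C i) := by
    rintro (⟨η, j, C⟩ | η | q)
    · exact (K.d_comp (fun k => (η, j, k)) (hQ C.1 C.2)).da ∅
    · refine DA.ex_of (DA.lt _ fun i _ => D.da (hS.pull
        (fun z : V ⊕ ξ → 𝕄 => (fun a => z (Sum.inr a)) ⋈
          fun j => z (Sum.inl (η.take (i + 1), j, f j))) ?_) ∅)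
      rintro (i | i) <;> exact Or.inl ⟨_, fun _ => rfl⟩
    · refine (DA.ex_of (DA.and (D.da (hS.pull
        (fun z : V ⊕ ξ → 𝕄 => (fun a => z (Sum.inr a)) ⋈
          fun j => z (Sum.inl (q.1.2, j, f j))) ?_) ∅) (D.da (hS.pull
        (fun z : V ⊕ ξ → 𝕄 => (fun a => z (Sum.inr a)) ⋈
          fun j => z (Sum.inl (q.1.1 ++ [true], j, f j))) ?_) ∅))).not <;>
      rintro (i | i) <;> exact Or.inl ⟨_, fun _ => rfl⟩
  obtain ⟨z, hz⟩ := K.sat Set.countable_empty C hC (by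
    intro s
    let len : ι → ℕ := fun i => match i with
      | Sum.inl _ => 0
      | Sum.inr (Sum.inl η) => η.length
      | Sum.inr (Sum.inr q) => q.1.2.length
    obtain ⟨B, hB1, hB2, hB3⟩ := h (s.sup len)
    choose e he1 he2 using hB1
    have hB : ∀ η, (fun j => e η j (f j)) = B η := fun η => funext fun j => (he2 η j).symm
    refine ⟨fun v => e v.1 v.2.1 v.2.2, ?_⟩
    rintro (⟨η, j, C⟩ | η | q) hi
    · exact he1 η j C.1 C.2
    · have hl : η.length ≤ s.sup len := Finset.le_sup (f := len) hi
      obtain ⟨x, hx⟩ := hB2 (η ++ List.replicate (s.sup len - η.length) false) (by simp; omega)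
      refine ⟨x, fun i hi => ?_⟩
      have := hx i (by omega)
      rw [List.take_append_of_le_length (by omega)] at this
      simpa only [hB] using this
    · have hl : q.1.2.length ≤ s.sup len := Finset.le_sup (f := len) hi
      have := hB3 q.1.1 q.1.2 q.2 hl
      simpa only [C, hB] using this)
  exact ⟨fun η j k => z (η, j, k), fun η i D hD => hz (Sum.inl (η, i, ⟨D, hD⟩)),
    fun η => hz (Sum.inr (Sum.inl η)), fun η₁ η₂ hh => hz (Sum.inr (Sum.inr ⟨(η₁, η₂), hh⟩))⟩

lemma mk_ns {nv : ℕ} {Q : Set (ParamFormula L 𝕄 (Fin nv))}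
    (hQ : ∀ φ ∈ Q, φ.ParamsIn (M : Set 𝕄)) (hco : CoNSOP1 L 𝕄 (M : Set 𝕄) Q) :
    (mkCtx L κ M hM hκ).NS (XP Q) where
  closed := by
    rintro j y y' hE ⟨e, he, rfl⟩
    obtain ⟨e', hE'⟩ := hE.homog e
    refine ⟨e', fun φ hφ => ?_, ?_⟩
    · exact hE' _ ((mkCtx L κ M hM hκ).d_comp Sum.inr (mk_d φ (hQ φ hφ))) (he φ hφ)
    · exact hE' (fun z => z (Sum.inl ()) = z (Sum.inr j)) (CD.eq _ _) rfl
  bound := by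
    classical
    intro ξ β S f _ _ hS
    by_contra hno
    push Not at hno
    obtain ⟨t, ht1, ht2, ht3⟩ := tree_limit (K := mkCtx L κ M hM hκ)
      (Q := Set.image ParamFormula.Realize Q)
      (by rintro _ ⟨φ, hφ, rfl⟩; exact mk_d φ (hQ φ hφ)) f hS (by
        intro N
        obtain ⟨B, h1, h2, h3, -⟩ := hno N
        refine ⟨B, fun η i => ?_, h2, fun η₁ η₂ h h' => ?_⟩
        · obtain ⟨e, he, hy⟩ := h1 η i
          refine ⟨e, ?_, hy⟩
          rintro _ ⟨φ, hφ, rfl⟩; exact he φ hφ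
        · rintro ⟨x, hx⟩
          exact h3 η₁ η₂ h h' x hx.1 hx.2)
    obtain ⟨s, C0, hC0, hSC⟩ := (mkCtx L κ M hM hκ).d_supp hS
    obtain ⟨k, ⟨eξ⟩⟩ := Finite.exists_equiv_fin s.toLeft
    obtain ⟨m, ⟨eβ⟩⟩ := Finite.exists_equiv_fin s.toRight
    let g : s → Fin k ⊕ (Fin m × Fin nv) := fun i => match i with
      | ⟨Sum.inl a, ha⟩ => Sum.inl (eξ ⟨a, by simpa using ha⟩)
      | ⟨Sum.inr j, hj⟩ => Sum.inr (eβ ⟨j, by simpa using hj⟩, f j)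
    obtain ⟨φ, hφ, hφ'⟩ := CD.comp g hC0
    obtain ⟨z0⟩ := (mkCtx L κ M hM hκ).ne
    let bb : List Bool → Fin m → Fin nv → 𝕄 := fun η i => t (false :: η) (eβ.symm i)
    have key : ∀ (η : List Bool) (x : ξ → 𝕄),
        (φ.subst (flat (bb η))).Realize (fun i => x (eξ.symm i)) ↔
          S (x ⋈ fun j => t (false :: η) j (f j)) := by
      intro η x
      rw [subst_realize, ← hφ', hSC]
      beta_reduce
      apply iff_of_eq
      congr 1
      funext i
      rcases i with ⟨a | j, hi⟩ <;> simp [g, bb, flat]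
    have key2 : ∀ y : Fin k → 𝕄, ∃ x : ξ → 𝕄, (fun i => x (eξ.symm i)) = y := by
      intro y
      refine ⟨fun a => if ha : a ∈ s.toLeft then y (eξ ⟨a, ha⟩) else z0, ?_⟩
      funext i
      have := (eξ.symm i).2
      simp [this]
    refine hco ⟨k, m, φ, bb, hφ, ?_, ?_, ?_⟩
    · intro η j φ hφ
      exact ht1 _ _ _ ⟨φ, hφ, rfl⟩
    · intro σ F
      obtain ⟨x, hx⟩ := ht2 (false :: List.ofFn fun i : Fin (F.sup id) => σ i)
      refine ⟨_, fun n hn => (key _ x).2 ?_⟩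
      have hn' : n ≤ F.sup id := Finset.le_sup (f := id) hn
      have := hx n (by simp; omega)
      rw [List.take_succ_cons] at this
      have e : List.take n (List.ofFn fun i : Fin (F.sup id) => σ i) =
          List.ofFn fun i : Fin n => σ i := by
        apply List.ext_getElem
        · simp [hn']
        · intro i h1 h2; simp
      rwa [e] at this
    · rintro η₁ η₂ hp ⟨y, h1, h2⟩
      obtain ⟨x, rfl⟩ := key2 y
      rw [key] at h1 h2
      exact ht3 (false :: η₁) (false :: η₂) (by simpa using hp) ⟨x, h1, h2⟩

end Wrap
end NSOP3Paper

namespace NSOP3Paper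
open FirstOrder Language Ctx Filter

section Wrap
variable {L : FirstOrder.Language.{u, v}} {𝕄 : Type w} [L.Structure 𝕄] {κ : Cardinal.{w}}
    [IsMonster L 𝕄 κ] {M : L.ElementarySubstructure 𝕄} {hM : (M : Set 𝕄).Infinite}
    {hκ : Cardinal.mk ↥(M : Set 𝕄) < κ}

lemma mk_e_of_tpEq {α : Type} {u v : α → 𝕄} (h : TpEq L 𝕄 (M : Set 𝕄) u v) :
    (mkCtx L κ M hM hκ).E u v := by
  rintro C ⟨φ, hφ, hC⟩ hu
  exact (hC v).2 ((h φ hφ).1 ((hC u).1 hu))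

lemma mk_tpEq_of_e {α : Type} {u v : α → 𝕄} (h : (mkCtx L κ M hM hκ).E u v) :
    TpEq L 𝕄 (M : Set 𝕄) u v :=
  fun φ hφ => h.iff (mk_d φ hφ)

lemma mk_da {α : Type} (φ : ParamFormula L 𝕄 α) {A : Set 𝕄}
    (hφ : φ.ParamsIn ((M : Set 𝕄) ∪ A)) : (mkCtx L κ M hM hκ).DA A φ.Realize := by
  have h1 : (mkCtx L κ M hM hκ).D fun z : α ⊕ φ.Params → 𝕄 => φ.toFormula.Realize z := by
    refine ⟨⟨Empty, φ.toFormula.relabel Sum.inl, Empty.elim⟩, fun i => i.elim, fun x => ?_⟩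
    simp [ParamFormula.Realize, Formula.realize_relabel]
  exact DA.sub (h1.da A) φ.params hφ

lemma mk_form {P : Type} (ψ : L.Formula P) :
    (mkCtx L κ M hM hκ).D fun z : P → 𝕄 => ψ.Realize z := by
  refine ⟨⟨Empty, ψ.relabel Sum.inl, Empty.elim⟩, fun i => i.elim, fun x => ?_⟩
  simp [ParamFormula.Realize, Formula.realize_relabel]

lemma mk_tpEq_range {α δ : Type} {x a : α → 𝕄} {d : δ → 𝕄}
    (h : (mkCtx L κ M hM hκ).E (Sum.elim x d) (Sum.elim a d)) :
    TpEq L 𝕄 ((M : Set 𝕄) ∪ Set.range d) x a := by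
  intro φ hφ
  obtain ⟨S, hS, hS'⟩ := (mk_da (hM := hM) (hκ := hκ) φ hφ).range
  rw [hS', hS']
  exact h.iff hS

lemma gt_ultra {P : Type} (p : GlobalType L 𝕄 P) : ∃ U : Ultrafilter (P → 𝕄),
    ∀ φ, p.Mem φ ↔ ∀ᶠ x in (U : Filter (P → 𝕄)), φ.Realize x := by
  classical
  obtain ⟨U, hU⟩ := Ultrafilter.exists_ultrafilter_of_finite_inter_nonempty
    ({s : Set (P → 𝕄) | ∃ φ, p.Mem φ ∧ s = {x | φ.Realize x}}) (by
      intro T hT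
      have hT' : ∀ s : T, ∃ φ, p.Mem φ ∧ s.1 = {x | φ.Realize x} := fun s => hT s.2
      choose φ hφ hs using hT'
      obtain ⟨m, hm⟩ := p.consistent (Finset.univ.image φ) (by
        intro ψ hψ
        obtain ⟨s, -, rfl⟩ := Finset.mem_image.1 hψ
        exact hφ s)
      refine ⟨m, ?_⟩
      simp only [Set.mem_sInter]
      intro s hsT
      have := hs ⟨s, hsT⟩
      simp only at this
      rw [this]
      exact hm _ (Finset.mem_image_of_mem _ (Finset.mem_univ _)))
  refine ⟨U, fun φ => ⟨fun h => hU ⟨φ, h, rfl⟩, fun h => ?_⟩⟩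
  rcases p.complete φ with h1 | h1
  · exact h1
  · have h2 : {x | φ.not.Realize x} ∈ U := hU ⟨φ.not, h1, rfl⟩
    obtain ⟨x, hx, hx'⟩ := (h.and h2).exists
    exact (hx' hx).elim

lemma mor_of_invMorley {P : Type} {s : ℕ → P → 𝕄} (h : IsInvMorleyOver L 𝕄 (M : Set 𝕄) s) :
    ∃ U, (mkCtx L κ M hM hκ).Inv U ∧ (mkCtx L κ M hM hκ).Mor U s := by
  obtain ⟨p, hp, hs⟩ := h
  obtain ⟨U, hU⟩ := gt_ultra p
  refine ⟨U, ?_, ?_⟩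
  · rintro R S e e' ⟨φ, hφ, hS⟩ hE h1
    simp only [hS, ← subst_realize, ← hU] at h1 ⊢
    refine (hp _ _ _ _ ?_).1 h1
    apply mk_tpEq_of_e (κ := κ) (hM := hM) (hκ := hκ)
    intro C hC
    exact hE (fun x => C (Sum.elim x φ.params)) ((mkCtx L κ M hM hκ).d_mem _ hφ hC)
  · intro i C hC h1
    obtain ⟨R, S, e, ⟨φ, hφ, hS⟩, he, hCS⟩ := hC
    simp only [hCS, hS, ← subst_realize, ← hU] at h1 ⊢
    refine hs i _ h1 ?_
    rintro (j | j)
    · obtain ⟨k, hk, l, hl⟩ := he j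
      refine Or.inr ?_
      simp only [Set.mem_iUnion]
      exact ⟨k, hk, l, hl⟩
    · exact Or.inl (hφ j)

lemma invMorley_of_mor {P : Type} {s : ℕ → P → 𝕄} {U : Ultrafilter (P → 𝕄)}
    (hU : (mkCtx L κ M hM hκ).Inv U) (hs : (mkCtx L κ M hM hκ).Mor U s) :
    IsInvMorleyOver L 𝕄 (M : Set 𝕄) s := by
  refine ⟨⟨fun φ => ∀ᶠ x in (U : Filter (P → 𝕄)), φ.Realize x, ?_, ?_⟩, ?_, ?_⟩
  · intro S hS
    exact ((Filter.eventually_all_finset S).2 hS).exists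
  · intro φ
    exact Ultrafilter.eventually_or.1 (Eventually.of_forall fun x => Classical.em (φ.Realize x))
  · intro R ψ e e' hE
    have hE' := mk_e_of_tpEq (κ := κ) (hM := hM) (hκ := hκ) hE
    exact ⟨hU R _ e e' (mk_form ψ) hE', hU R _ e' e (mk_form ψ) hE'.symm⟩
  · intro i φ h1 h2
    refine hs i _ (mk_da φ ?_) h1
    intro j
    rcases h2 j with h | h
    · exact Or.inl h
    · simp only [Set.mem_iUnion] at h
      obtain ⟨k, hk, l, hl⟩ := h
      exact Or.inr ⟨k, hk, l, hl⟩

lemma wk_of_ind {α β : Type} {a : α → 𝕄} {b : β → 𝕄}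
    (h : IndConant L 𝕄 (M : Set 𝕄) (Set.range b) a) : (mkCtx L κ M hM hκ).Wk a b := by
  rintro S ⟨ψ, hψ, hS⟩ hab n
  have h1 : ¬ (ψ.subst b).ConantDividesOver (M : Set 𝕄) := by
    intro hd
    refine h (ψ.subst b) ?_ ((subst_realize ψ b a).2 ((hS _).1 hab)) ⟨1, fun _ => ψ.subst b,
      fun _ => hd, fun x hx => ⟨0, hx⟩⟩
    rintro (i | i)
    · exact Or.inr ⟨i, rfl⟩
    · exact Or.inl (hψ i)
  unfold ParamFormula.ConantDividesOver at h1
  push Not at h1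
  obtain ⟨s, hs0, hs, hcons⟩ := h1
  obtain ⟨U, hU, hmor⟩ := mor_of_invMorley (κ := κ) (hM := hM) (hκ := hκ) hs
  have hE : ∀ i, (mkCtx L κ M hM hκ).E (s i) (s 0) :=
    hmor.e ((hmor 0).mono (Set.empty_subset _))
  have hconst : ∀ i q, s i (Sum.inr q) = ψ.params q := by
    intro i q
    have := (hE i).symm (fun x => x (Sum.inr q) = ψ.params q)
      ((mkCtx L κ M hM hκ).d_mem (C := fun z => z (Sum.inl (Sum.inr q)) = z (Sum.inr q))
        ψ.params hψ (CD.eq _ _)) (by rw [hs0]; rfl)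
    exact this
  refine ⟨fun i => s i ∘ Sum.inl, fun i _ => ⟨?_, ?_⟩, ?_⟩
  · have := (hE i).comp (Sum.inl : β → β ⊕ ψ.Params)
    rw [hs0] at this
    exact this
  · exact ⟨_, hU.map _, (hmor.map Sum.inl) i⟩
  · obtain ⟨x, hx⟩ := hcons (Finset.range n)
    refine ⟨x, fun i hi => ?_⟩
    have := hx i (by simpa using hi)
    rw [hS]
    have e : s i = Sum.elim (s i ∘ Sum.inl) ψ.params := by
      funext q
      rcases q with q | q
      · rfl
      · exact hconst i q
    have h3 : (ψ.subst (s i ∘ Sum.inl)).Realize x := by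
      unfold ParamFormula.Realize
      change (ψ.subst b).toFormula.Realize (Sum.elim x (Sum.elim (s i ∘ Sum.inl) ψ.params))
      rw [← e]
      exact this
    exact (subst_realize _ _ _).1 h3

lemma ind_exists {α : Type} {a : α → 𝕄} {B : Set 𝕄} (h : IndConant L 𝕄 (M : Set 𝕄) B a)
    {Q : Type} (q : Q → 𝕄) : ∃ s : ℕ → Q → 𝕄, s 0 = q ∧ IsInvMorleyOver L 𝕄 (M : Set 𝕄) s := by
  by_contra hno
  push Not at hno
  refine h ⟨Empty, ⊤, Empty.elim⟩ (fun i => i.elim) (by simp [ParamFormula.Realize])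
    ⟨1, fun _ => ⟨Q, ⊤, q⟩, fun _ s hs0 hs => (hno s hs0 hs).elim, fun x _ => ⟨0, ?_⟩⟩
  simp [ParamFormula.Realize]

lemma ind_of_wk {α δ J : Type} [Finite α] [Countable δ] {Y : J → Set 𝕄}
    (hY : (mkCtx L κ M hM hκ).NS Y) {x : α → 𝕄} {d : δ → 𝕄} (hd : Good Y d)
    (hwk : (mkCtx L κ M hM hκ).Wk x d)
    (hex : ∀ (Q : Type) (q : Q → 𝕄), ∃ s : ℕ → Q → 𝕄, s 0 = q ∧
      IsInvMorleyOver L 𝕄 (M : Set 𝕄) s) :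
    IndConant L 𝕄 (M : Set 𝕄) (Set.range d) x := by
  classical
  rintro φ hφ hx ⟨k, ψ, hψ, himp⟩
  obtain ⟨S, hS, hS'⟩ := (mk_da (hM := hM) (hκ := hκ) φ hφ).range
  let Q : Type := δ ⊕ (Σ j, (ψ j).Params)
  let q : Q → 𝕄 := Sum.elim d fun r => (ψ r.1).params r.2
  obtain ⟨s, hs0, hs⟩ := hex Q q
  obtain ⟨U, hU, hmor⟩ := mor_of_invMorley (κ := κ) (hM := hM) (hκ := hκ) hs
  have hE : ∀ i, (mkCtx L κ M hM hκ).E (s 0) (s i) := fun i =>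
    (hmor.e ((hmor 0).mono (Set.empty_subset _)) i).symm
  have hst := (hwk S hS ((hS' x).1 hx)).st hY hd hS _ (hU.map (Sum.inl : δ → Q)) (by
    have := (((hmor 0).mono (Set.empty_subset _)).map (Sum.inl : δ → Q))
    rw [hs0] at this
    exact this) _ (hmor.map Sum.inl)
  -- a realization of all instances
  obtain ⟨y, hy⟩ := (mkCtx L κ M hM hκ).sat (A := ⋃ i, Set.range (s i ∘ (Sum.inl : δ → Q)))
    (Set.countable_iUnion fun i => Set.countable_range _)
    (fun (i : ℕ) (y : α → 𝕄) => S (Sum.elim y (s i ∘ Sum.inl)))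
    (fun i => hS.sub _ fun j => Set.mem_iUnion.2 ⟨i, j, rfl⟩) (by
      intro F
      obtain ⟨y, hy⟩ := hst (F.sup id + 1)
      exact ⟨y, fun i hi => hy i (Nat.lt_succ_of_le (Finset.le_sup (f := id) hi))⟩)
  -- the implication transfers
  have himp' : ∀ i, ∀ y : α → 𝕄, S (Sum.elim y (s i ∘ Sum.inl)) →
      ∃ j, (ψ j).toFormula.Realize (Sum.elim y fun p => s i (Sum.inr ⟨j, p⟩)) := by
    intro i
    refine hE i (fun z => ∀ y : α → 𝕄, S (Sum.elim y (z ∘ Sum.inl)) →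
      ∃ j, (ψ j).toFormula.Realize (Sum.elim y fun p => z (Sum.inr ⟨j, p⟩))) ?_ ?_
    · refine DA.d (DA.all_of (DA.imp (D.da ?_ ∅) ?_))
      · exact hS.pull (fun z : Q ⊕ α → 𝕄 => Sum.elim (z ∘ Sum.inr) ((z ∘ Sum.inl) ∘ Sum.inl))
          (by rintro (i | i) <;> exact Or.inl ⟨_, fun _ => rfl⟩)
      · have := DA.bex (K := mkCtx L κ M hM hκ) (A := ∅) (Finset.univ : Finset (Fin k))
          (C := fun j (z : Q ⊕ α → 𝕄) => (ψ j).toFormula.Realize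
            (Sum.elim (z ∘ Sum.inr) fun p => z (Sum.inl (Sum.inr ⟨j, p⟩)))) (fun j _ =>
            D.da ((mk_form (ψ j).toFormula).pull (fun z : Q ⊕ α → 𝕄 =>
              Sum.elim (z ∘ Sum.inr) fun p => z (Sum.inl (Sum.inr ⟨j, p⟩)))
              (by rintro (i | i) <;> exact Or.inl ⟨_, fun _ => rfl⟩)) ∅)
        simpa using this
    · intro y hy
      rw [hs0] at hy ⊢
      exact himp y ((hS' y).2 hy)
  have hj : ∀ i, ∃ j, (ψ j).toFormula.Realize (Sum.elim y fun p => s i (Sum.inr ⟨j, p⟩)) :=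
    fun i => himp' i y (hy i)
  choose jj hjj using hj
  obtain ⟨j, hj⟩ := Finite.exists_infinite_fiber jj
  have hinf : (jj ⁻¹' {j}).Infinite := Set.infinite_coe_iff.1 hj
  let f : ℕ → ℕ := Nat.nth (fun i => i ∈ jj ⁻¹' {j})
  have hf : StrictMono f := Nat.nth_strictMono hinf
  have hfj : ∀ i, jj (f i) = j := fun i => Nat.nth_mem_of_infinite hinf i
  refine hψ j (fun i => s i ∘ fun p => Sum.inr ⟨j, p⟩) ?_ (invMorley_of_mor (hU.map _)
    (hmor.map _)) ?_
  · rw [hs0]; rfl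
  · intro F
    have huniq := (hmor.sub hf).unique hU hmor (F.sup id + 1)
    obtain ⟨y', hy'⟩ := huniq (fun z => ∃ y : α → 𝕄, ∀ i : Fin (F.sup id + 1),
      (ψ j).toFormula.Realize (Sum.elim y fun p => z (i, Sum.inr ⟨j, p⟩)))
      (DA.d (DA.ex_of (DA.all_fin fun i => D.da ((mk_form (ψ j).toFormula).pull
        (fun z : (Fin (F.sup id + 1) × Q) ⊕ α → 𝕄 => Sum.elim (z ∘ Sum.inr)
          fun p => z (Sum.inl (i, Sum.inr ⟨j, p⟩)))
        (by rintro (i | i) <;> exact Or.inl ⟨_, fun _ => rfl⟩)) ∅)))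
      ⟨y, fun i => by
        have := hjj (f i)
        rw [hfj] at this
        exact this⟩
    exact ⟨y', fun i hi => hy' ⟨i, Nat.lt_succ_of_le (Finset.le_sup (f := id) hi)⟩⟩

end Wrap
end NSOP3Paper

namespace NSOP3Paper

open FirstOrder Language

universe u v w w' w₂ x y z

/-- the independence theorem for two co-NSOP₁ types in an NSOP₃
theory. -/
theorem statement_14
    (L : FirstOrder.Language.{u, v}) (𝕄 : Type w) [L.Structure 𝕄]
    (κ : Cardinal.{w}) [IsMonster L 𝕄 κ]
    (M : L.ElementarySubstructure 𝕄) (hMsmall : Cardinal.mk ↥(M : Set 𝕄) < κ)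
    (hNSOP3 : IsNSOP3 L 𝕄)
    {nv₁ nv₂ : ℕ}
    (P : Set (ParamFormula L 𝕄 (Fin nv₁))) (Q : Set (ParamFormula L 𝕄 (Fin nv₂)))
    (hPparams : ∀ φ ∈ P, φ.ParamsIn (M : Set 𝕄)) (hQparams : ∀ φ ∈ Q, φ.ParamsIn (M : Set 𝕄))
    (hcoP : CoNSOP1 L 𝕄 (M : Set 𝕄) P) (hcoQ : CoNSOP1 L 𝕄 (M : Set 𝕄) Q)
    {ma mb mc : ℕ}
    (a a' : Fin ma → Fin nv₁ → 𝕄) (b : Fin mb → Fin nv₂ → 𝕄) (c : Fin mc → Fin nv₂ → 𝕄)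
    (haP : ∀ j, RealizesPType L 𝕄 P (a j)) (ha'P : ∀ j, RealizesPType L 𝕄 P (a' j))
    (hbQ : ∀ j, RealizesPType L 𝕄 Q (b j)) (hcQ : ∀ j, RealizesPType L 𝕄 Q (c j))
    (heq : TpEq L 𝕄 (M : Set 𝕄) (flat a) (flat a'))
    (hab : IndConant L 𝕄 (M : Set 𝕄) (Set.range (flat b)) (flat a))
    (ha'c : IndConant L 𝕄 (M : Set 𝕄) (Set.range (flat c)) (flat a'))
    (hcb : IndConant L 𝕄 (M : Set 𝕄) (Set.range (flat b)) (flat c)) :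
    ∃ a'' : Fin ma → Fin nv₁ → 𝕄,
      IndConant L 𝕄 (M : Set 𝕄) (Set.range (flat b) ∪ Set.range (flat c)) (flat a'') ∧
      TpEq L 𝕄 ((M : Set 𝕄) ∪ Set.range (flat b)) (flat a'') (flat a) ∧
      TpEq L 𝕄 ((M : Set 𝕄) ∪ Set.range (flat c)) (flat a'') (flat a') := by
  classical
  by_cases hM : (M : Set 𝕄).Infinite
  · have hE := mk_e_of_tpEq (κ := κ) (hM := hM) (hκ := hMsmall) heq
    have hX := mk_ns (κ := κ) (hM := hM) (hκ := hMsmall) hPparams hcoP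
    have hY := mk_ns (κ := κ) (hM := hM) (hκ := hMsmall) hQparams hcoQ
    have hga : Ctx.Good (XP P) (flat a) := ⟨Prod.snd, fun i => ⟨_, haP i.1, rfl⟩⟩
    have hgb : Ctx.Good (XP Q) (flat b) := ⟨Prod.snd, fun i => ⟨_, hbQ i.1, rfl⟩⟩
    have hgc : Ctx.Good (XP Q) (flat c) := ⟨Prod.snd, fun i => ⟨_, hcQ i.1, rfl⟩⟩
    obtain ⟨x, h1, h2, h3⟩ := Ctx.ind_thm (mk_n3 (κ := κ) (hM := hM) (hκ := hMsmall) hNSOP3) hX hY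
      hga hgb hgc hE (wk_of_ind hab) (wk_of_ind ha'c) (wk_of_ind hcb)
    have hx : flat (fun i j => x (i, j)) = x := rfl
    refine ⟨fun i j => x (i, j), ?_, ?_, ?_⟩
    · rw [hx, ← Set.Sum.elim_range]
      exact ind_of_wk hY (hgb.pair hgc) h3 (fun Q q => ind_exists hab q)
    · rw [hx]; exact mk_tpEq_range h1
    · rw [hx]; exact mk_tpEq_range h2
  · have huniv := univ_of_finite M (Set.not_infinite.1 hM)
    have haa : flat a = flat a' := by
      funext i
      have := (heq ⟨Unit, Term.equal (Term.var (Sum.inl i)) (Term.var (Sum.inr ())),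
        fun _ => flat a i⟩ (fun _ => huniv _)).1
        (by simp [ParamFormula.Realize, Formula.realize_equal])
      simpa [ParamFormula.Realize, Formula.realize_equal] using this.symm
    refine ⟨a, fun φ _ => hab φ fun i => Or.inl (huniv _), fun φ _ => Iff.rfl, fun φ _ => ?_⟩
    rw [haa]

end NSOP3Paper
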